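/- arXiv:1712.09861 — 2 statements merged into one kernel-verified Lean document; each statement's English description precedes it below -/
import Mathlib

section
/- Let q be a power of a prime p ≥ 5 and let n ≥ 3 be a positive integer. Then there exists an element α ∈ F_{q^n} that is simultaneously 2-primitive and 1-normal over F_q. -/
/-- The `F_q`-span of the conjugates `α, α^q, …, α^{q^{n-1}}` of `α ∈ F_{q^n}`. -/
def conjSpan (K : Type*) {L : Type*} [Field K] [Field L] [Algebra K L]
    (q n : ℕ) (α : L) : Submodule K L :=
  Submodule.span K (Set.range fun i : Fin n => α ^ q ^ (i : ℕ))

open Finset Polynomial UniqueFactorizationMonoid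

/-- The sums of `w` twisted by an arbitrary additive and a nontrivial multiplicative character
are bounded by `A`. -/
def TwistBound {L : Type*} [Field L] [Fintype L] (w : L → ℂ) (A : ℝ) : Prop :=
  ∀ (ψ : AddChar L ℂ) (χ : MulChar L ℂ), χ ≠ 1 → ‖∑ x, w x * (ψ x * χ x)‖ ≤ A

lemma norm_gaussSum_le {L : Type*} [Field L] [Fintype L] (ψ : AddChar L ℂ) (χ : MulChar L ℂ)
    (hχ : χ ≠ 1) : ‖gaussSum χ ψ‖ ≤ √(Fintype.card L) := by
  by_cases hψ : ψ = 1
  · rw [hψ, gaussSum_one_right hχ]; simp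
  · have h := gaussSum_mul_gaussSum_eq_card hχ (AddChar.IsPrimitive.of_ne_one hψ)
    rw [← star_gaussSum_eq] at h
    have h2 : ‖gaussSum χ ψ‖ ^ 2 = Fintype.card L := by
      have := congrArg (‖·‖) h
      rw [norm_mul, norm_star] at this
      rw [sq, this]; simp
    rw [← h2, Real.sqrt_sq (norm_nonneg _)]

lemma twistBound_one {L : Type*} [Field L] [Fintype L] :
    TwistBound (fun _ : L => (1 : ℂ)) √(Fintype.card L) := by
  intro ψ χ hχ
  have := norm_gaussSum_le ψ χ hχ
  simpa [gaussSum, mul_comm] using this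

section Subspace

variable {L : Type*} [Field L] [Fintype L] (V : AddSubgroup L) [DecidablePred (· ∈ V)]

lemma indicator_eq_sum_addChar [Fintype (L ⧸ V)] (x : L) :
    (if x ∈ V then (1 : ℂ) else 0) =
      (V.index : ℂ)⁻¹ * ∑ ψ : AddChar (L ⧸ V) ℂ, ψ (QuotientAddGroup.mk x) := by
  classical
  simp only [AddChar.sum_apply_eq_ite, QuotientAddGroup.eq_zero_iff]
  have hc : (Fintype.card (L ⧸ V)) = V.index := by
    rw [AddSubgroup.index, Nat.card_eq_fintype_card]
  have : (V.index : ℂ) ≠ 0 := by exact_mod_cast AddSubgroup.index_ne_zero_of_finite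
  split_ifs
  · rw [hc, inv_mul_cancel₀ this]
  · simp

lemma sum_mul_indicator (w : L → ℂ) [Fintype (L ⧸ V)] (φ : AddChar L ℂ) (χ : MulChar L ℂ) :
    ∑ x, (w x * if x ∈ V then (1 : ℂ) else 0) * (φ x * χ x) =
      (V.index : ℂ)⁻¹ * ∑ ψ : AddChar (L ⧸ V) ℂ, ∑ x, w x *
        ((φ * ψ.compAddMonoidHom (QuotientAddGroup.mk' V)) x * χ x) := by
  rw [sum_comm, mul_sum]
  refine sum_congr rfl fun x _ => ?_
  rw [indicator_eq_sum_addChar]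
  simp only [AddChar.mul_apply, AddChar.compAddMonoidHom_apply, mul_sum, sum_mul,
    QuotientAddGroup.coe_mk']
  exact sum_congr rfl fun ψ _ => by ring

variable {V}
variable {w : L → ℂ} {A : ℝ}

lemma index_pos_real (V : AddSubgroup L) : (0 : ℝ) < V.index := by
  exact_mod_cast Nat.pos_of_ne_zero AddSubgroup.index_ne_zero_of_finite

lemma TwistBound.mul_indicator (h : TwistBound w A) :
    TwistBound (fun x => w x * if x ∈ V then (1 : ℂ) else 0) A := by
  classical
  have := Fintype.ofFinite (L ⧸ V)
  intro φ χ hχ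
  rw [sum_mul_indicator, norm_mul, norm_inv, Complex.norm_natCast,
    inv_mul_le_iff₀ (index_pos_real V)]
  refine (norm_sum_le _ _).trans ((sum_le_card_nsmul _ _ A fun ψ _ => h _ χ hχ).trans ?_)
  rw [card_univ, AddChar.card_eq, nsmul_eq_mul, AddSubgroup.index, Nat.card_eq_fintype_card]

lemma TwistBound.mul_indicator_sub (h : TwistBound w A) :
    TwistBound (fun x => w x * ((if x ∈ V then (1 : ℂ) else 0) - (V.index : ℂ)⁻¹))
      ((1 - (V.index : ℝ)⁻¹) * A) := by
  classical
  have := Fintype.ofFinite (L ⧸ V)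
  intro φ χ hχ
  have hpos := index_pos_real V
  have key : ∑ x, (w x * ((if x ∈ V then (1 : ℂ) else 0) - (V.index : ℂ)⁻¹)) * (φ x * χ x) =
      (V.index : ℂ)⁻¹ * ∑ ψ ∈ univ.erase (1 : AddChar (L ⧸ V) ℂ), ∑ x, w x *
        ((φ * ψ.compAddMonoidHom (QuotientAddGroup.mk' V)) x * χ x) := by
    have h1 := sum_mul_indicator V w φ χ
    rw [← add_sum_erase univ _ (mem_univ (1 : AddChar (L ⧸ V) ℂ)), mul_add] at h1
    have h2 : ∑ x, (w x * ((if x ∈ V then (1 : ℂ) else 0) - (V.index : ℂ)⁻¹)) * (φ x * χ x) =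
        ∑ x, (w x * if x ∈ V then (1 : ℂ) else 0) * (φ x * χ x) -
          (V.index : ℂ)⁻¹ * ∑ x, w x * (φ x * χ x) := by
      rw [mul_sum, ← sum_sub_distrib]
      exact sum_congr rfl fun x _ => by ring
    rw [h2, h1]
    simp
  rw [key, norm_mul, norm_inv, Complex.norm_natCast, inv_mul_le_iff₀ hpos]
  refine (norm_sum_le _ _).trans ((sum_le_card_nsmul _ _ A fun ψ _ => h _ χ hχ).trans ?_)
  rw [card_erase_of_mem (mem_univ _), card_univ, AddChar.card_eq, nsmul_eq_mul,
    ← Nat.card_eq_fintype_card]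
  change ((V.index - 1 : ℕ) : ℝ) * A ≤ _
  rw [Nat.cast_sub (Nat.one_le_iff_ne_zero.2 AddSubgroup.index_ne_zero_of_finite)]
  apply le_of_eq
  field_simp
  push_cast
  ring

lemma TwistBound.mul_one_sub_indicator (h : TwistBound w A) :
    TwistBound (fun x => w x * (1 - if x ∈ V then (1 : ℂ) else 0))
      (2 * (1 - (V.index : ℝ)⁻¹) * A) := by
  intro φ χ hχ
  have h1 := h.mul_indicator_sub (V := V) φ χ hχ
  have h2 := h φ χ hχ
  have hle : (0 : ℝ) ≤ 1 - (V.index : ℝ)⁻¹ := by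
    have : (1 : ℝ) ≤ V.index := by
      exact_mod_cast (Nat.one_le_iff_ne_zero.2 AddSubgroup.index_ne_zero_of_finite)
    have := inv_le_one_of_one_le₀ this
    linarith
  have e : ∑ x, (w x * (1 - if x ∈ V then (1 : ℂ) else 0)) * (φ x * χ x) =
      ((1 - (V.index : ℝ)⁻¹ : ℝ) : ℂ) * ∑ x, w x * (φ x * χ x) -
      ∑ x, (w x * ((if x ∈ V then (1 : ℂ) else 0) - (V.index : ℂ)⁻¹)) * (φ x * χ x) := by
    rw [mul_sum, ← sum_sub_distrib]
    refine sum_congr rfl fun x _ => ?_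
    push_cast
    ring
  rw [e]
  refine (norm_sub_le _ _).trans ?_
  rw [norm_mul, Complex.norm_real, Real.norm_of_nonneg hle]
  nlinarith

end Subspace

/-- The combination `∑_{j < e} c j χ^j` of the powers of a multiplicative character. -/
noncomputable def charComb {L : Type*} [Field L] (χ : MulChar L ℂ) (e : ℕ) (c : ℕ → ℝ)
    (x : L) : ℂ :=
  ∑ j ∈ range e, (c j : ℂ) * (χ ^ j) x

lemma mulChar_mul_pow_eq_one {L : Type*} [Field L] {χ η : MulChar L ℂ} {k j : ℕ}
    (hk : χ ^ k = 1) (hc : k.Coprime (orderOf η)) (hj : j < orderOf η) (h : χ * η ^ j = 1) :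
    j = 0 ∧ χ = 1 := by
  have h1 : η ^ (j * k) = 1 := by
    have := congrArg (· ^ k) h
    simpa [mul_pow, hk, ← pow_mul] using this
  have h2 : orderOf η ∣ j := hc.symm.dvd_of_dvd_mul_right (orderOf_dvd_of_pow_eq_one h1)
  have h3 : j = 0 := Nat.eq_zero_of_dvd_of_lt h2 hj
  subst h3
  simpa using h

section Core

variable {L : Type*} [Field L] [Fintype L] {ι : Type*} [DecidableEq ι]
  {η : ι → MulChar L ℂ} {c : ι → ℕ → ℝ} {m W : ι → ℝ} {w : L → ℂ} {E : ℝ}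

lemma core_bound (hw : ∀ χ : MulChar L ℂ, χ ≠ 1 → ‖∑ x, w x * χ x‖ ≤ E)
    (C : Finset ι)
    (hcop : (C : Set ι).Pairwise fun i j => (orderOf (η i)).Coprime (orderOf (η j)))
    (hpos : ∀ i ∈ C, 0 < orderOf (η i))
    (hm : ∀ i ∈ C, c i 0 = m i) (hm0 : ∀ i ∈ C, 0 ≤ m i) (hW0 : ∀ i ∈ C, 0 ≤ W i)
    (hW : ∀ i ∈ C, ∑ j ∈ range (orderOf (η i)), |c i j| = m i * W i) :
    (∀ (χ : MulChar L ℂ) (k : ℕ), χ ^ k = 1 → (∀ i ∈ C, k.Coprime (orderOf (η i))) → χ ≠ 1 →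
      ‖∑ x, w x * ((∏ i ∈ C, charComb (η i) (orderOf (η i)) (c i) x) * χ x)‖ ≤
        (∏ i ∈ C, m i) * (∏ i ∈ C, W i) * E) ∧
    ‖∑ x, w x * ((∏ i ∈ C, charComb (η i) (orderOf (η i)) (c i) x) * (1 : MulChar L ℂ) x) -
      ((∏ i ∈ C, m i : ℝ) : ℂ) * ∑ x, w x * (1 : MulChar L ℂ) x‖ ≤
        (∏ i ∈ C, m i) * ((∏ i ∈ C, W i) - 1) * E := by
  induction C using Finset.induction_on with
  | empty =>
    refine ⟨fun χ k _ _ hχ => by simpa using hw χ hχ, by simp⟩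
  | insert a C ha ih =>
    have hins : ∀ i ∈ C, i ∈ insert a C := fun i hi => mem_insert_of_mem hi
    obtain ⟨ih1, ih2⟩ := ih
      (hcop.mono (by simp)) (fun i hi => hpos i (hins i hi)) (fun i hi => hm i (hins i hi))
      (fun i hi => hm0 i (hins i hi)) (fun i hi => hW0 i (hins i hi))
      (fun i hi => hW i (hins i hi))
    have haI : a ∈ insert a C := mem_insert_self _ _
    have expand : ∀ χ : MulChar L ℂ,
        ∑ x, w x * ((∏ i ∈ insert a C, charComb (η i) (orderOf (η i)) (c i) x) * χ x) =
        ∑ j ∈ range (orderOf (η a)), (c a j : ℂ) *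
          ∑ x, w x * ((∏ i ∈ C, charComb (η i) (orderOf (η i)) (c i) x) * (χ * η a ^ j) x) := by
      intro χ
      simp_rw [mul_sum]
      rw [sum_comm]
      refine sum_congr rfl fun x _ => ?_
      rw [prod_insert ha]
      conv_lhs => rw [charComb]
      simp_rw [sum_mul, mul_sum]
      refine sum_congr rfl fun j _ => ?_
      rw [MulChar.mul_apply]
      ring
    have hacop : ∀ i ∈ C, (orderOf (η a)).Coprime (orderOf (η i)) := fun i hi =>
      hcop (by simp) (by simp [hi]) (by rintro rfl; exact ha hi)
    have hP : 0 ≤ ∏ i ∈ C, m i := prod_nonneg fun i hi => hm0 i (hins i hi)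
    have hQ : 0 ≤ ∏ i ∈ C, W i := prod_nonneg fun i hi => hW0 i (hins i hi)
    have term : ∀ (χ : MulChar L ℂ) (k : ℕ), χ ^ k = 1 →
        (∀ i ∈ insert a C, k.Coprime (orderOf (η i))) → ∀ j ∈ range (orderOf (η a)),
        (χ ≠ 1 ∨ j ≠ 0) →
        ‖∑ x, w x * ((∏ i ∈ C, charComb (η i) (orderOf (η i)) (c i) x) * (χ * η a ^ j) x)‖ ≤
          (∏ i ∈ C, m i) * (∏ i ∈ C, W i) * E := by
      intro χ k hk hkc j hj hne
      refine ih1 (χ * η a ^ j) (k * orderOf (η a)) ?_ ?_ ?_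
      · rw [mul_pow, pow_mul, hk, one_pow, one_mul, ← pow_mul,
          show j * (k * orderOf (η a)) = orderOf (η a) * (j * k) by ring, pow_mul,
          pow_orderOf_eq_one, one_pow]
      · exact fun i hi => Nat.Coprime.mul_left (hkc i (hins i hi)) (hacop i hi)
      · intro h
        obtain ⟨h1, h2⟩ := mulChar_mul_pow_eq_one hk (hkc a haI) (mem_range.1 hj) h
        tauto
    constructor
    · intro χ k hk hkc hχ
      rw [expand]
      refine (norm_sum_le _ _).trans ?_
      calc _ ≤ ∑ j ∈ range (orderOf (η a)), |c a j| * ((∏ i ∈ C, m i) * (∏ i ∈ C, W i) * E) := by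
            refine sum_le_sum fun j hj => ?_
            rw [norm_mul, Complex.norm_real, Real.norm_eq_abs]
            exact mul_le_mul_of_nonneg_left (term χ k hk hkc j hj (Or.inl hχ)) (abs_nonneg _)
        _ = _ := by
            rw [← sum_mul, hW a haI, prod_insert ha, prod_insert ha]; ring
    · rw [expand]
      have h0 : 0 ∈ range (orderOf (η a)) := mem_range.2 (hpos a haI)
      rw [← add_sum_erase _ _ h0, hm a haI]
      have hsum : ∑ j ∈ (range (orderOf (η a))).erase 0, |c a j| = m a * W a - m a := by
        have := hW a haI
        rw [← add_sum_erase _ _ h0, hm a haI, abs_of_nonneg (hm0 a haI)] at this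
        linarith
      have e2 : ‖∑ j ∈ (range (orderOf (η a))).erase 0, (c a j : ℂ) *
          ∑ x, w x * ((∏ i ∈ C, charComb (η i) (orderOf (η i)) (c i) x) *
            ((1 : MulChar L ℂ) * η a ^ j) x)‖ ≤
          (m a * W a - m a) * ((∏ i ∈ C, m i) * (∏ i ∈ C, W i) * E) := by
        refine (norm_sum_le _ _).trans ?_
        rw [← hsum, sum_mul]
        refine sum_le_sum fun j hj => ?_
        rw [norm_mul, Complex.norm_real, Real.norm_eq_abs]
        exact mul_le_mul_of_nonneg_left (term 1 1 (one_pow _) (fun _ _ => Nat.coprime_one_left _) j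
          (mem_of_mem_erase hj) (Or.inr (ne_of_mem_erase hj))) (abs_nonneg _)
      rw [prod_insert ha, prod_insert ha]
      have e1 := mul_le_mul_of_nonneg_left ih2 (hm0 a haI)
      rw [pow_zero, mul_one]
      set R := ∑ j ∈ (range (orderOf (η a))).erase 0, (c a j : ℂ) *
          ∑ x, w x * ((∏ i ∈ C, charComb (η i) (orderOf (η i)) (c i) x) *
            ((1 : MulChar L ℂ) * η a ^ j) x) with hR
      set S := ∑ x, w x * ((∏ i ∈ C, charComb (η i) (orderOf (η i)) (c i) x) *
            (1 : MulChar L ℂ) x)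
      set S' := ∑ x, w x * (1 : MulChar L ℂ) x
      have e3 : (m a : ℂ) * S + R - ((m a * ∏ i ∈ C, m i : ℝ) : ℂ) * S' =
          (m a : ℂ) * (S - ((∏ i ∈ C, m i : ℝ) : ℂ) * S') + R := by
        push_cast; ring
      rw [e3]
      refine (norm_add_le _ _).trans ?_
      rw [norm_mul, Complex.norm_real, Real.norm_of_nonneg (hm0 a haI)]
      nlinarith

end Core

lemma mulChar_pow_orderOf_apply {L : Type*} [Field L] {χ : MulChar L ℂ} {x : L}
    (hx : x ≠ 0) : χ x ^ orderOf χ = 1 := by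
  have h : (χ ^ orderOf χ) x = 1 := by
    rw [pow_orderOf_eq_one]; exact MulChar.one_apply (isUnit_iff_ne_zero.2 hx)
  by_cases h0 : orderOf χ = 0
  · rw [h0, pow_zero]
  · rwa [MulChar.pow_apply' _ h0] at h

lemma mulChar_pow_apply_of_ne_zero {L : Type*} [Field L] (χ : MulChar L ℂ) {x : L}
    (hx : x ≠ 0) (j : ℕ) : (χ ^ j) x = χ x ^ j := by
  rcases Nat.eq_zero_or_pos j with rfl | h
  · simpa using MulChar.one_apply (isUnit_iff_ne_zero.2 hx)
  · exact MulChar.pow_apply' _ h.ne' _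

/-- Orthogonality for the powers of one multiplicative character. -/
lemma sum_range_orderOf_pow {L : Type*} [Field L] {χ : MulChar L ℂ} {x : L} (hx : x ≠ 0)
    [Decidable (χ x = 1)] :
    ∑ j ∈ range (orderOf χ), (χ ^ j) x = if χ x = 1 then (orderOf χ : ℂ) else 0 := by
  simp_rw [mulChar_pow_apply_of_ne_zero χ hx]
  split_ifs with h
  · simp [h]
  · have := geom_sum_mul (χ x) (orderOf χ)
    rw [mulChar_pow_orderOf_apply hx, sub_self] at this
    exact (mul_eq_zero.1 this).resolve_right (sub_ne_zero.2 h)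

section Sieve

variable {L : Type*} [Field L] [Fintype L] {ι κ : Type*} [DecidableEq ι]
  {η : ι → MulChar L ℂ} {c : ι → ℕ → ℝ} {m W : ι → ℝ} {E : ℝ}

open Classical in
lemma sieve_aux {P : L → Prop} (hE : 0 ≤ E)
    (hw : TwistBound (fun x => if P x then (1 : ℂ) else 0) E) (hP0 : P 0 → 1 ≤ E)
    (C T : Finset ι) (hCT : Disjoint C T) {Gd : ι → L → Prop}
    (hGd : ∀ i ∈ C, ∀ x : L, x ≠ 0 →
      charComb (η i) (orderOf (η i)) (c i) x = if Gd i x then 1 else 0)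
    (hcop : ((C ∪ T : Finset ι) : Set ι).Pairwise
      fun i j => (orderOf (η i)).Coprime (orderOf (η j)))
    (hpos : ∀ i ∈ C ∪ T, 0 < orderOf (η i))
    (hm : ∀ i ∈ C, c i 0 = m i) (hm0 : ∀ i ∈ C, 0 < m i) (hW0 : ∀ i ∈ C, 0 ≤ W i)
    (hW : ∀ i ∈ C, ∑ j ∈ range (orderOf (η i)), |c i j| = m i * W i)
    (B : Finset κ) (V : κ → AddSubgroup L)
    (hB : ∀ k ∈ B, ∑ x, (if P x then (1 : ℂ) else 0) *
      ((if x ∈ V k then (1 : ℂ) else 0) - ((V k).index : ℂ)⁻¹) = 0)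
    {δ : ℝ} (hδ : δ = 1 - ∑ i ∈ T, (orderOf (η i) : ℝ)⁻¹ - ∑ k ∈ B, ((V k).index : ℝ)⁻¹)
    (hδ0 : 0 ≤ δ)
    (hmain : (∏ i ∈ C, W i) * E * (#T + #B - 1 + 2 * δ) < δ * #{x | P x}) :
    ∃ x : L, x ≠ 0 ∧ P x ∧ (∀ i ∈ C, Gd i x) ∧ (∀ i ∈ T, η i x ≠ 1) ∧ ∀ k ∈ B, x ∉ V k := by
  by_contra hno
  push Not at hno
  set w : L → ℂ := fun x => if P x then (1 : ℂ) else 0 with hwdef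
  set F : L → ℂ := fun x => ∏ i ∈ C, charComb (η i) (orderOf (η i)) (c i) x with hF
  set I : L → ℂ := fun x => (1 : MulChar L ℂ) x with hI
  set mm := ∏ i ∈ C, m i with hmm
  set WW := ∏ i ∈ C, W i with hWW
  have hmm0 : 0 < mm := prod_pos hm0
  have hWW0 : 0 ≤ WW := prod_nonneg hW0
  have hsub : (C : Set ι) ⊆ ((C ∪ T : Finset ι) : Set ι) := by simp
  have hposC : ∀ i ∈ C, 0 < orderOf (η i) := fun i hi => hpos i (mem_union_left _ hi)
  have twist : ∀ {w' : L → ℂ} {E' : ℝ}, TwistBound w' E' →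
      ∀ χ : MulChar L ℂ, χ ≠ 1 → ‖∑ x, w' x * χ x‖ ≤ E' := by
    intro w' E' h χ hχ
    simpa using h 1 χ hχ
  have I0 : ∀ x : L, x ≠ 0 → I x = 1 := fun x hx => MulChar.one_apply (isUnit_iff_ne_zero.2 hx)
  have I00 : I 0 = 0 := MulChar.map_zero 1
  have sumI : ∀ w' : L → ℂ, ∑ x, w' x * I x = ∑ x, w' x - w' 0 := by
    intro w'
    rw [← add_sum_erase _ _ (mem_univ (0 : L)), ← add_sum_erase univ w' (mem_univ (0 : L)), I00,
      mul_zero, zero_add, add_sub_cancel_left]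
    exact sum_congr rfl fun x hx => by rw [I0 x (ne_of_mem_erase hx), mul_one]
  obtain ⟨core1, core2⟩ := core_bound (twist hw) C (hcop.mono hsub) hposC hm
    (fun i hi => (hm0 i hi).le) hW0 hW
  -- contributions of the sieved multiplicative conditions
  have hT : ∀ i ∈ T, ‖∑ x, w x * (F x * I x) *
      ((if η i x = 1 then (1 : ℂ) else 0) - (orderOf (η i) : ℂ)⁻¹)‖ ≤
      (1 - (orderOf (η i) : ℝ)⁻¹) * (mm * WW * E) := by
    intro i hi
    have hoi : 0 < orderOf (η i) := hpos i (mem_union_right _ hi)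
    have hoR : (0 : ℝ) < orderOf (η i) := by exact_mod_cast hoi
    have hoC : (orderOf (η i) : ℂ) ≠ 0 := by exact_mod_cast hoi.ne'
    have h0 : 0 ∈ range (orderOf (η i)) := mem_range.2 hoi
    have e1 : ∑ x, w x * (F x * I x) *
        ((if η i x = 1 then (1 : ℂ) else 0) - (orderOf (η i) : ℂ)⁻¹) =
        (orderOf (η i) : ℂ)⁻¹ * ∑ j ∈ (range (orderOf (η i))).erase 0,
          ∑ x, w x * (F x * (η i ^ j) x) := by
      rw [sum_comm, mul_sum]
      refine sum_congr rfl fun x _ => ?_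
      by_cases hx : x = 0
      · subst hx
        rw [I00, sum_eq_zero fun j _ => by rw [MulChar.map_zero, mul_zero, mul_zero]]
        simp
      · rw [I0 x hx, ← mul_sum, ← mul_sum]
        have := sum_range_orderOf_pow (χ := η i) hx
        rw [← add_sum_erase _ _ h0, pow_zero, show (1 : MulChar L ℂ) x = 1 from I0 x hx] at this
        rw [eq_sub_of_add_eq' this]
        split_ifs
        · field_simp
        · field_simp; ring
    rw [e1, norm_mul, norm_inv, Complex.norm_natCast, inv_mul_le_iff₀ hoR]
    refine (norm_sum_le _ _).trans ((sum_le_card_nsmul _ _ (mm * WW * E) fun j hj => ?_).trans ?_)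
    · refine core1 (η i ^ j) (orderOf (η i)) ?_ ?_ ?_
      · rw [← pow_mul, mul_comm, pow_mul, pow_orderOf_eq_one, one_pow]
      · exact fun i' hi' => hcop (by simp [hi]) (by simp [hi'])
          (by rintro rfl; exact disjoint_left.1 hCT hi' hi)
      · intro h
        have h1 := orderOf_dvd_of_pow_eq_one h
        exact ne_of_mem_erase hj
          (Nat.eq_zero_of_dvd_of_lt h1 (mem_range.1 (mem_of_mem_erase hj)))
    · rw [card_erase_of_mem h0, card_range, nsmul_eq_mul, Nat.cast_sub hoi]
      apply le_of_eq
      field_simp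
      push_cast
      ring
  -- contributions of the sieved additive conditions
  have hBk : ∀ k ∈ B, ‖∑ x, w x * (F x * I x) *
      ((if x ∈ V k then (1 : ℂ) else 0) - ((V k).index : ℂ)⁻¹)‖ ≤
      (1 - ((V k).index : ℝ)⁻¹) * (mm * WW * E) := by
    intro k hk
    have h1 := hw.mul_indicator_sub (V := V k)
    have hle : (0 : ℝ) ≤ 1 - ((V k).index : ℝ)⁻¹ := by
      have : (1 : ℝ) ≤ (V k).index := by
        exact_mod_cast (Nat.one_le_iff_ne_zero.2 AddSubgroup.index_ne_zero_of_finite)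
      have := inv_le_one_of_one_le₀ this
      linarith
    have h2 := (core_bound (twist h1) C (hcop.mono hsub) hposC hm
      (fun i hi => (hm0 i hi).le) hW0 hW).2
    rw [sumI, hB k hk, zero_sub] at h2
    have h3 : ‖((mm : ℝ) : ℂ) * -((if P 0 then (1 : ℂ) else 0) *
        ((if (0 : L) ∈ V k then (1 : ℂ) else 0) - ((V k).index : ℂ)⁻¹))‖ ≤
        mm * ((1 - ((V k).index : ℝ)⁻¹) * E) := by
      rw [norm_mul, Complex.norm_real, Real.norm_of_nonneg hmm0.le, norm_neg]
      refine mul_le_mul_of_nonneg_left ?_ hmm0.le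
      rw [if_pos (zero_mem _), norm_mul]
      have : ‖(1 : ℂ) - ((V k).index : ℂ)⁻¹‖ = 1 - ((V k).index : ℝ)⁻¹ := by
        rw [← Real.norm_of_nonneg hle, ← Complex.norm_real]; push_cast; rfl
      rw [this]
      split_ifs with hp
      · have := hP0 hp
        rw [norm_one]; nlinarith
      · rw [norm_zero, zero_mul]; positivity
    have h4 := (norm_le_norm_sub_add _ _).trans (add_le_add h2 h3)
    have e : ∑ x, w x * (F x * I x) *
        ((if x ∈ V k then (1 : ℂ) else 0) - ((V k).index : ℂ)⁻¹) =
        ∑ x, w x * ((if x ∈ V k then (1 : ℂ) else 0) - ((V k).index : ℂ)⁻¹) * (F x * I x) :=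
      sum_congr rfl fun x _ => by ring
    rw [e]
    refine h4.trans (le_of_eq ?_)
    ring
  set Z : ℂ := ∑ x, w x * (F x * I x) * (1 - ∑ i ∈ T, (if η i x = 1 then (1 : ℂ) else 0) -
    ∑ k ∈ B, if x ∈ V k then (1 : ℂ) else 0) with hZ
  have hZle : Z.re ≤ 0 := by
    rw [hZ, Complex.re_sum]
    refine sum_nonpos fun x _ => ?_
    by_cases hx : x = 0
    · subst hx
      simp [I00]
    by_cases hp : P x
    swap
    · simp [hwdef, hp]
    by_cases hg : ∀ i ∈ C, Gd i x
    swap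
    · push Not at hg
      obtain ⟨i, hi, hgi⟩ := hg
      have : F x = 0 := prod_eq_zero hi (by rw [hGd i hi x hx, if_neg hgi])
      simp [this]
    have hF1 : F x = 1 := prod_eq_one fun i hi => by rw [hGd i hi x hx, if_pos (hg i hi)]
    have e : w x * (F x * I x) * (1 - ∑ i ∈ T, (if η i x = 1 then (1 : ℂ) else 0) -
        ∑ k ∈ B, if x ∈ V k then (1 : ℂ) else 0) =
        ((1 - ∑ i ∈ T, (if η i x = 1 then (1 : ℝ) else 0) -
        ∑ k ∈ B, if x ∈ V k then (1 : ℝ) else 0 : ℝ) : ℂ) := by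
      rw [hF1, I0 x hx]; simp [hwdef, hp]
    rw [e, Complex.ofReal_re]
    have n1 : 0 ≤ ∑ i ∈ T, (if η i x = 1 then (1 : ℝ) else 0) :=
      sum_nonneg fun i _ => by split_ifs <;> norm_num
    have n2 : 0 ≤ ∑ k ∈ B, if x ∈ V k then (1 : ℝ) else 0 :=
      sum_nonneg fun i _ => by split_ifs <;> norm_num
    by_cases hTx : ∀ i ∈ T, η i x ≠ 1
    · obtain ⟨k, hk, hkx⟩ := hno x hx hp hg hTx
      have := single_le_sum (f := fun k => if x ∈ V k then (1 : ℝ) else 0)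
        (fun i _ => by split_ifs <;> norm_num) hk
      simp only [if_pos hkx] at this
      linarith
    · push Not at hTx
      obtain ⟨k, hk, hkx⟩ := hTx
      have := single_le_sum (f := fun i => if η i x = 1 then (1 : ℝ) else 0)
        (fun i _ => by split_ifs <;> norm_num) hk
      simp only [if_pos hkx] at this
      linarith
  have hZeq : Z = (δ : ℂ) * ∑ x, w x * (F x * I x) -
      ∑ i ∈ T, ∑ x, w x * (F x * I x) *
        ((if η i x = 1 then (1 : ℂ) else 0) - (orderOf (η i) : ℂ)⁻¹) -
      ∑ k ∈ B, ∑ x, w x * (F x * I x) *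
        ((if x ∈ V k then (1 : ℂ) else 0) - ((V k).index : ℂ)⁻¹) := by
    rw [sum_comm (s := T), sum_comm (s := B), mul_sum, ← sum_sub_distrib, ← sum_sub_distrib, hZ]
    refine sum_congr rfl fun x _ => ?_
    rw [← mul_sum, ← mul_sum, sum_sub_distrib, sum_sub_distrib, hδ]
    push_cast
    ring
  have hM : ∑ x, w x = ((#{x | P x} : ℝ) : ℂ) := by
    simp [hwdef]
  have hmainsum := core2
  rw [show ∑ x, (fun x => if P x then (1 : ℂ) else 0) x * (1 : MulChar L ℂ) x =
    ∑ x, w x - w 0 from sumI w, hM] at hmainsum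
  have hw0 : (w 0).re ≤ E := by
    by_cases hp : P 0
    · simpa [hwdef, hp] using hP0 hp
    · simpa [hwdef, hp] using hE
  have r1 : mm * (#{x | P x} - (w 0).re) - mm * (WW - 1) * E ≤ (∑ x, w x * (F x * I x)).re := by
    have := (Complex.abs_re_le_norm _).trans hmainsum
    have h := (abs_le.1 this).1
    rw [Complex.sub_re, Complex.re_ofReal_mul, Complex.sub_re, Complex.ofReal_re] at h
    linarith
  have r2 : (∑ i ∈ T, ∑ x, w x * (F x * I x) *
        ((if η i x = 1 then (1 : ℂ) else 0) - (orderOf (η i) : ℂ)⁻¹)).re ≤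
        (#T - ∑ i ∈ T, (orderOf (η i) : ℝ)⁻¹) * (mm * WW * E) := by
    refine (Complex.re_le_norm _).trans ((norm_sum_le_of_le _ hT).trans (le_of_eq ?_))
    rw [← sum_mul, sum_sub_distrib]
    simp
  have r3 : (∑ k ∈ B, ∑ x, w x * (F x * I x) *
        ((if x ∈ V k then (1 : ℂ) else 0) - ((V k).index : ℂ)⁻¹)).re ≤
        (#B - ∑ k ∈ B, ((V k).index : ℝ)⁻¹) * (mm * WW * E) := by
    refine (Complex.re_le_norm _).trans ((norm_sum_le_of_le _ hBk).trans (le_of_eq ?_))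
    rw [← sum_mul, sum_sub_distrib]
    simp
  rw [hZeq, Complex.sub_re, Complex.sub_re, Complex.re_ofReal_mul] at hZle
  have r4 : δ * (mm * (#{x | P x} - E) - mm * (WW - 1) * E) ≤
      δ * (∑ x, w x * (F x * I x)).re := by
    refine mul_le_mul_of_nonneg_left (le_trans ?_ r1) hδ0
    nlinarith
  have r5 : δ * (mm * (#{x | P x} - E) - mm * (WW - 1) * E) ≤
      (#T + #B - 1 + δ) * (mm * WW * E) := by
    have : (#T + #B - 1 + δ) * (mm * WW * E) =
        (#T - ∑ i ∈ T, (orderOf (η i) : ℝ)⁻¹) * (mm * WW * E) +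
        (#B - ∑ k ∈ B, ((V k).index : ℝ)⁻¹) * (mm * WW * E) := by
      rw [hδ]; ring
    linarith
  have r6 : mm * (δ * #{x | P x}) ≤ mm * (WW * E * (#T + #B - 1 + 2 * δ)) := by
    linarith
  exact absurd (le_of_mul_le_mul_left r6 hmm0) (not_le.2 hmain)

end Sieve

lemma mem_range_algebraMap_of_pow_card {K L : Type*} [Field K] [Field L] [Algebra K L] [Fintype K]
    {y : L} (hy : y ^ Fintype.card K = y) : ∃ c : K, algebraMap K L c = y := by
  classical
  have h1 : (Polynomial.X ^ Fintype.card K - Polynomial.X : Polynomial K) =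
      ∏ c : K, (Polynomial.X - Polynomial.C c) := by
    have hr := FiniteField.roots_X_pow_card_sub_X K
    have hm : (Polynomial.X ^ Fintype.card K - Polynomial.X : Polynomial K).Monic :=
      Polynomial.monic_X_pow_sub (by
        rw [Polynomial.degree_X]; exact_mod_cast Fintype.one_lt_card)
    have := Polynomial.prod_multiset_X_sub_C_of_monic_of_roots_card_eq hm (by
      rw [hr, FiniteField.X_pow_card_sub_X_natDegree_eq K Fintype.one_lt_card]; rfl)
    rw [hr] at this
    exact this.symm
  have h2 := congrArg (Polynomial.aeval y) h1
  simp only [map_sub, map_pow, Polynomial.aeval_X, map_prod, Polynomial.aeval_C, hy,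
    sub_self] at h2
  obtain ⟨c, -, hc⟩ := prod_eq_zero_iff.1 h2.symm
  exact ⟨c, (sub_eq_zero.1 hc).symm⟩

lemma exists_coprime_two_mul_modEq {Q a : ℕ} (hodd : ∀ l, l.Prime → l ≠ 2 → l ∣ Q → ¬ l ∣ a)
    (h4 : 4 ∣ Q → a % 4 = 2) (h2 : Q % 4 = 2 → a % 2 = 0) :
    ∃ b, b.Coprime Q ∧ 2 * b ≡ a [MOD Q] := by
  have key : ∀ b z : ℕ, 2 * b = a + z * Q → (2 ∣ Q → ¬ 2 ∣ b) →
      b.Coprime Q ∧ 2 * b ≡ a [MOD Q] := by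
    intro b z hb hb2
    refine ⟨Nat.Coprime.symm (Nat.coprime_of_dvd fun l hl hlQ hlb => ?_), ?_⟩
    · by_cases h : l = 2
      · subst h; exact hb2 hlQ hlb
      · refine hodd l hl h hlQ ?_
        have : l ∣ a + z * Q := hb ▸ hlb.mul_left 2
        exact (Nat.dvd_add_left (hlQ.mul_left z)).1 this
    · rw [hb]; simp [Nat.ModEq]
  have : Q % 4 = 0 ∨ Q % 4 = 2 ∨ Q % 2 = 1 := by omega
  rcases this with h | h | h
  · have := h4 (Nat.dvd_of_mod_eq_zero h)
    exact ⟨a / 2, key _ 0 (by omega) (by omega)⟩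
  · have := h2 h
    by_cases ho : (a / 2) % 2 = 1
    · exact ⟨a / 2, key _ 0 (by omega) (by omega)⟩
    · exact ⟨a / 2 + Q / 2, key _ 1 (by omega) (by omega)⟩
  · refine ⟨(a + a * Q) / 2, key _ a ?_ (by omega)⟩
    have : Even (a + a * Q) := by
      have : Odd Q := Nat.odd_iff.2 h
      have h1 : Even (Q + 1) := this.add_one
      rw [show a + a * Q = a * (Q + 1) by ring]
      exact h1.mul_left a
    obtain ⟨k, hk⟩ := this
    omega

/-- If `x = γ ^ a` for a generator `γ` and `a` satisfies suitable congruence conditions modulo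
the index of `Kˣ` in `Lˣ`, then some `K`-multiple of `x` has order `(|L| - 1) / 2`. -/
lemma exists_smul_orderOf {K L : Type*} [Field K] [Field L] [Algebra K L] [Fintype K] [Fintype L]
    {Q : ℕ} (hQ : Q * (Fintype.card K - 1) = Fintype.card L - 1) (heven : 2 ∣ Fintype.card L - 1)
    {γ : Lˣ} (hγ : orderOf γ = Fintype.card L - 1) {a : ℕ}
    (hodd : ∀ l, l.Prime → l ≠ 2 → l ∣ Q → ¬ l ∣ a)
    (h4 : 4 ∣ Q → a % 4 = 2) (h2 : Q % 4 = 2 → a % 2 = 0) :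
    ∃ c : K, c ≠ 0 ∧ orderOf (c • ((γ ^ a : Lˣ) : L)) = (Fintype.card L - 1) / 2 := by
  have hL1 : 1 < Fintype.card L := Fintype.one_lt_card
  have hK1 : 1 < Fintype.card K := Fintype.one_lt_card
  have hN0 : Fintype.card L - 1 ≠ 0 := by omega
  have : NeZero (Fintype.card L - 1) := ⟨hN0⟩
  have hQdvd : Q ∣ Fintype.card L - 1 := ⟨_, hQ.symm⟩
  have : NeZero Q := ⟨by rintro rfl; simp at hQ; omega⟩
  obtain ⟨b, hb, hba⟩ := exists_coprime_two_mul_modEq hodd h4 h2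
  obtain ⟨u', hu'⟩ := ZMod.unitsMap_surjective hQdvd (ZMod.unitOfCoprime b hb)
  set u := (u' : ZMod (Fintype.card L - 1)).val with hu
  have huc : u.Coprime (Fintype.card L - 1) := ZMod.val_coe_unit_coprime u'
  have hub : u ≡ b [MOD Q] := by
    have := congrArg Units.val hu'
    rw [ZMod.unitsMap_val, ZMod.coe_unitOfCoprime] at this
    rw [← ZMod.natCast_eq_natCast_iff, ← this, hu, ZMod.cast_eq_val]
  have h2u : 2 * u ≡ a [MOD Q] := (hub.mul_left 2).trans hba
  set y : Lˣ := γ ^ (2 * u) * (γ ^ a)⁻¹ with hy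
  have hyq : y ^ (Fintype.card K - 1) = 1 := by
    obtain ⟨z, hz⟩ : (Q : ℤ) ∣ (2 * u : ℤ) - a := by
      have := h2u.symm.dvd
      simpa using this
    have : y = γ ^ ((Q : ℤ) * z) := by
      rw [← hz, zpow_sub, hy]
      norm_cast
    rw [this, ← zpow_natCast, ← zpow_mul,
      show (Q : ℤ) * z * (Fintype.card K - 1 : ℕ) = ((Q * (Fintype.card K - 1) : ℕ) : ℤ) * z by
        push_cast; ring, hQ, zpow_mul, zpow_natCast, ← hγ, pow_orderOf_eq_one, one_zpow]
  obtain ⟨c, hc⟩ := mem_range_algebraMap_of_pow_card (K := K) (y := (y : L)) (by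
    have := congrArg Units.val hyq
    rw [Units.val_pow_eq_pow_val, Units.val_one] at this
    conv_lhs => rw [show Fintype.card K = Fintype.card K - 1 + 1 by omega, pow_succ, this, one_mul])
  refine ⟨c, ?_, ?_⟩
  · rintro rfl
    rw [map_zero] at hc
    exact y.ne_zero hc.symm
  · rw [Algebra.smul_def, hc, ← Units.val_mul, hy, inv_mul_cancel_right, orderOf_units,
      orderOf_pow, hγ]
    congr 1
    rw [mul_comm 2 u, Nat.Coprime.gcd_mul_left_cancel_right _ huc]
    exact Nat.gcd_eq_right heven

/-- The order of the character used at the prime `l`. -/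
def charOrd (Q l : ℕ) : ℕ := if l = 2 ∧ 4 ∣ Q then 4 else l

/-- The coefficients of the indicator function of the condition imposed at the prime `l`. -/
noncomputable def charCoeff (Q l j : ℕ) : ℝ :=
  if l = 2 then (if 4 ∣ Q then (-1) ^ j / 4 else 1 / 2)
  else if j = 0 then 1 - (l : ℝ)⁻¹ else -(l : ℝ)⁻¹

/-- The condition imposed on the value at `x` of the character at the prime `l`. -/
def CharCond {L : Type*} [Field L] (Q l : ℕ) (χ : MulChar L ℂ) (x : L) : Prop :=
  if l = 2 then (if 4 ∣ Q then χ x = -1 else χ x = 1) else χ x ≠ 1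

lemma charComb_eq_ite {L : Type*} [Field L] {Q l : ℕ} (hl : l.Prime) {χ : MulChar L ℂ}
    (hχ : orderOf χ = charOrd Q l) {x : L} (hx : x ≠ 0) [Decidable (CharCond Q l χ x)] :
    charComb χ (orderOf χ) (charCoeff Q l) x = if CharCond Q l χ x then 1 else 0 := by
  classical
  have h0 : 0 < orderOf χ := by
    rw [hχ, charOrd]; split_ifs <;> [norm_num; exact hl.pos]
  by_cases h2 : l = 2
  · by_cases h4 : 4 ∣ Q
    · have ho : orderOf χ = 4 := by simp [hχ, charOrd, h2, h4]
      have hpow := mulChar_pow_orderOf_apply (χ := χ) hx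
      simp only [charComb, CharCond, charCoeff, h2, h4, if_true,
        mulChar_pow_apply_of_ne_zero χ hx, ho] at hpow ⊢
      have e : ∑ j ∈ range 4, (((-1) ^ j / 4 : ℝ) : ℂ) * χ x ^ j =
          (∑ j ∈ range 4, (-χ x) ^ j) / 4 := by
        simp only [sum_range_succ, range_zero, sum_empty]
        push_cast; ring
      rw [e]
      split_ifs with h
      · rw [h]; norm_num [sum_range_succ]
      · have := geom_sum_mul (-χ x) 4
        rw [Even.neg_pow (by decide), hpow, sub_self] at this
        rw [(mul_eq_zero.1 this).resolve_right, zero_div]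
        intro h'
        apply h
        linear_combination -h'
    · have ho : orderOf χ = 2 := by simp [hχ, charOrd, h2, h4]
      have hs := sum_range_orderOf_pow (χ := χ) hx
      simp only [charComb, CharCond, charCoeff, h2, h4, if_true, if_false, ← mul_sum]
      rw [hs, ho]
      split_ifs <;> simp
  · have ho : orderOf χ = l := by simp [hχ, charOrd, h2]
    have hs := sum_range_orderOf_pow (χ := χ) hx
    have hl0 : (l : ℂ) ≠ 0 := by exact_mod_cast hl.ne_zero
    have hmem : 0 ∈ range (orderOf χ) := mem_range.2 h0
    have e : charComb χ (orderOf χ) (charCoeff Q l) x =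
        1 - (l : ℂ)⁻¹ * ∑ j ∈ range (orderOf χ), (χ ^ j) x := by
      have hone : (χ ^ 0) x = 1 := by
        rw [mulChar_pow_apply_of_ne_zero χ hx, pow_zero]
      have hrest : ∑ j ∈ (range (orderOf χ)).erase 0, ((charCoeff Q l j : ℝ) : ℂ) * (χ ^ j) x =
          -((l : ℂ)⁻¹ * ∑ j ∈ (range (orderOf χ)).erase 0, (χ ^ j) x) := by
        rw [mul_sum, ← sum_neg_distrib]
        exact sum_congr rfl fun j hj => by simp [charCoeff, h2, ne_of_mem_erase hj]
      rw [charComb, ← add_sum_erase _ _ hmem, hrest,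
        ← add_sum_erase _ (fun j => (χ ^ j) x) hmem, hone,
        show ((charCoeff Q l 0 : ℝ) : ℂ) = 1 - (l : ℂ)⁻¹ by simp [charCoeff, h2]]
      ring
    rw [e, hs, ho]
    simp only [CharCond, h2, if_false]
    by_cases h : χ x = 1
    · simp [h, hl0]
    · simp [h]

lemma charCoeff_zero_pos {Q l : ℕ} (hl : l.Prime) : 0 < charCoeff Q l 0 := by
  unfold charCoeff
  split_ifs
  · norm_num
  · norm_num
  · have : (1 : ℝ) < l := by exact_mod_cast hl.one_lt
    have := inv_lt_one_of_one_lt₀ this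
    linarith
  · contradiction

lemma sum_abs_charCoeff {Q l : ℕ} (hl : l.Prime) :
    ∑ j ∈ range (charOrd Q l), |charCoeff Q l j| =
      charCoeff Q l 0 * if l = 2 ∧ 4 ∣ Q then 4 else 2 := by
  by_cases h2 : l = 2
  · by_cases h4 : 4 ∣ Q
    · simp only [charOrd, charCoeff, h2, h4, if_true, and_self, sum_range_succ, range_zero,
        sum_empty]
      norm_num [abs_div]
    · simp only [charOrd, charCoeff, h2, h4, if_true, and_false, if_false, sum_range_succ,
        range_zero, sum_empty]
      norm_num
  · simp only [charOrd, h2, false_and, if_false]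
    have hl1 : (1 : ℝ) < l := by exact_mod_cast hl.one_lt
    have hinv := inv_lt_one_of_one_lt₀ hl1
    rw [← add_sum_erase _ _ (mem_range.2 hl.pos),
      sum_congr rfl (g := fun _ => (l : ℝ)⁻¹) fun j hj => ?_]
    · rw [sum_const, card_erase_of_mem (mem_range.2 hl.pos), card_range, nsmul_eq_mul,
        Nat.cast_sub hl.one_le, abs_of_pos (charCoeff_zero_pos hl)]
      simp only [charCoeff, h2, if_false, if_true]
      have : (l : ℝ) ≠ 0 := by positivity
      field_simp
      push_cast
      ring
    · have : (0 : ℝ) < (l : ℝ)⁻¹ := by positivity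
      simp [charCoeff, h2, ne_of_mem_erase hj, abs_of_pos this]

lemma prod_weights {Q : ℕ} {C : Finset ℕ} (h2C : 2 ∣ Q → 2 ∈ C) :
    ∏ l ∈ C, (if l = 2 ∧ 4 ∣ Q then 4 else 2 : ℝ) = 2 ^ #C * if 4 ∣ Q then 2 else 1 := by
  by_cases h4 : 4 ∣ Q
  · have hmem := h2C (dvd_trans (by norm_num) h4)
    simp only [h4, and_true, if_true]
    rw [← mul_prod_erase _ _ hmem, prod_congr rfl (g := fun _ => (2 : ℝ)) fun l hl => by
      rw [if_neg (ne_of_mem_erase hl)], prod_const, ← card_erase_add_one hmem, pow_succ]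
    norm_num
    ring
  · simp [h4]

/-- The sieve criterion. -/
lemma exists_smul_orderOf_of_sieve {K L : Type*} [Field K] [Field L] [Algebra K L] [Fintype K]
    [Fintype L] {Q : ℕ} (hQ : Q * (Fintype.card K - 1) = Fintype.card L - 1)
    (heven : 2 ∣ Fintype.card L - 1) {κ : Type*} {P : L → Prop} [DecidablePred P] {E : ℝ}
    (hE : 0 ≤ E) (hw : TwistBound (fun x => if P x then (1 : ℂ) else 0) E) (hP0 : P 0 → 1 ≤ E)
    {C T : Finset ℕ} (hCT : Disjoint C T) (hunion : C ∪ T = Q.primeFactors) (h2T : 2 ∉ T)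
    (B : Finset κ) (V : κ → AddSubgroup L) [∀ k, DecidablePred (· ∈ V k)]
    (hB : ∀ k ∈ B, ∑ x, (if P x then (1 : ℂ) else 0) *
      ((if x ∈ V k then (1 : ℂ) else 0) - ((V k).index : ℂ)⁻¹) = 0)
    {δ : ℝ} (hδ : δ = 1 - ∑ l ∈ T, (l : ℝ)⁻¹ - ∑ k ∈ B, ((V k).index : ℝ)⁻¹) (hδ0 : 0 ≤ δ)
    (hmain : (2 ^ #C * if 4 ∣ Q then 2 else 1) * E * (#T + #B - 1 + 2 * δ) <
      δ * #{x | P x}) :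
    ∃ x : L, P x ∧ (∀ k ∈ B, x ∉ V k) ∧
      ∃ c : K, c ≠ 0 ∧ orderOf (c • x) = (Fintype.card L - 1) / 2 := by
  classical
  have hL1 : 1 < Fintype.card L := Fintype.one_lt_card
  have hQ0 : Q ≠ 0 := by rintro rfl; simp at hQ; omega
  have hprime : ∀ l ∈ C ∪ T, l.Prime := fun l hl => by
    rw [hunion] at hl; exact Nat.prime_of_mem_primeFactors hl
  have hdvd : ∀ l ∈ C ∪ T, l ∣ Q := fun l hl => by
    rw [hunion] at hl; exact Nat.dvd_of_mem_primeFactors hl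
  have hchar : ∀ l, ∃ χ : MulChar L ℂ, l ∈ C ∪ T → orderOf χ = charOrd Q l := by
    intro l
    by_cases hl : l ∈ C ∪ T
    · have hd : charOrd Q l ∣ Fintype.card L - 1 := by
        refine dvd_trans ?_ (Dvd.intro _ hQ)
        unfold charOrd
        split_ifs with h
        exacts [h.2, hdvd l hl]
      have h0 : charOrd Q l ≠ 0 := by
        unfold charOrd; split_ifs <;> [norm_num; exact (hprime l hl).ne_zero]
      obtain ⟨χ, hχ⟩ := MulChar.exists_mulChar_orderOf L hd (Complex.isPrimitiveRoot_exp _ h0)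
      exact ⟨χ, fun _ => hχ⟩
    · exact ⟨1, fun h => absurd h hl⟩
  choose η hη using hchar
  have hTord : ∀ l ∈ T, orderOf (η l) = l := fun l hl => by
    rw [hη l (mem_union_right _ hl), charOrd, if_neg]
    rintro ⟨rfl, -⟩; exact h2T hl
  have hcop : ((C ∪ T : Finset ℕ) : Set ℕ).Pairwise
      fun i j => (orderOf (η i)).Coprime (orderOf (η j)) := by
    intro i hi j hj hij
    have hi' := mem_coe.1 hi
    have hj' := mem_coe.1 hj
    have hc := (Nat.coprime_primes (hprime i hi') (hprime j hj')).2 hij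
    change (orderOf (η i)).Coprime (orderOf (η j))
    rw [hη i hi', hη j hj']
    have hpow : ∀ k, ∃ e, charOrd Q k = k ^ e := by
      intro k
      unfold charOrd
      split_ifs with h
      exacts [⟨2, by rw [h.1]; norm_num⟩, ⟨1, (pow_one k).symm⟩]
    obtain ⟨e1, h1⟩ := hpow i
    obtain ⟨e2, h2⟩ := hpow j
    rw [h1, h2]
    exact Nat.Coprime.pow _ _ hc
  have h2C : 2 ∣ Q → 2 ∈ C := fun h => by
    have : 2 ∈ C ∪ T := by
      rw [hunion]; exact Nat.mem_primeFactors.2 ⟨Nat.prime_two, h, hQ0⟩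
    exact (mem_union.1 this).resolve_right h2T
  obtain ⟨x, hx0, hxP, hxC, hxT, hxB⟩ := sieve_aux (η := η) (c := charCoeff Q)
    (m := fun l => charCoeff Q l 0) (W := fun l => if l = 2 ∧ 4 ∣ Q then 4 else 2)
    (P := P) hE (by convert hw) hP0 C T hCT (Gd := fun l => CharCond Q l (η l))
    (fun l hl x hx => charComb_eq_ite (hprime l (mem_union_left _ hl))
      (hη l (mem_union_left _ hl)) hx) hcop
    (fun l hl => by
      rw [hη l hl, charOrd]; split_ifs <;> [norm_num; exact (hprime l hl).pos])
    (fun l _ => rfl) (fun l hl => charCoeff_zero_pos (hprime l (mem_union_left _ hl)))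
    (fun l _ => by split_ifs <;> norm_num)
    (fun l hl => by
      rw [hη l (mem_union_left _ hl)]; exact sum_abs_charCoeff (hprime l (mem_union_left _ hl)))
    B V (by convert hB) (δ := δ)
    (by rw [hδ, sum_congr (g := fun l => (orderOf (η l) : ℝ)⁻¹) rfl
      fun l hl => by rw [hTord l hl]]) hδ0
    (by rw [prod_weights h2C]; convert hmain)
  refine ⟨x, hxP, hxB, ?_⟩
  obtain ⟨γ, hγ⟩ := IsCyclic.exists_generator (α := Lˣ)
  have hγo : orderOf γ = Fintype.card L - 1 := by
    rw [orderOf_eq_card_of_forall_mem_zpowers hγ, Nat.card_eq_fintype_card, Fintype.card_units]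
  obtain ⟨a, ha⟩ : ∃ a : ℕ, γ ^ a = Units.mk0 x hx0 := by
    have := (mem_powers_iff_mem_zpowers (x := γ)).2 (hγ (Units.mk0 x hx0))
    exact this
  have hval : ∀ l, η l x = η l γ ^ a := fun l => by
    rw [← map_pow, ← Units.val_pow_eq_pow_val, ha, Units.val_mk0]
  have hprim : ∀ l, ∀ k, η l γ ^ k = 1 → orderOf (η l) ∣ k := by
    intro l k hk
    apply orderOf_dvd_of_pow_eq_one
    rw [MulChar.eq_iff hγ, mulChar_pow_apply_of_ne_zero _ γ.ne_zero, hk, MulChar.one_apply_coe]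
  have hfull : ∀ l, η l γ ^ orderOf (η l) = 1 := fun l => mulChar_pow_orderOf_apply γ.ne_zero
  rw [show x = ((γ ^ a : Lˣ) : L) by rw [ha, Units.val_mk0]]
  refine exists_smul_orderOf hQ heven hγo ?_ ?_ ?_
  · intro l hl hl2 hlQ hla
    have hmem : l ∈ C ∪ T := by rw [hunion]; exact Nat.mem_primeFactors.2 ⟨hl, hlQ, hQ0⟩
    have ho : orderOf (η l) = l := by rw [hη l hmem, charOrd]; simp [hl2]
    have hne : η l x ≠ 1 := by
      rcases mem_union.1 hmem with h | h
      · have := hxC l h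
        simpa [CharCond, hl2] using this
      · exact hxT l h
    apply hne
    obtain ⟨k, rfl⟩ := hla
    rw [hval, pow_mul]
    have := hfull l
    rw [ho] at this
    rw [this, one_pow]
  · intro h4
    have hmem := h2C (dvd_trans (by norm_num) h4)
    have hx2 := hxC 2 hmem
    have ho : orderOf (η 2) = 4 := by rw [hη 2 (mem_union_left _ hmem), charOrd]; simp [h4]
    simp only [CharCond, h4, if_true] at hx2
    rw [hval] at hx2
    have d1 : 4 ∣ a * 2 := by
      rw [← ho]; apply hprim; rw [pow_mul, hx2]; norm_num
    have d2 : ¬ 4 ∣ a := by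
      rintro ⟨k, rfl⟩
      have := hfull 2
      rw [ho] at this
      rw [pow_mul, this, one_pow] at hx2
      norm_num at hx2
    omega
  · intro h4
    have h4' : ¬ 4 ∣ Q := by omega
    have hmem := h2C (by omega)
    have hx2 := hxC 2 hmem
    have ho : orderOf (η 2) = 2 := by rw [hη 2 (mem_union_left _ hmem), charOrd]; simp [h4']
    simp only [CharCond, h4', if_true, if_false] at hx2
    rw [hval] at hx2
    have := hprim 2 a hx2
    rw [ho] at this
    omega

section FrobeniusKernel

variable (K : Type*) {L : Type*} [Field K] [Field L] [Algebra K L] [Fintype K] [Fintype L]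

/-- The action of a polynomial on `L`, with `X` acting as the Frobenius. -/
noncomputable def frobAct (F : K[X]) : L →ₗ[K] L :=
  aeval (FiniteField.frobeniusAlgHom K L).toLinearMap F

/-- The elements of `L` killed by the polynomial `F` in the Frobenius. -/
noncomputable def frobKer (L : Type*) [Field L] [Algebra K L] [Fintype L] (F : K[X]) :
    Submodule K L := LinearMap.ker (frobAct K F : L →ₗ[K] L)

variable {K}

lemma mem_frobKer {F : K[X]} {x : L} : x ∈ frobKer K L F ↔ frobAct K F x = 0 := LinearMap.mem_ker

lemma frobAct_mul (F G : K[X]) (x : L) : frobAct K (F * G) x = frobAct K F (frobAct K G x) := by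
  simp [frobAct]

lemma frobAct_add (F G : K[X]) (x : L) : frobAct K (F + G) x = frobAct K F x + frobAct K G x := by
  simp [frobAct]

lemma frobAct_sub (F G : K[X]) (x : L) : frobAct K (F - G) x = frobAct K F x - frobAct K G x := by
  simp [frobAct]

lemma frobAct_X_pow (i : ℕ) (x : L) :
    frobAct K (X ^ i : K[X]) x = x ^ Fintype.card K ^ i := by
  simp only [frobAct, aeval_X_pow, Module.End.coe_pow, AlgHom.coe_toLinearMap,
    FiniteField.coe_frobeniusAlgHom, pow_iterate]

lemma frobAct_X (x : L) : frobAct K (X : K[X]) x = x ^ Fintype.card K := by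
  simpa using frobAct_X_pow (K := K) 1 x

lemma frobAct_one (x : L) : frobAct K (1 : K[X]) x = x := by
  simpa using frobAct_X_pow (K := K) 0 x

lemma frobAct_C (a : K) (x : L) : frobAct K (C a) x = a • x := by
  simp [frobAct]

lemma frobAct_eq_sum (F : K[X]) (x : L) :
    frobAct K F x = ∑ i ∈ range (F.natDegree + 1), F.coeff i • x ^ Fintype.card K ^ i := by
  conv_lhs => rw [F.as_sum_range_C_mul_X_pow]
  rw [frobAct, map_sum, LinearMap.sum_apply]
  refine sum_congr rfl fun i _ => ?_
  have := frobAct_mul (C (F.coeff i)) (X ^ i) x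
  rw [frobAct_C, frobAct_X_pow] at this
  exact this

lemma frobKer_mono {F G : K[X]} (h : F ∣ G) : frobKer K L F ≤ frobKer K L G := by
  obtain ⟨H, rfl⟩ := h
  intro x hx
  rw [mem_frobKer] at hx ⊢
  rw [mul_comm, frobAct_mul, hx, map_zero]

lemma frobAct_X_pow_finrank_sub_one :
    (frobAct K (X ^ Module.finrank K L - 1) : L →ₗ[K] L) = 0 := by
  rw [← FiniteField.minpoly_frobeniusAlgHom K L, frobAct, minpoly.aeval]

lemma finrank_frobKer_le {F : K[X]} (hF : F ≠ 0) :
    Module.finrank K (frobKer K L F) ≤ F.natDegree := by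
  classical
  set q := Fintype.card K with hq
  have hq1 : 1 < q := Fintype.one_lt_card
  set R : L[X] := ∑ i ∈ range (F.natDegree + 1), C (algebraMap K L (F.coeff i)) * X ^ q ^ i with hR
  have hcoeff : R.coeff (q ^ F.natDegree) = algebraMap K L F.leadingCoeff := by
    rw [hR, finsetSum_coeff, sum_eq_single F.natDegree]
    · simp
    · intro i _ hi
      rw [coeff_C_mul, coeff_X_pow, if_neg, mul_zero]
      intro h
      exact hi (Nat.pow_right_injective hq1 h).symm
    · simp
  have hR0 : R ≠ 0 := by
    intro h
    rw [h, coeff_zero] at hcoeff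
    exact hF (leadingCoeff_eq_zero.1 ((map_eq_zero _).1 hcoeff.symm))
  have hdeg : R.natDegree ≤ q ^ F.natDegree := by
    refine natDegree_sum_le_of_forall_le _ _ fun i hi => ?_
    refine (natDegree_C_mul_X_pow_le _ _).trans ?_
    exact Nat.pow_le_pow_right hq1.le (by simpa [Nat.lt_succ_iff] using hi)
  have hcard : Nat.card (frobKer K L F) ≤ q ^ F.natDegree := by
    have hsub : (univ.filter fun x : L => x ∈ frobKer K L F) ⊆ R.roots.toFinset := by
      intro x hx
      rw [mem_filter, mem_frobKer, frobAct_eq_sum] at hx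
      rw [Multiset.mem_toFinset, mem_roots hR0, IsRoot, hR, eval_finsetSum, ← hx.2]
      exact sum_congr rfl fun i _ => by simp [Algebra.smul_def, hq]
    have h1 := card_le_card hsub
    rw [show #(univ.filter fun x : L => x ∈ frobKer K L F) = Nat.card (frobKer K L F) by
      rw [Nat.card_eq_fintype_card, Fintype.card_subtype]] at h1
    exact h1.trans ((Multiset.toFinset_card_le _).trans ((card_roots' R).trans hdeg))
  have hpow : Nat.card (frobKer K L F) = q ^ Module.finrank K (frobKer K L F) := by
    rw [Module.natCard_eq_pow_finrank (K := K), Nat.card_eq_fintype_card]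
  rw [hpow] at hcard
  exact (Nat.pow_le_pow_iff_right hq1).1 hcard

lemma finrank_frobKer {F : K[X]} (hF : F ∣ X ^ Module.finrank K L - 1) :
    Module.finrank K (frobKer K L F) = F.natDegree := by
  obtain ⟨H, hH⟩ := hF
  have hn : 0 < Module.finrank K L := Module.finrank_pos
  have hne : (X ^ Module.finrank K L - 1 : K[X]) ≠ 0 := (monic_X_pow_sub_C 1 hn.ne').ne_zero
  have hF0 : F ≠ 0 := by rintro rfl; simp at hH; exact hne hH
  have hH0 : H ≠ 0 := by rintro rfl; simp at hH; exact hne hH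
  have hdeg : F.natDegree + H.natDegree = Module.finrank K L := by
    rw [← natDegree_mul hF0 hH0, ← hH]
    exact natDegree_X_pow_sub_C
  have hrange : LinearMap.range (frobAct K F : L →ₗ[K] L) ≤ frobKer K L H := by
    rintro _ ⟨x, rfl⟩
    rw [mem_frobKer, ← frobAct_mul, mul_comm, ← hH, frobAct_X_pow_finrank_sub_one]
    rfl
  have h1 := Submodule.finrank_mono hrange
  have h2 := (frobAct K F : L →ₗ[K] L).finrank_range_add_finrank_ker
  have h3 := finrank_frobKer_le (L := L) hH0
  have h4 := finrank_frobKer_le (L := L) hF0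
  change _ + Module.finrank K (frobKer K L F) = _ at h2
  omega

/-- An element killed by `f` but by no `f / g`, with `g` an irreducible factor of `f`, spans a
Frobenius-stable subspace of dimension `deg f`. -/
lemma finrank_conjSpan_of_forall {n : ℕ} {f : K[X]} (hf : f ∣ X ^ Module.finrank K L - 1)
    (hn : f.natDegree ≤ n) {α : L} (hα : frobAct K f α = 0)
    (h : ∀ g, Irreducible g → ∀ e, f = g * e → frobAct K e α ≠ 0) :
    Module.finrank K (conjSpan K (Fintype.card K) n α) = f.natDegree := by
  classical
  have hne : (X ^ Module.finrank K L - 1 : K[X]) ≠ 0 :=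
    (monic_X_pow_sub_C 1 Module.finrank_pos.ne').ne_zero
  have hf0 : f ≠ 0 := ne_zero_of_dvd_ne_zero hne hf
  have hconj : ∀ i, α ^ Fintype.card K ^ i ∈ frobKer K L f := fun i => by
    rw [mem_frobKer, ← frobAct_X_pow, ← frobAct_mul, mul_comm, frobAct_mul, hα, map_zero]
  apply le_antisymm
  · rw [← finrank_frobKer (L := L) hf]
    refine Submodule.finrank_mono (Submodule.span_le.2 ?_)
    rintro _ ⟨i, rfl⟩
    exact hconj i
  · have hli : LinearIndependent K
        (fun i : Fin f.natDegree => α ^ Fintype.card K ^ (i : ℕ)) := by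
      rw [Fintype.linearIndependent_iff]
      intro c hc
      set F : K[X] := ∑ i : Fin f.natDegree, C (c i) * X ^ (i : ℕ) with hF
      have hFα : frobAct K F α = 0 := by
        rw [← hc, hF, frobAct, map_sum, LinearMap.sum_apply]
        refine sum_congr rfl fun i _ => ?_
        have := frobAct_mul (C (c i)) (X ^ (i : ℕ)) α
        rw [frobAct_C, frobAct_X_pow] at this
        exact this
      have hFdeg : F.degree < f.natDegree := by
        refine (degree_sum_fin_lt c)
      have hF0 : F = 0 := by
        by_contra hF0
        have hdv := EuclideanDomain.gcd_dvd_left F f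
        obtain ⟨e, he⟩ := EuclideanDomain.gcd_dvd_right F f
        have hgα : frobAct K (EuclideanDomain.gcd F f) α = 0 := by
          rw [EuclideanDomain.gcd_eq_gcd_ab, frobAct_add, mul_comm, frobAct_mul, hFα, map_zero,
            mul_comm, frobAct_mul, hα, map_zero, add_zero]
        have hnu : ¬ IsUnit e := by
          intro hu
          have : f ∣ F := by
            refine dvd_trans ?_ hdv
            conv_lhs => rw [he]
            exact hu.mul_right_dvd.2 dvd_rfl
          have h2 := degree_le_of_dvd this hF0
          rw [degree_eq_natDegree hf0] at h2
          exact absurd hFdeg (not_lt.2 h2)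
        have he0 : e ≠ 0 := by rintro rfl; rw [mul_zero] at he; exact hf0 he
        obtain ⟨g, hg, k, hk⟩ := WfDvdMonoid.exists_irreducible_factor hnu he0
        refine h g hg (EuclideanDomain.gcd F f * k) ?_ ?_
        · conv_lhs => rw [he, hk]
          ring
        · rw [mul_comm, frobAct_mul, hgα, map_zero]
      intro i
      have := congrArg (fun p => p.coeff (i : ℕ)) hF0
      simpa [hF, finsetSum_coeff, coeff_C_mul, coeff_X_pow, Fin.val_inj] using this
    have h1 := finrank_span_eq_card hli
    rw [Fintype.card_fin] at h1
    rw [← h1]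
    refine Submodule.finrank_mono (Submodule.span_mono ?_)
    rintro _ ⟨i, rfl⟩
    exact ⟨⟨i, i.2.trans_le hn⟩, rfl⟩

end FrobeniusKernel

section Subspaces

variable {K L : Type*} [Field K] [Field L] [Algebra K L] [Fintype L]

lemma exists_submodule_inf_eq {U W : Submodule K L} (h : U ≤ W) :
    ∃ V : Submodule K L, V ⊓ W = U ∧
      Module.finrank K V + Module.finrank K W = Module.finrank K U + Module.finrank K L := by
  obtain ⟨C, hC⟩ := Submodule.exists_isCompl W
  refine ⟨U ⊔ C, ?_, ?_⟩
  · rw [sup_inf_assoc_of_le C h, inf_comm, hC.inf_eq_bot, sup_bot_eq]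
  · have h1 := Submodule.finrank_sup_add_finrank_inf_eq U C
    have h2 : U ⊓ C = ⊥ := eq_bot_iff.2 (by rw [← hC.inf_eq_bot]; exact inf_le_inf_right C h)
    rw [h2, finrank_bot] at h1
    have h3 := Submodule.finrank_add_eq_of_isCompl hC
    omega

variable [Fintype K]

lemma card_submodule (V : Submodule K L) :
    Nat.card V = Fintype.card K ^ Module.finrank K V := by
  rw [Module.natCard_eq_pow_finrank (K := K), Nat.card_eq_fintype_card]

lemma index_toAddSubgroup {V : Submodule K L} {d : ℕ}
    (h : Module.finrank K V + d = Module.finrank K L) :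
    V.toAddSubgroup.index = Fintype.card K ^ d := by
  have h1 := V.toAddSubgroup.index_mul_card
  have h2 : Nat.card V.toAddSubgroup = Fintype.card K ^ Module.finrank K V := card_submodule V
  rw [h2, Module.natCard_eq_pow_finrank (K := K) (V := L), Nat.card_eq_fintype_card, ← h,
    add_comm, pow_add] at h1
  exact Nat.eq_of_mul_eq_mul_right (pow_pos Fintype.card_pos _) h1

lemma exists_addSubgroup_of_dvd {f : K[X]} (hf : f ∣ X ^ Module.finrank K L - 1) (g : K[X]) :
    ∃ V : AddSubgroup L, g ∣ f → (∀ x ∈ frobKer K L f, x ∈ V ↔ frobAct K (f / g) x = 0) ∧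
      V.index = Fintype.card K ^ g.natDegree := by
  by_cases hg : g ∣ f
  · have hne : (X ^ Module.finrank K L - 1 : K[X]) ≠ 0 :=
      (monic_X_pow_sub_C 1 Module.finrank_pos.ne').ne_zero
    have hf0 : f ≠ 0 := ne_zero_of_dvd_ne_zero hne hf
    have hg0 : g ≠ 0 := ne_zero_of_dvd_ne_zero hf0 hg
    have hmul : g * (f / g) = f := EuclideanDomain.mul_div_cancel' hg0 hg
    have hdvd : f / g ∣ f := Dvd.intro_left _ hmul
    have he0 : f / g ≠ 0 := ne_zero_of_dvd_ne_zero hf0 hdvd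
    obtain ⟨V, hV, hd⟩ := exists_submodule_inf_eq (frobKer_mono (L := L) hdvd)
    refine ⟨V.toAddSubgroup, fun _ => ⟨fun x hx => ?_, index_toAddSubgroup ?_⟩⟩
    · rw [← mem_frobKer, ← hV, Submodule.mem_inf]
      exact ⟨fun h => ⟨h, hx⟩, fun h => h.1⟩
    · rw [finrank_frobKer hf, finrank_frobKer (hdvd.trans hf)] at hd
      have := natDegree_mul hg0 he0
      rw [hmul] at this
      omega
  · exact ⟨⊤, fun h => absurd h hg⟩

lemma frobAct_eq_zero_of_isCoprime {P g h : K[X]} (hc : IsCoprime P g) {x : L}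
    (h1 : frobAct K (g * h) x = 0) (h2 : frobAct K (P * h) x = 0) : frobAct K h x = 0 := by
  obtain ⟨u, v, huv⟩ := hc
  have : h = u * (P * h) + v * (g * h) := by linear_combination -h * huv
  rw [this, frobAct_add, frobAct_mul, h2, frobAct_mul v, h1, map_zero, map_zero, add_zero]

lemma frobAct_div_prod {f : K[X]} (hf0 : f ≠ 0) {t : Finset K[X]}
    (hc : (t : Set K[X]).Pairwise IsCoprime) (ht : ∏ g ∈ t, g ∣ f) {x : L}
    (hx : frobAct K f x = 0) :
    (∀ g ∈ t, frobAct K (f / g) x = 0) ↔ frobAct K (f / ∏ g ∈ t, g) x = 0 := by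
  classical
  induction t using Finset.induction_on with
  | empty => simp [hx]
  | insert a t ha ih =>
    have hd : (∏ g ∈ t, g) * a ∣ f := by rwa [prod_insert ha, mul_comm] at ht
    have ih' := ih (hc.mono (by simp)) ((Dvd.intro _ rfl).trans hd)
    have hcop : IsCoprime (∏ g ∈ t, g) a := IsCoprime.prod_left fun g hg =>
      hc (by simp [hg]) (by simp) (by rintro rfl; exact ha hg)
    obtain ⟨h, rfl⟩ := hd
    have hP0 : ∏ g ∈ t, g ≠ 0 := by
      intro h0; rw [h0] at hf0; simp at hf0
    have ha0 : a ≠ 0 := by rintro rfl; simp at hf0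
    rw [prod_insert ha]
    have e1 : (∏ g ∈ t, g) * a * h / ∏ g ∈ t, g = a * h := by
      rw [mul_assoc]; exact mul_div_cancel_left₀ _ hP0
    have e2 : (∏ g ∈ t, g) * a * h / a = (∏ g ∈ t, g) * h := by
      rw [mul_comm (∏ g ∈ t, g) a, mul_assoc]; exact mul_div_cancel_left₀ _ ha0
    have e3 : (∏ g ∈ t, g) * a * h / (a * ∏ g ∈ t, g) = h := by
      rw [mul_comm (∏ g ∈ t, g) a]
      exact mul_div_cancel_left₀ _ (mul_ne_zero ha0 hP0)
    rw [e3]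
    rw [e1] at ih'
    constructor
    · intro hall
      have h1 := ih'.1 fun g hg => hall g (mem_insert_of_mem hg)
      have h2 := hall a (mem_insert_self _ _)
      rw [e2] at h2
      exact frobAct_eq_zero_of_isCoprime hcop h1 h2
    · intro h0 g hg
      rcases mem_insert.1 hg with rfl | hg
      · rw [e2, frobAct_mul, h0, map_zero]
      · exact ih'.2 (by rw [frobAct_mul, h0, map_zero]) g hg

open Classical in
lemma card_mem_all {f : K[X]} (hf : f ∣ X ^ Module.finrank K L - 1) {V : K[X] → AddSubgroup L}
    {t : Finset K[X]} (hV : ∀ g ∈ t, (∀ x ∈ frobKer K L f, x ∈ V g ↔ frobAct K (f / g) x = 0) ∧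
      (V g).index = Fintype.card K ^ g.natDegree)
    (hc : (t : Set K[X]).Pairwise IsCoprime) (ht : ∏ g ∈ t, g ∣ f) :
    (#{x : L | x ∈ frobKer K L f ∧ ∀ g ∈ t, x ∈ V g} : ℝ) =
      (Fintype.card K : ℝ) ^ f.natDegree * ∏ g ∈ t, ((V g).index : ℝ)⁻¹ := by
  have hne : (X ^ Module.finrank K L - 1 : K[X]) ≠ 0 :=
    (monic_X_pow_sub_C 1 Module.finrank_pos.ne').ne_zero
  have hf0 : f ≠ 0 := ne_zero_of_dvd_ne_zero hne hf
  have hP0 : ∏ g ∈ t, g ≠ 0 := ne_zero_of_dvd_ne_zero hf0 ht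
  have hmul : (∏ g ∈ t, g) * (f / ∏ g ∈ t, g) = f := EuclideanDomain.mul_div_cancel' hP0 ht
  have hdvd : f / (∏ g ∈ t, g) ∣ f := Dvd.intro_left _ hmul
  have he0 := ne_zero_of_dvd_ne_zero hf0 hdvd
  have hset : ({x : L | x ∈ frobKer K L f ∧ ∀ g ∈ t, x ∈ V g} : Finset L) =
      ({x : L | x ∈ frobKer K L (f / ∏ g ∈ t, g)} : Finset L) := by
    ext x
    simp only [mem_filter, mem_univ, true_and]
    constructor
    · rintro ⟨h1, h2⟩
      rw [mem_frobKer, ← frobAct_div_prod hf0 hc ht (mem_frobKer.1 h1)]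
      exact fun g hg => ((hV g hg).1 x h1).1 (h2 g hg)
    · intro h
      have h1 := frobKer_mono hdvd h
      refine ⟨h1, fun g hg => ((hV g hg).1 x h1).2 ?_⟩
      rw [mem_frobKer, ← frobAct_div_prod hf0 hc ht (mem_frobKer.1 h1)] at h
      exact h g hg
  have hcard : #({x : L | x ∈ frobKer K L (f / ∏ g ∈ t, g)} : Finset L) =
      Fintype.card K ^ (f / ∏ g ∈ t, g).natDegree := by
    rw [← finrank_frobKer (hdvd.trans hf), ← card_submodule, Nat.card_eq_fintype_card,
      Fintype.card_subtype]
  have hprod : ∏ g ∈ t, ((V g).index : ℝ) = (Fintype.card K : ℝ) ^ (∏ g ∈ t, g).natDegree := by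
    rw [natDegree_prod _ _ fun g hg h0 => hP0 (prod_eq_zero hg h0), ← prod_pow_eq_pow_sum]
    exact prod_congr rfl fun g hg => by rw [(hV g hg).2]; push_cast; rfl
  have hq : (Fintype.card K : ℝ) ≠ 0 := by exact_mod_cast Fintype.card_ne_zero
  have hdeg := natDegree_mul hP0 he0
  rw [hmul] at hdeg
  rw [hset, hcard, prod_inv_distrib, hprod, hdeg, pow_add]
  push_cast
  field_simp

open Classical in
lemma card_mem_none {f : K[X]} (hf : f ∣ X ^ Module.finrank K L - 1) {V : K[X] → AddSubgroup L}
    {t : Finset K[X]} (hV : ∀ g ∈ t, (∀ x ∈ frobKer K L f, x ∈ V g ↔ frobAct K (f / g) x = 0) ∧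
      (V g).index = Fintype.card K ^ g.natDegree)
    (hc : (t : Set K[X]).Pairwise IsCoprime) (ht : ∏ g ∈ t, g ∣ f) :
    (#{x : L | x ∈ frobKer K L f ∧ ∀ g ∈ t, x ∉ V g} : ℝ) =
      (Fintype.card K : ℝ) ^ f.natDegree * ∏ g ∈ t, (1 - ((V g).index : ℝ)⁻¹) := by
  have h1 : (#{x : L | x ∈ frobKer K L f ∧ ∀ g ∈ t, x ∉ V g} : ℝ) =
      ∑ x : L, (if x ∈ frobKer K L f then 1 else 0) *
        ∏ g ∈ t, (1 + -(if x ∈ V g then (1 : ℝ) else 0)) := by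
    rw [natCast_card_filter]
    refine sum_congr rfl fun x _ => ?_
    by_cases hx : x ∈ frobKer K L f
    · by_cases hall : ∀ g ∈ t, x ∉ V g
      · rw [if_pos ⟨hx, hall⟩, if_pos hx, prod_eq_one, mul_one]
        exact fun g hg => by simp [hall g hg]
      · rw [if_neg (by tauto)]
        push Not at hall
        obtain ⟨g, hg, hxg⟩ := hall
        rw [prod_eq_zero hg (by simp [hxg]), mul_zero]
    · simp [hx]
  rw [h1]
  simp_rw [prod_one_add, mul_sum]
  rw [sum_comm]
  simp_rw [sub_eq_add_neg, prod_one_add, mul_sum]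
  refine sum_congr rfl fun s hs => ?_
  have hst := mem_powerset.1 hs
  have := card_mem_all hf (fun g hg => hV g (hst hg)) (hc.mono (by exact_mod_cast hst))
    ((prod_dvd_prod_of_subset _ _ _ hst).trans ht)
  have e : ∀ x : L, (if x ∈ frobKer K L f then (1 : ℝ) else 0) *
      ∏ g ∈ s, -(if x ∈ V g then (1 : ℝ) else 0) =
      (-1) ^ #s * if x ∈ frobKer K L f ∧ ∀ g ∈ s, x ∈ V g then 1 else 0 := by
    intro x
    rw [prod_neg, prod_ite_zero]
    by_cases hx : x ∈ frobKer K L f <;> by_cases ha : ∀ g ∈ s, x ∈ V g <;> simp [hx, ha]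
  rw [sum_congr rfl fun x _ => e x, ← mul_sum, ← natCast_card_filter, this, prod_neg]
  ring

end Subspaces

section Criterion

lemma inv_index_lt_one {K L : Type*} [Field K] [Field L] [Fintype K]
    {V : AddSubgroup L} {d : ℕ} (hV : V.index = Fintype.card K ^ d)
    (hd : d ≠ 0) : ((V.index : ℝ))⁻¹ < 1 := by
  have : 1 < V.index := by rw [hV]; exact Nat.one_lt_pow hd Fintype.one_lt_card
  exact inv_lt_one_of_one_lt₀ (by exact_mod_cast this)

variable {K L : Type*} [Field K] [Field L] [Algebra K L] [Fintype L]

open Classical in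
lemma twistBound_mem_none (W : Submodule K L) (V : K[X] → AddSubgroup L) (t : Finset K[X]) :
    TwistBound (fun x : L => if x ∈ W ∧ ∀ g ∈ t, x ∉ V g then (1 : ℂ) else 0)
      ((∏ g ∈ t, (2 * (1 - ((V g).index : ℝ)⁻¹))) * √(Fintype.card L)) := by
  induction t using Finset.induction_on with
  | empty =>
    have := (twistBound_one (L := L)).mul_indicator (V := W.toAddSubgroup)
    simpa using this
  | insert a t ha ih =>
    have := ih.mul_one_sub_indicator (V := V a)
    rw [prod_insert ha, mul_assoc]
    convert this using 2 with x
    by_cases h1 : x ∈ W ∧ ∀ g ∈ t, x ∉ V g <;> by_cases h2 : x ∈ V a <;>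
      simp [h1, h2]

variable [Fintype K]

lemma exists_orderOf_of_sieve [DecidableEq K] {f : K[X]} (hf : f ∣ X ^ Module.finrank K L - 1)
    {Q : ℕ} (hQ : Q * (Fintype.card K - 1) = Fintype.card L - 1)
    (heven : 2 ∣ Fintype.card L - 1) {A B : Finset K[X]} (hAB : Disjoint A B)
    (hdeg : ∀ g ∈ A, g.natDegree ≠ 0)
    (hc : ((A ∪ B : Finset K[X]) : Set K[X]).Pairwise IsCoprime) (hprod : ∏ g ∈ A ∪ B, g ∣ f)
    {C T : Finset ℕ} (hCT : Disjoint C T) (hunion : C ∪ T = Q.primeFactors) (h2T : 2 ∉ T)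
    {δ : ℝ} (hδ : δ = 1 - ∑ l ∈ T, (l : ℝ)⁻¹ - ∑ g ∈ B, ((Fintype.card K : ℝ) ^ g.natDegree)⁻¹)
    (hδ0 : 0 ≤ δ)
    (hmain : 2 ^ #A * (2 ^ #C * if 4 ∣ Q then 2 else 1) * √(Fintype.card L) *
      (#T + #B - 1 + 2 * δ) < δ * (Fintype.card K : ℝ) ^ f.natDegree) :
    ∃ α : L, orderOf α = (Fintype.card L - 1) / 2 ∧ frobAct K f α = 0 ∧
      ∀ g ∈ A ∪ B, frobAct K (f / g) α ≠ 0 := by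
  classical
  choose V hV using fun g => exists_addSubgroup_of_dvd hf g
  have hdvd : ∀ g ∈ A ∪ B, g ∣ f := fun g hg => (dvd_prod_of_mem _ hg).trans hprod
  have hVA : ∀ g ∈ A ∪ B, _ := fun g hg => hV g (hdvd g hg)
  have hVA' : ∀ g ∈ A, _ := fun g hg => hVA g (mem_union_left B hg)
  have hcA : (A : Set K[X]).Pairwise IsCoprime := hc.mono (by simp)
  have hpA : ∏ g ∈ A, g ∣ f := (prod_dvd_prod_of_subset _ _ _ subset_union_left).trans hprod
  set θ : ℝ := ∏ g ∈ A, (1 - ((V g).index : ℝ)⁻¹) with hθ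
  have hθ0 : 0 < θ := prod_pos fun g hg => sub_pos.2 (inv_index_lt_one (hVA' g hg).2 (hdeg g hg))
  have hcard := card_mem_none hf hVA' hcA hpA
  have hL1 : (1 : ℝ) ≤ √(Fintype.card L) := by
    rw [Real.one_le_sqrt]; exact_mod_cast Fintype.card_pos
  have hE : (∏ g ∈ A, (2 * (1 - ((V g).index : ℝ)⁻¹))) = 2 ^ #A * θ := by
    rw [prod_mul_distrib, prod_const]
  obtain ⟨x, hPx, hBx, c, hc0, hord⟩ := exists_smul_orderOf_of_sieve (K := K) hQ heven
    (P := fun x => x ∈ frobKer K L f ∧ ∀ g ∈ A, x ∉ V g)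
    (E := (∏ g ∈ A, (2 * (1 - ((V g).index : ℝ)⁻¹))) * √(Fintype.card L))
    (by rw [hE]; positivity) (twistBound_mem_none _ _ _) (by
      rintro ⟨-, h0⟩
      have : A = ∅ := eq_empty_of_forall_notMem fun g hg => h0 g hg (V g).zero_mem
      simpa [this] using hL1) hCT hunion h2T B V (by
      intro k hk
      have hkA : k ∉ A := disjoint_right.1 hAB hk
      have hsub : insert k A ⊆ A ∪ B := insert_subset (mem_union_right _ hk) subset_union_left
      have h1 := card_mem_none hf (fun g hg => hVA g (hsub hg)) (hc.mono (by exact_mod_cast hsub))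
        ((prod_dvd_prod_of_subset _ _ _ hsub).trans hprod)
      rw [prod_insert hkA] at h1
      have h2 : ∑ x : L, (if x ∈ frobKer K L f ∧ ∀ g ∈ A, x ∉ V g then (1 : ℝ) else 0) *
          ((if x ∈ V k then (1 : ℝ) else 0) - ((V k).index : ℝ)⁻¹) = 0 := by
        have e : ∀ x : L, (if x ∈ frobKer K L f ∧ ∀ g ∈ A, x ∉ V g then (1 : ℝ) else 0) *
            ((if x ∈ V k then (1 : ℝ) else 0) - ((V k).index : ℝ)⁻¹) =
            (1 - ((V k).index : ℝ)⁻¹) *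
              (if x ∈ frobKer K L f ∧ ∀ g ∈ A, x ∉ V g then (1 : ℝ) else 0) -
              (if x ∈ frobKer K L f ∧ ∀ g ∈ insert k A, x ∉ V g then (1 : ℝ) else 0) := by
          intro x
          by_cases h1 : x ∈ frobKer K L f ∧ ∀ g ∈ A, x ∉ V g <;> by_cases h2 : x ∈ V k
          · simp [h1, h2]
          · rw [if_pos h1, if_neg h2, if_pos (by simpa [h2] using h1)]; ring
          · simp [h1, h2]
          · rw [if_neg h1, if_neg h2, if_neg (by simpa [h2] using h1)]; ring
        rw [sum_congr rfl fun x _ => e x, sum_sub_distrib, ← mul_sum, ← natCast_card_filter,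
          ← natCast_card_filter, h1, hcard]
        ring
      have := congrArg (fun r : ℝ => (r : ℂ)) h2
      push_cast at this
      convert this using 2 with x
      split_ifs <;> simp)
    (δ := δ) (by
      rw [hδ]
      congr 1
      exact sum_congr rfl fun g hg => by
        rw [(hVA g (mem_union_right _ hg)).2]; push_cast; rfl) hδ0 (by
      rw [hcard, hE, ← hθ]
      calc _ = (2 ^ #A * (2 ^ #C * if 4 ∣ Q then 2 else 1) * √(Fintype.card L) *
            (#T + #B - 1 + 2 * δ)) * θ := by ring
        _ < _ := mul_lt_mul_of_pos_right hmain hθ0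
        _ = _ := by ring)
  refine ⟨c • x, hord, ?_, fun g hg h0 => ?_⟩
  · rw [map_smul, mem_frobKer.1 hPx.1, smul_zero]
  · rw [map_smul, smul_eq_zero_iff_right hc0, ← (hVA g hg).1 x hPx.1] at h0
    rcases mem_union.1 hg with h | h
    · exact hPx.2 g h h0
    · exact hBx g h h0

lemma finrank_conjSpan_of_normalizedFactors [DecidableEq K] {n : ℕ} {f : K[X]}
    (hf : f ∣ X ^ Module.finrank K L - 1) (hn : f.natDegree ≤ n) {α : L}
    (hα : frobAct K f α = 0)
    (h : ∀ g ∈ normalizedFactors f, frobAct K (f / g) α ≠ 0) :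
    Module.finrank K (conjSpan K (Fintype.card K) n α) = f.natDegree := by
  have hne : (X ^ Module.finrank K L - 1 : K[X]) ≠ 0 :=
    (monic_X_pow_sub_C 1 Module.finrank_pos.ne').ne_zero
  have hf0 : f ≠ 0 := ne_zero_of_dvd_ne_zero hne hf
  refine finrank_conjSpan_of_forall hf hn hα fun g hg e he h0 => ?_
  obtain ⟨g', hg', hass⟩ := exists_mem_normalizedFactors_of_dvd hf0 hg (Dvd.intro _ he.symm)
  obtain ⟨u, hu⟩ := hass
  apply h g' hg'
  have : f = g' * ((↑u⁻¹ : K[X]) * e) := by rw [he, ← hu]; simp [mul_assoc]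
  have hg'0 : g' ≠ 0 := by rintro rfl; simp at this; exact hf0 this
  rw [this, mul_div_cancel_left₀ _ hg'0, frobAct_mul, h0, map_zero]

end Criterion

/-- An upper bound for the number of roots of `1 + X + ⋯ + X ^ (n - 1)` in a field with `q`
elements. -/
def rootBound (q n : ℕ) : ℕ :=
  if n.Coprime q then n.gcd (q - 1) - 1 else n.gcd (q - 1)

section GeomSum

variable {K : Type*} [Field K]

lemma geomSum_dvd (n : ℕ) : (∑ i ∈ range n, X ^ i : K[X]) ∣ X ^ n - 1 :=
  Dvd.intro _ (geom_sum_mul X n)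

lemma monic_geomSum {n : ℕ} (hn : n ≠ 0) : (∑ i ∈ range n, X ^ i : K[X]).Monic :=
  monic_geom_sum_X hn

lemma natDegree_geomSum {n : ℕ} (hn : n ≠ 0) :
    (∑ i ∈ range n, X ^ i : K[X]).natDegree = n - 1 := by
  have h := congrArg natDegree (geom_sum_mul (X : K[X]) n)
  rw [Monic.natDegree_mul (monic_geomSum hn) (by simpa using monic_X_sub_C (1 : K))] at h
  have h1 : (X - 1 : K[X]).natDegree = 1 := by simpa using natDegree_X_sub_C (1 : K)
  have h2 : (X ^ n - 1 : K[X]).natDegree = n := by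
    simpa using natDegree_X_pow_sub_C (n := n) (r := (1 : K))
  omega

variable [DecidableEq K]

/-- The monic irreducible factors of `1 + X + ⋯ + X ^ (n - 1)`. -/
noncomputable def geomFactors (K : Type*) [Field K] [DecidableEq K] (n : ℕ) : Finset K[X] :=
  (normalizedFactors (∑ i ∈ range n, X ^ i : K[X])).toFinset

lemma geomFactors_spec {n : ℕ} {g : K[X]} (hg : g ∈ geomFactors K n) :
    g.Monic ∧ Irreducible g ∧ g ∣ ∑ i ∈ range n, X ^ i := by
  have hg := Multiset.mem_toFinset.1 hg
  have h1 := irreducible_of_normalized_factor g hg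
  refine ⟨?_, h1, dvd_of_mem_normalizedFactors hg⟩
  rw [← normalize_normalized_factor g hg]
  exact monic_normalize h1.ne_zero

lemma pairwise_isCoprime_geomFactors (n : ℕ) :
    (geomFactors K n : Set K[X]).Pairwise IsCoprime := by
  intro g hg h hh hne
  obtain ⟨hgm, hgi, -⟩ := geomFactors_spec hg
  obtain ⟨hhm, hhi, -⟩ := geomFactors_spec hh
  refine (hgi.isCoprime_or_dvd h).resolve_right fun hd => hne ?_
  exact eq_of_monic_of_associated hgm hhm (hgi.associated_of_dvd hhi hd)

lemma prod_geomFactors_dvd (n : ℕ) :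
    ∏ g ∈ geomFactors K n, g ∣ ∑ i ∈ range n, X ^ i :=
  Finset.prod_dvd_of_coprime (pairwise_isCoprime_geomFactors n) 
    fun _ hg => (geomFactors_spec hg).2.2

lemma card_geomFactors_degree_le {n : ℕ} (hn : n ≠ 0) :
    #{g ∈ geomFactors K n | g.natDegree = 1} + 2 * #{g ∈ geomFactors K n | ¬ g.natDegree = 1} ≤
      n - 1 := by
  have h1 : ∑ g ∈ geomFactors K n, g.natDegree ≤ n - 1 := by
    rw [← natDegree_geomSum (K := K) hn, ← natDegree_prod _ _
      fun g hg => (geomFactors_spec hg).1.ne_zero]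
    exact natDegree_le_of_dvd (prod_geomFactors_dvd n) (monic_geomSum hn).ne_zero
  refine le_trans ?_ h1
  rw [← sum_filter_add_sum_filter_not (geomFactors K n) (fun g => g.natDegree = 1)]
  refine Nat.add_le_add ?_ ?_
  · rw [card_eq_sum_ones]
    exact sum_le_sum fun g hg => (mem_filter.1 hg).2.ge
  · rw [mul_comm, ← smul_eq_mul, ← sum_const]
    refine sum_le_sum fun g hg => ?_
    obtain ⟨hg, hd⟩ := mem_filter.1 hg
    have := (geomFactors_spec hg).2.1.natDegree_pos
    omega

variable [Fintype K]

lemma card_roots_geomSum_le {n : ℕ} (hn : n ≠ 0) :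
    #{r : K | ∑ i ∈ range n, r ^ i = 0} ≤ rootBound (Fintype.card K) n := by
  set q := Fintype.card K with hq
  have hq1 : 1 < q := Fintype.one_lt_card
  have hg0 : 0 < n.gcd (q - 1) := Nat.gcd_pos_of_pos_left _ (Nat.pos_of_ne_zero hn)
  have hsub : ∀ r : K, ∑ i ∈ range n, r ^ i = 0 → r ∈ nthRootsFinset (n.gcd (q - 1)) (1 : K) := by
    intro r hr
    have h1 : r ^ n = 1 := by
      have := geom_sum_mul r n
      rw [hr, zero_mul] at this
      exact (sub_eq_zero.1 this.symm)
    have hr0 : r ≠ 0 := by rintro rfl; simp [zero_pow hn] at h1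
    rw [mem_nthRootsFinset hg0]
    exact pow_gcd_eq_one.2 ⟨h1, FiniteField.pow_card_sub_one_eq_one r hr0⟩
  have hcard : #(nthRootsFinset (n.gcd (q - 1)) (1 : K)) ≤ n.gcd (q - 1) := by
    classical
    rw [nthRootsFinset_def]
    exact (Multiset.toFinset_card_le _).trans (card_nthRoots _ _)
  unfold rootBound
  split_ifs with hc
  · have : ({r : K | ∑ i ∈ range n, r ^ i = 0} : Finset K) ⊆
        (nthRootsFinset (n.gcd (q - 1)) (1 : K)).erase 1 := by
      intro r hr
      have hr := (mem_filter.1 hr).2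
      refine mem_erase.2 ⟨?_, hsub r hr⟩
      rintro rfl
      have hn0 : (n : K) = 0 := by simpa using hr
      have hco : IsCoprime (n : K) (q : K) := Nat.Coprime.cast hc
      rw [hn0, hq, FiniteField.cast_card_eq_zero] at hco
      exact not_isCoprime_zero_zero hco
    refine (card_le_card this).trans ?_
    rw [card_erase_of_mem (by rw [mem_nthRootsFinset hg0, one_pow])]
    omega
  · exact (card_le_card fun r hr => hsub r (mem_filter.1 hr).2).trans hcard

lemma card_filter_natDegree_eq_one_le {n : ℕ} (hn : n ≠ 0) :
    #{g ∈ geomFactors K n | g.natDegree = 1} ≤ rootBound (Fintype.card K) n := by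
  refine le_trans ?_ (card_roots_geomSum_le (K := K) hn)
  have hform : ∀ g ∈ geomFactors K n, g.natDegree = 1 → g = X - C (-g.coeff 0) := by
    intro g hg hd
    have hm := (geomFactors_spec hg).1
    have := eq_X_add_C_of_natDegree_le_one hd.le
    rw [← hd, hm.coeff_natDegree, C_1, one_mul] at this
    simpa using this
  refine card_le_card_of_injOn (fun g => -g.coeff 0) ?_ ?_
  · intro g hg
    obtain ⟨hg, hd⟩ := mem_filter.1 hg
    have hdvd := (geomFactors_spec hg).2.2
    rw [hform g hg hd, dvd_iff_isRoot, IsRoot, eval_finsetSum] at hdvd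
    simpa using hdvd
  · intro g hg h hh heq
    obtain ⟨hg, hd⟩ := mem_filter.1 hg
    obtain ⟨hh, hd'⟩ := mem_filter.1 hh
    rw [hform g hg hd, hform h hh hd']
    exact congrArg (fun r => X - C r) heq

lemma card_geomFactors_le {n : ℕ} (hn : n ≠ 0) :
    #(geomFactors K n) ≤ (n - 1 + rootBound (Fintype.card K) n) / 2 := by
  have h1 := card_filter_natDegree_eq_one_le (K := K) hn
  have h2 := card_geomFactors_degree_le (K := K) hn
  have h3 := card_filter_add_card_filter_not (s := geomFactors K n) (fun g => g.natDegree = 1)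
  omega

lemma sum_inv_geomFactors_le {n G : ℕ} (hn : n ≠ 0)
    (hG : #{g ∈ geomFactors K n | g.natDegree = 1} ≤ G) :
    ∑ g ∈ geomFactors K n, ((Fintype.card K : ℝ) ^ g.natDegree)⁻¹ ≤
      G / Fintype.card K + ((n : ℝ) - 1 - G) / (2 * (Fintype.card K : ℝ) ^ 2) := by
  have h2 := card_geomFactors_degree_le (K := K) hn
  have hq1 : (1 : ℝ) ≤ Fintype.card K := by exact_mod_cast Fintype.card_pos (α := K)
  set q : ℝ := (Fintype.card K : ℝ)
  set a := #{g ∈ geomFactors K n | g.natDegree = 1}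
  set b := #{g ∈ geomFactors K n | ¬ g.natDegree = 1}
  have h3 : ∑ g ∈ geomFactors K n, (q ^ g.natDegree)⁻¹ ≤ a * q⁻¹ + b * (q ^ 2)⁻¹ := by
    rw [← sum_filter_add_sum_filter_not (geomFactors K n) (fun g => g.natDegree = 1)]
    refine add_le_add ?_ ?_
    · rw [← nsmul_eq_mul]
      exact sum_le_card_nsmul _ _ _ fun g hg => by rw [(mem_filter.1 hg).2, pow_one]
    · rw [← nsmul_eq_mul]
      refine sum_le_card_nsmul _ _ _ fun g hg => ?_
      obtain ⟨hg, hd⟩ := mem_filter.1 hg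
      have := (geomFactors_spec hg).2.1.natDegree_pos
      have h : q ^ 2 ≤ q ^ g.natDegree := pow_le_pow_right₀ hq1 (by omega)
      gcongr
  refine h3.trans ?_
  have h4 : (a : ℝ) + 2 * b ≤ n - 1 := by
    have : a + 2 * b + 1 ≤ n := by omega
    have : (a : ℝ) + 2 * b + 1 ≤ n := by exact_mod_cast this
    linarith
  have h5 : (a : ℝ) ≤ G := by exact_mod_cast hG
  have hqpos : 0 < q := by linarith
  rw [div_add_div _ _ hqpos.ne' (by positivity), ← div_eq_mul_inv, ← div_eq_mul_inv,
    div_add_div _ _ hqpos.ne' (by positivity), div_le_div_iff₀ (by positivity) (by positivity)]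
  have : (a * q ^ 2 + q * b) * 2 ≤ G * (2 * q ^ 2) + q * (n - 1 - G) := by
    nlinarith [mul_nonneg (sub_nonneg.2 h5) (sub_nonneg.2 hq1),
      mul_nonneg (mul_nonneg (sub_nonneg.2 h5) (sub_nonneg.2 hq1)) hqpos.le,
      mul_nonneg (sub_nonneg.2 h5) hqpos.le,
      mul_nonneg (sub_nonneg.2 h4) hqpos.le]
  nlinarith [mul_le_mul_of_nonneg_left this (by positivity : 0 ≤ q * q ^ 2)]

end GeomSum

lemma sieve_inequality {q n a s W D Z : ℕ} (hq0 : 0 < q) (hn : 2 ≤ n) (hD : 0 < D) (hZ : 0 < Z)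
    (hmain : 4 ^ a * W ^ 2 * (s * Z + 2 * D) ^ 2 < D ^ 2 * q ^ (n - 2))
    {w u δ : ℝ} (hw : w ≤ 2 ^ a * W) (hw0 : 0 ≤ w) (hu : u ≤ s) (hδ : (D : ℝ) / Z ≤ δ) :
    w * √((q : ℝ) ^ n) * (u + 2 * δ) < δ * (q : ℝ) ^ (n - 1) := by
  have hD' : (0 : ℝ) < D := by exact_mod_cast hD
  have hZ' : (0 : ℝ) < Z := by exact_mod_cast hZ
  have hq : (0 : ℝ) < q := by exact_mod_cast hq0
  set d : ℝ := D / Z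
  have hd : 0 < d := by positivity
  have hδ0 : 0 < δ := hd.trans_le hδ
  set r := √((q : ℝ) ^ (n - 2))
  have h1 : 2 ^ a * W * (s + 2 * d) < d * r := by
    refine lt_of_pow_lt_pow_left₀ 2 (by positivity) ?_
    have hr : r ^ 2 = (q : ℝ) ^ (n - 2) := Real.sq_sqrt (by positivity)
    have h : (4 : ℝ) ^ a * W ^ 2 * (s * Z + 2 * D) ^ 2 < D ^ 2 * q ^ (n - 2) := by
      exact_mod_cast hmain
    have e1 : (2 ^ a * W * (s + 2 * d)) ^ 2 * Z ^ 2 = 4 ^ a * W ^ 2 * (s * Z + 2 * D) ^ 2 := by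
      have : (s * Z + 2 * D : ℝ) = (s + 2 * d) * Z := by simp only [d]; field_simp
      rw [this, show (4 : ℝ) = 2 ^ 2 by norm_num, ← pow_mul]
      ring
    have e2 : (d * r) ^ 2 * Z ^ 2 = D ^ 2 * q ^ (n - 2) := by
      rw [mul_pow, hr]; simp only [d]; field_simp
    rw [← e1, ← e2] at h
    exact lt_of_mul_lt_mul_right h (by positivity)
  have h2 : √((q : ℝ) ^ n) = q * r := by
    rw [show n = 2 + (n - 2) by omega, pow_add, Real.sqrt_mul (by positivity),
      Real.sqrt_sq hq.le]
  have h3 : (q : ℝ) ^ (n - 1) = q * r ^ 2 := by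
    rw [Real.sq_sqrt (by positivity), ← pow_succ']
    congr 1; omega
  have hr0 : 0 < r := by positivity
  have h4 : d * (u + 2 * δ) ≤ δ * (s + 2 * d) := by
    have : (0 : ℝ) ≤ s := by positivity
    nlinarith
  rw [h2, h3]
  have h5 : w * (u + 2 * δ) < δ * r := by
    by_cases hneg : u + 2 * δ ≤ 0
    · have := mul_nonpos_of_nonneg_of_nonpos hw0 hneg
      have : 0 < δ * r := by positivity
      linarith
    push Not at hneg
    refine lt_of_mul_lt_mul_left ?_ hd.le
    calc d * (w * (u + 2 * δ)) ≤ d * (2 ^ a * W * (u + 2 * δ)) := by gcongr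
      _ = 2 ^ a * W * (d * (u + 2 * δ)) := by ring
      _ ≤ 2 ^ a * W * (δ * (s + 2 * d)) := by gcongr
      _ = δ * (2 ^ a * W * (s + 2 * d)) := by ring
      _ < δ * (d * r) := by gcongr
      _ = _ := by ring
  calc w * (q * r) * (u + 2 * δ) = q * r * (w * (u + 2 * δ)) := by ring
    _ < q * r * (δ * r) := by gcongr
    _ = _ := by ring

section Modes

variable {K L : Type*} [Field K] [Field L] [Algebra K L] [Fintype K] [Fintype L]

lemma exists_orderOf_of_bounds [DecidableEq K] (hodd : Odd (Fintype.card K))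
    (hn : 2 ≤ Module.finrank K L)
    {A B : Finset K[X]} (hAB : Disjoint A B) (hS : A ∪ B ⊆ geomFactors K (Module.finrank K L))
    {Q : ℕ} (hQ : Q * (Fintype.card K - 1) = Fintype.card K ^ Module.finrank K L - 1)
    {C T : Finset ℕ} (hCT : Disjoint C T) (hunion : C ∪ T = Q.primeFactors) (h2T : 2 ∉ T)
    {a s W D Z : ℕ} (hA : #A ≤ a) (hs : #T + #B ≤ s + 1)
    (hW : (2 ^ #C * if 4 ∣ Q then 2 else 1) ≤ W) (hD : 0 < D) (hZ : 0 < Z)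
    (hδ : (D : ℝ) / Z ≤
      1 - ∑ l ∈ T, (l : ℝ)⁻¹ - ∑ g ∈ B, ((Fintype.card K : ℝ) ^ g.natDegree)⁻¹)
    (hmain : 4 ^ a * W ^ 2 * (s * Z + 2 * D) ^ 2 <
      D ^ 2 * Fintype.card K ^ (Module.finrank K L - 2)) :
    ∃ α : L, orderOf α = (Fintype.card L - 1) / 2 ∧
      frobAct K (∑ i ∈ range (Module.finrank K L), X ^ i) α = 0 ∧
      ∀ g ∈ A ∪ B, frobAct K ((∑ i ∈ range (Module.finrank K L), X ^ i) / g) α ≠ 0 := by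
  set n := Module.finrank K L
  have hn0 : n ≠ 0 := by omega
  have hcardL : Fintype.card L = Fintype.card K ^ n := by
    rw [← Nat.card_eq_fintype_card, Module.natCard_eq_pow_finrank (K := K),
      Nat.card_eq_fintype_card]
  refine exists_orderOf_of_sieve (geomSum_dvd n) (by rw [hQ, hcardL])
    (by rw [hcardL]; exact (Nat.Odd.sub_odd hodd.pow odd_one).two_dvd) hAB
    (fun g hg => (geomFactors_spec (hS (mem_union_left _ hg))).2.1.natDegree_pos.ne')
    ((pairwise_isCoprime_geomFactors n).mono (by exact_mod_cast hS))
    ((prod_dvd_prod_of_subset _ _ _ hS).trans (prod_geomFactors_dvd n)) hCT hunion h2T rfl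
    (le_trans (by positivity) hδ) ?_
  rw [natDegree_geomSum hn0, hcardL]
  push_cast
  refine sieve_inequality Fintype.card_pos hn hD hZ hmain ?_ (by positivity) ?_ hδ
  · have h1 : ((2 : ℝ) ^ #C * if 4 ∣ Q then 2 else 1) ≤ W := by exact_mod_cast hW
    have h2 : (2 : ℝ) ^ #A ≤ 2 ^ a := pow_le_pow_right₀ (by norm_num) hA
    exact mul_le_mul h2 h1 (by positivity) (by positivity)
  · have : (#T : ℝ) + #B ≤ s + 1 := by exact_mod_cast hs
    linarith

/-- Sieving over the primes in `T` and over all irreducible factors of `(X ^ n - 1) / (X - 1)`. -/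
lemma exists_of_sieve_factors [DecidableEq K] (hodd : Odd (Fintype.card K))
    (hn : 2 ≤ Module.finrank K L)
    {Q : ℕ} (hQ : Q * (Fintype.card K - 1) = Fintype.card K ^ Module.finrank K L - 1)
    {C T : Finset ℕ} (hCT : Disjoint C T) (hunion : C ∪ T = Q.primeFactors) (h2T : 2 ∉ T)
    {s W D Z : ℕ} (hs : #T + #(geomFactors K (Module.finrank K L)) ≤ s + 1)
    (hW : (2 ^ #C * if 4 ∣ Q then 2 else 1) ≤ W) (hD : 0 < D) (hZ : 0 < Z)
    (hδ : (D : ℝ) / Z ≤ 1 - ∑ l ∈ T, (l : ℝ)⁻¹ -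
      ∑ g ∈ geomFactors K (Module.finrank K L), ((Fintype.card K : ℝ) ^ g.natDegree)⁻¹)
    (hmain : W ^ 2 * (s * Z + 2 * D) ^ 2 <
      D ^ 2 * Fintype.card K ^ (Module.finrank K L - 2)) :
    ∃ α : L, orderOf α = (Fintype.card L - 1) / 2 ∧
      Module.finrank K (conjSpan K (Fintype.card K) (Module.finrank K L) α) =
        Module.finrank K L - 1 := by
  have hn0 : Module.finrank K L ≠ 0 := by omega
  obtain ⟨α, h1, h2, h3⟩ := exists_orderOf_of_bounds (L := L) hodd hn
    (disjoint_empty_left (geomFactors K (Module.finrank K L))) (by rw [empty_union]) hQ hCT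
    hunion h2T (a := 0) (by simp) hs hW hD hZ hδ (by simpa using hmain)
  refine ⟨α, h1, ?_⟩
  rw [finrank_conjSpan_of_normalizedFactors (geomSum_dvd _)
    (by rw [natDegree_geomSum hn0]; omega) h2, natDegree_geomSum hn0]
  exact fun g hg => h3 g (by rw [empty_union]; exact Multiset.mem_toFinset.2 hg)

/-- Sieving over the primes in `T` only. -/
lemma exists_of_sieve_primes (hodd : Odd (Fintype.card K))
    (hn : 2 ≤ Module.finrank K L)
    {Q : ℕ} (hQ : Q * (Fintype.card K - 1) = Fintype.card K ^ Module.finrank K L - 1)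
    {C T : Finset ℕ} (hCT : Disjoint C T) (hunion : C ∪ T = Q.primeFactors) (h2T : 2 ∉ T)
    {a s W D Z : ℕ}
    (ha : (Module.finrank K L - 1 + rootBound (Fintype.card K) (Module.finrank K L)) / 2 ≤ a)
    (hs : #T ≤ s + 1) (hW : (2 ^ #C * if 4 ∣ Q then 2 else 1) ≤ W) (hD : 0 < D) (hZ : 0 < Z)
    (hδ : (D : ℝ) / Z ≤ 1 - ∑ l ∈ T, (l : ℝ)⁻¹)
    (hmain : 4 ^ a * W ^ 2 * (s * Z + 2 * D) ^ 2 <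
      D ^ 2 * Fintype.card K ^ (Module.finrank K L - 2)) :
    ∃ α : L, orderOf α = (Fintype.card L - 1) / 2 ∧
      Module.finrank K (conjSpan K (Fintype.card K) (Module.finrank K L) α) =
        Module.finrank K L - 1 := by
  classical
  have hn0 : Module.finrank K L ≠ 0 := by omega
  have hcard := (card_geomFactors_le (K := K) hn0).trans ha
  obtain ⟨α, h1, h2, h3⟩ := exists_orderOf_of_bounds (L := L) hodd hn
    (disjoint_empty_right (geomFactors K (Module.finrank K L)))
    (by rw [union_empty]) hQ hCT
    hunion h2T hcard (by simpa using hs) hW hD hZ (by simpa using hδ) hmain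
  refine ⟨α, h1, ?_⟩
  rw [finrank_conjSpan_of_normalizedFactors (geomSum_dvd _)
    (by rw [natDegree_geomSum hn0]; omega) h2, natDegree_geomSum hn0]
  exact fun g hg => h3 g (by rw [union_empty]; exact Multiset.mem_toFinset.2 hg)

lemma finrank_conjSpan_three (h3 : Module.finrank K L = 3) {α : L}
    (hord : orderOf α = (Fintype.card L - 1) / 2)
    (hα : frobAct K (∑ i ∈ range 3, X ^ i) α = 0) :
    Module.finrank K (conjSpan K (Fintype.card K) 3 α) = 2 := by
  have hq1 : 1 < Fintype.card K := Fintype.one_lt_card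
  have hcardL : Fintype.card L = Fintype.card K ^ 3 := by
    rw [← Nat.card_eq_fintype_card, Module.natCard_eq_pow_finrank (K := K),
      Nat.card_eq_fintype_card, h3]
  set q := Fintype.card K with hq
  have hbig : (q - 1) ^ 2 < (Fintype.card L - 1) / 2 := by
    rw [hcardL]
    obtain ⟨m, hm⟩ : ∃ m, q = m + 2 := ⟨q - 2, by omega⟩
    rw [hm, Nat.lt_div_iff_mul_lt two_pos]
    have : (m + 2) ^ 3 - 1 = m ^ 3 + 6 * m ^ 2 + 12 * m + 7 := by
      rw [show (m + 2) ^ 3 = m ^ 3 + 6 * m ^ 2 + 12 * m + 7 + 1 by ring]; simp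
    rw [this, show m + 2 - 1 = m + 1 by omega]
    have : (m + 1) ^ 2 * 2 < m ^ 3 + 6 * m ^ 2 + 12 * m + 6 := by nlinarith [sq_nonneg m]
    omega
  have hpos : 0 < orderOf α := by rw [hord]; omega
  have hα0 : α ≠ 0 := by
    rintro rfl
    have := pow_orderOf_eq_one (0 : L)
    rw [zero_pow hpos.ne'] at this
    exact zero_ne_one this
  have hdeg := natDegree_geomSum (K := K) three_ne_zero
  rw [finrank_conjSpan_of_forall (by rw [h3]; exact geomSum_dvd 3) (by rw [hdeg]; omega) hα, hdeg]
  intro g hg e he h0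
  have hf0 : (∑ i ∈ range 3, X ^ i : K[X]) ≠ 0 := (monic_geomSum three_ne_zero).ne_zero
  have he0 : e ≠ 0 := by rintro rfl; simp [he] at hf0
  have hsum := natDegree_mul hg.ne_zero he0
  rw [← he, hdeg] at hsum
  have hgd := hg.natDegree_pos
  have hform := eq_X_add_C_of_natDegree_le_one (p := e) (by omega)
  rw [hform, frobAct_add, frobAct_mul, frobAct_C, frobAct_C, frobAct_X] at h0
  by_cases ha : e.coeff 1 = 0
  · have hb : e.coeff 0 ≠ 0 := by
      intro hb; rw [ha, hb] at hform; simp at hform; exact he0 hform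
    rw [ha, zero_smul, zero_add] at h0
    exact hα0 ((smul_eq_zero_iff_right hb).1 h0)
  · set c : K := -(e.coeff 0 / e.coeff 1)
    have h1 : α ^ q = algebraMap K L c * α := by
      have : α ^ q = c • α := by
        have h2 : e.coeff 1 • (α ^ q - c • α) = 0 := by
          rw [smul_sub, smul_smul, ← h0]
          have : e.coeff 1 * c = -e.coeff 0 := by simp only [c]; field_simp
          rw [this, neg_smul]; simp [hq]
        exact sub_eq_zero.1 ((smul_eq_zero_iff_right ha).1 h2)
      rw [this, Algebra.smul_def]
    have h2 : α ^ (q - 1) = algebraMap K L c := by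
      refine mul_right_cancel₀ hα0 ?_
      rw [← h1, ← pow_succ]; congr 1; omega
    have hc0 : c ≠ 0 := by
      rintro hc; rw [hc, map_zero] at h2; exact pow_ne_zero _ hα0 h2
    have h4 : α ^ (q - 1) ^ 2 = 1 := by
      rw [sq, pow_mul, h2, ← map_pow, FiniteField.pow_card_sub_one_eq_one c hc0, map_one]
    have := Nat.le_of_dvd (by have : 0 < q - 1 := by omega
                              positivity) (orderOf_dvd_of_pow_eq_one h4)
    omega

/-- In degree three every element of trace zero and order `(q ^ 3 - 1) / 2` is `1`-normal. -/
lemma exists_of_sieve_three (hodd : Odd (Fintype.card K)) (h3 : Module.finrank K L = 3)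
    {Q : ℕ} (hQ : Q * (Fintype.card K - 1) = Fintype.card K ^ 3 - 1)
    {C T : Finset ℕ} (hCT : Disjoint C T) (hunion : C ∪ T = Q.primeFactors) (h2T : 2 ∉ T)
    {s W D Z : ℕ} (hs : #T ≤ s + 1) (hW : (2 ^ #C * if 4 ∣ Q then 2 else 1) ≤ W)
    (hD : 0 < D) (hZ : 0 < Z) (hδ : (D : ℝ) / Z ≤ 1 - ∑ l ∈ T, (l : ℝ)⁻¹)
    (hmain : W ^ 2 * (s * Z + 2 * D) ^ 2 < D ^ 2 * Fintype.card K) :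
    ∃ α : L, orderOf α = (Fintype.card L - 1) / 2 ∧
      Module.finrank K (conjSpan K (Fintype.card K) 3 α) = 2 := by
  classical
  obtain ⟨α, h1, h2, -⟩ := exists_orderOf_of_bounds (K := K) (L := L) hodd (by omega)
    (disjoint_empty_right (∅ : Finset K[X])) (by simp) (by rw [h3, hQ]) hCT hunion h2T
    (a := 0) (by simp) (by simpa using hs) hW hD hZ (by simpa using hδ) (by simpa [h3] using hmain)
  rw [h3] at h2
  exact ⟨α, h1, finrank_conjSpan_three h3 h1 h2⟩

end Modes

/-- The number `(q ^ n - 1) / (q - 1)`. -/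
def geomNat (q n : ℕ) : ℕ := ∑ i ∈ range n, q ^ i

lemma geomNat_mul {q : ℕ} (hq : 1 ≤ q) (n : ℕ) : geomNat q n * (q - 1) = q ^ n - 1 := by
  have h := geom_sum_mul (q : ℤ) n
  zify [hq, Nat.one_le_pow n q hq]
  rw [← h, geomNat]
  push_cast
  rfl

lemma geomNat_pos {q n : ℕ} (hn : n ≠ 0) : 0 < geomNat q n :=
  sum_pos' (fun _ _ => Nat.zero_le _) ⟨0, by simpa [Nat.pos_iff_ne_zero] using hn, by simp⟩

lemma four_mul_geomNat_lt {q n : ℕ} (hq : 5 ≤ q) (hn : n ≠ 0) :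
    4 * geomNat q n < 5 * q ^ (n - 1) := by
  have h1 := geomNat_mul (by omega : 1 ≤ q) n
  obtain ⟨m, rfl⟩ : ∃ m, n = m + 1 := ⟨n - 1, by omega⟩
  obtain ⟨r, rfl⟩ : ∃ r, q = r + 5 := ⟨q - 5, by omega⟩
  have hpos : 0 < (r + 5) ^ m := by positivity
  simp only [Nat.add_sub_cancel, show r + 5 - 1 = r + 4 by omega] at *
  have h2 : geomNat (r + 5) (m + 1) * (r + 4) < (r + 5) ^ m * (r + 5) := by
    rw [h1, pow_succ]
    have : 0 < (r + 5) ^ m * (r + 5) := by positivity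
    omega
  by_contra! h
  nlinarith

lemma geomNat_odd {q n : ℕ} (hq : Odd q) (hn : Odd n) : ¬ 2 ∣ geomNat q n := by
  rw [← even_iff_two_dvd, Nat.not_even_iff_odd, geomNat, Finset.odd_sum_iff_odd_card_odd]
  rw [filter_true_of_mem fun i _ => hq.pow, card_range]
  exact hn

section PrimeSets

lemma pow_card_mul_prod_le {b : ℕ} {T P : Finset ℕ} (hP : ∀ l ∈ P, l ≤ b)
    (hT : ∀ l ∈ T, l ∉ P → b ≤ l) :
    b ^ #T * ∏ l ∈ P, l ≤ b ^ #P * ∏ l ∈ T, l := by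
  have h1 : b ^ #(T \ P) ≤ ∏ l ∈ T \ P, l := pow_card_le_prod _ _ _ fun l hl =>
    hT l (mem_sdiff.1 hl).1 (mem_sdiff.1 hl).2
  have h2 : ∏ l ∈ P \ T, l ≤ b ^ #(P \ T) := prod_le_pow_card _ _ _ fun l hl =>
    hP l (mem_sdiff.1 hl).1
  rw [← card_inter_add_card_sdiff T P, ← card_inter_add_card_sdiff P T,
    ← prod_inter_mul_prod_sdiff T P, ← prod_inter_mul_prod_sdiff P T, inter_comm P T, pow_add,
    pow_add]
  calc _ = b ^ #(T ∩ P) * (∏ l ∈ T ∩ P, l) * (b ^ #(T \ P) * ∏ l ∈ P \ T, l) := by ring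
    _ ≤ b ^ #(T ∩ P) * (∏ l ∈ T ∩ P, l) * ((∏ l ∈ T \ P, l) * b ^ #(P \ T)) := by gcongr
    _ = _ := by ring

lemma prod_dvd_of_subset_primeFactors {Q : ℕ} {T : Finset ℕ} (h : T ⊆ Q.primeFactors) :
    ∏ l ∈ T, l ∣ Q := (prod_dvd_prod_of_subset _ _ _ h).trans (Nat.prod_primeFactors_dvd Q)

/-- `2 ^ ω(Q)`, doubled when `4 ∣ Q`, is at most a multiple of a root of `Q`. -/
lemma two_pow_card_primeFactors_le {Q k b : ℕ} (hQ : Q ≠ 0) (hk : 2 ≤ k) (hb : b = 2 ^ k)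
    {P : Finset ℕ} (hP : ∀ l ∈ P, l ≤ b)
    (hsmall : ∀ l < b, l.Prime → l ≠ 2 → l ∈ P) :
    4 * ((∏ l ∈ P, l) * (2 ^ #Q.primeFactors * if 4 ∣ Q then 2 else 1) ^ k) ≤
      4 ^ k * (b ^ #P * Q) := by
  set T := Q.primeFactors.erase 2
  have hT : b ^ #T * ∏ l ∈ P, l ≤ b ^ #P * ∏ l ∈ T, l := by
    refine pow_card_mul_prod_le hP fun l hl hlP => ?_
    by_contra! h
    exact hlP (hsmall l h (Nat.prime_of_mem_primeFactors (mem_of_mem_erase hl))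
      (ne_of_mem_erase hl))
  have hbT : b ^ #T = (2 ^ #T) ^ k := by rw [hb, ← pow_mul, ← pow_mul, mul_comm]
  have h4k : 4 ^ 2 ≤ 4 ^ k := Nat.pow_le_pow_right (by norm_num) hk
  have h42 : 4 ^ k = 2 ^ k * 2 ^ k := by rw [← mul_pow]; norm_num
  have h2k : 2 ^ 2 ≤ 2 ^ k := Nat.pow_le_pow_right (by norm_num) hk
  by_cases h2 : 2 ∣ Q
  · have hmem : 2 ∈ Q.primeFactors := Nat.mem_primeFactors.2 ⟨Nat.prime_two, h2, hQ⟩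
    have hcard : #Q.primeFactors = #T + 1 := (card_erase_add_one hmem).symm
    have hcop : Nat.Coprime 4 (∏ l ∈ T, l) := by
      refine Nat.Coprime.prod_right fun l hl => ?_
      have hl' := Nat.prime_of_mem_primeFactors (mem_of_mem_erase hl)
      exact Nat.Coprime.pow_left 2 ((Nat.coprime_primes Nat.prime_two hl').2
        (ne_of_mem_erase hl).symm)
    have hTQ : ∏ l ∈ T, l ∣ Q := prod_dvd_of_subset_primeFactors (erase_subset _ _)
    rw [hcard]
    split_ifs with h4
    · have : 4 * ∏ l ∈ T, l ≤ Q := Nat.le_of_dvd (Nat.pos_of_ne_zero hQ)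
        (hcop.mul_dvd_of_dvd_of_dvd h4 hTQ)
      calc _ = 4 ^ k * (4 * (b ^ #T * ∏ l ∈ P, l)) := by
            rw [hbT, show 2 ^ (#T + 1) * 2 = 4 * 2 ^ #T by ring, mul_pow]; ring
        _ ≤ 4 ^ k * (4 * (b ^ #P * ∏ l ∈ T, l)) := by gcongr
        _ = 4 ^ k * (b ^ #P * (4 * ∏ l ∈ T, l)) := by ring
        _ ≤ _ := by gcongr
    · have : 2 * ∏ l ∈ T, l ≤ Q := Nat.le_of_dvd (Nat.pos_of_ne_zero hQ)
        ((Nat.Coprime.coprime_dvd_left (by norm_num) hcop).mul_dvd_of_dvd_of_dvd h2 hTQ)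
      calc _ = 2 ^ k * (4 * (b ^ #T * ∏ l ∈ P, l)) := by
            rw [hbT, show 2 ^ (#T + 1) * 1 = 2 * 2 ^ #T by ring, mul_pow]; ring
        _ ≤ 2 ^ k * (4 * (b ^ #P * ∏ l ∈ T, l)) := by gcongr
        _ = 2 ^ k * 2 * (b ^ #P * (2 * ∏ l ∈ T, l)) := by ring
        _ ≤ 2 ^ k * 2 ^ k * (b ^ #P * Q) := by gcongr; omega
        _ = _ := by rw [h42]
  · have hmem : 2 ∉ Q.primeFactors := fun h => h2 (Nat.dvd_of_mem_primeFactors h)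
    have hTe : T = Q.primeFactors := erase_eq_of_notMem hmem
    have h4 : ¬ 4 ∣ Q := fun h => h2 (dvd_trans (by norm_num) h)
    have hTQ : ∏ l ∈ T, l ≤ Q := Nat.le_of_dvd (Nat.pos_of_ne_zero hQ)
      (prod_dvd_of_subset_primeFactors (erase_subset _ _))
    rw [if_neg h4, mul_one, ← hTe, ← hbT]
    calc _ = 4 * (b ^ #T * ∏ l ∈ P, l) := by ring
      _ ≤ 4 * (b ^ #P * ∏ l ∈ T, l) := by gcongr
      _ ≤ 4 ^ k * (b ^ #P * Q) := by gcongr; omega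

/-- Bounds for a sieving set of primes, all of which lie in `P` or are at least `b`. -/
lemma card_and_sum_inv_le {T P : Finset ℕ} {b t : ℕ} (hb : 0 < b)
    (hT : ∀ l ∈ T, l ∉ P → b ≤ l) (ht : #(T \ P) ≤ t) :
    #T ≤ #P + t ∧ ∑ l ∈ T, (l : ℝ)⁻¹ ≤ ∑ l ∈ P, (l : ℝ)⁻¹ + t * (b : ℝ)⁻¹ := by
  have hb' : (0 : ℝ) < b := by exact_mod_cast hb
  constructor
  · rw [← card_inter_add_card_sdiff T P]
    have := card_le_card (inter_subset_right (s₁ := T) (s₂ := P))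
    omega
  · rw [← sum_inter_add_sum_sdiff T P]
    refine add_le_add (sum_le_sum_of_subset_of_nonneg inter_subset_right
      fun l _ _ => by positivity) ?_
    calc ∑ l ∈ T \ P, (l : ℝ)⁻¹ ≤ #(T \ P) • (b : ℝ)⁻¹ := sum_le_card_nsmul _ _ _ fun l hl => by
          have h : (b : ℝ) ≤ l := by
            exact_mod_cast hT l (mem_sdiff.1 hl).1 (mem_sdiff.1 hl).2
          gcongr
      _ ≤ _ := by
          rw [nsmul_eq_mul]
          have : (#(T \ P) : ℝ) ≤ t := by exact_mod_cast ht
          gcongr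

lemma card_le_of_pow_le {b t c Q : ℕ} (hb : 1 < b) (hQ : Q < b ^ (t + 1)) (h : b ^ c ≤ Q) :
    c ≤ t := by
  have := (Nat.pow_lt_pow_iff_right hb).1 (h.trans_lt hQ)
  omega

end PrimeSets

/-- Some element of `L` is `2`-primitive and `1`-normal over `K`. -/
def HasTwoPrimitiveOneNormal (K L : Type*) [Field K] [Field L] [Algebra K L] [Fintype K]
    [Fintype L] : Prop :=
  ∃ α : L, orderOf α = (Fintype.card L - 1) / 2 ∧
    Module.finrank K (conjSpan K (Fintype.card K) (Module.finrank K L) α) =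
      Module.finrank K L - 1

/-- The contribution of `C = Q.primeFactors` to the sieve. -/
def sieveWeight (Q : ℕ) : ℕ := 2 ^ #Q.primeFactors * if 4 ∣ Q then 2 else 1

lemma sieveWeight_pow_four_le {q n : ℕ} (hq : 5 ≤ q) (hn : n ≠ 0) :
    sieveWeight (geomNat q n) ^ 4 ≤ 5588 * q ^ (n - 1) := by
  have h1 := two_pow_card_primeFactors_le (geomNat_pos (q := q) hn).ne' (k := 4) (b := 16)
    (by norm_num) (by norm_num) (P := {3, 5, 7, 11, 13}) (by simp) (by
      intro l hl; interval_cases l <;> norm_num)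
  have h2 := four_mul_geomNat_lt hq hn
  rw [← sieveWeight] at h1
  norm_num at h1
  omega

lemma sieveWeight_pow_five_le {q n : ℕ} (hn : n ≠ 0) :
    sieveWeight (geomNat q n) ^ 5 ≤ 2874297 * geomNat q n := by
  have h1 := two_pow_card_primeFactors_le (geomNat_pos (q := q) hn).ne' (k := 5) (b := 32)
    (by norm_num) (by norm_num) (P := {3, 5, 7, 11, 13, 17, 19, 23, 29, 31}) (by simp) (by
      intro l hl; interval_cases l <;> norm_num)
  rw [← sieveWeight] at h1
  norm_num at h1
  omega

section Regions

variable {K L : Type*} [Field K] [Field L] [Algebra K L] [Fintype K]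

lemma geomNat_card_mul :
    geomNat (Fintype.card K) (Module.finrank K L) * (Fintype.card K - 1) =
      Fintype.card K ^ Module.finrank K L - 1 :=
  geomNat_mul Fintype.card_pos _

variable [Fintype L]

/-- Sieving over the factors of `(X ^ n - 1) / (X - 1)` and no primes. -/
lemma hasTwoPrimitiveOneNormal_of_factors (hodd : Odd (Fintype.card K))
    (hn : 2 ≤ Module.finrank K L) {G D Z : ℕ}
    (hG : Module.finrank K L - 1 ≤ G ∨ rootBound (Fintype.card K) (Module.finrank K L) ≤ G)
    (hD : 0 < D) (hZ : 0 < Z)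
    (hδ : (D : ℝ) / Z ≤ 1 - (G / Fintype.card K +
      ((Module.finrank K L : ℝ) - 1 - G) / (2 * (Fintype.card K : ℝ) ^ 2)))
    (hmain : sieveWeight (geomNat (Fintype.card K) (Module.finrank K L)) ^ 2 *
      ((Module.finrank K L - 2 : ℕ) * Z + 2 * D) ^ 2 <
      D ^ 2 * Fintype.card K ^ (Module.finrank K L - 2)) :
    HasTwoPrimitiveOneNormal K L := by
  classical
  set n := Module.finrank K L with hndef
  have hn0 : n ≠ 0 := by omega
  have h1 := card_geomFactors_degree_le (K := K) hn0
  have h2 := card_filter_add_card_filter_not (s := geomFactors K n) (fun g => g.natDegree = 1)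
  have hlin : #{g ∈ geomFactors K n | g.natDegree = 1} ≤ G := by
    rcases hG with h | h
    · omega
    · exact (card_filter_natDegree_eq_one_le hn0).trans h
  have hsum := sum_inv_geomFactors_le hn0 hlin
  refine exists_of_sieve_factors hodd hn geomNat_card_mul (disjoint_empty_right _)
    (union_empty _) (notMem_empty 2) (s := n - 2) ?_ le_rfl hD hZ ?_ hmain
  · rw [card_empty, ← hndef]; omega
  · rw [sum_empty, sub_zero]
    linarith

lemma hasTwoPrimitiveOneNormal_of_two_mul_finrank_le (hodd : Odd (Fintype.card K))
    (hn : 3 ≤ Module.finrank K L) (hq : 5 ≤ Fintype.card K)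
    (hnq : 2 * Module.finrank K L ≤ Fintype.card K)
    (hbig : 16 * (Module.finrank K L - 1) ^ 4 * 5588 < Fintype.card K ^ (Module.finrank K L - 3)) :
    HasTwoPrimitiveOneNormal K L := by
  set n := Module.finrank K L with hndef
  set q := Fintype.card K with hqdef
  have hW := sieveWeight_pow_four_le hq (by omega : n ≠ 0)
  have hq0 : (0 : ℝ) < q := by exact_mod_cast (by omega : 0 < q)
  refine hasTwoPrimitiveOneNormal_of_factors hodd (by omega) (G := n - 1) (D := 1) (Z := 2)
    (Or.inl le_rfl) one_pos two_pos ?_ ?_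
  · rw [← hqdef, ← hndef, Nat.cast_sub (by omega)]
    have : (2 : ℝ) * n ≤ q := by exact_mod_cast hnq
    have h : ((n : ℝ) - 1) / q ≤ 1 / 2 := by
      rw [div_le_div_iff₀ hq0 two_pos]; linarith
    push_cast
    rw [sub_self, zero_div]
    linarith
  · rw [← hqdef, ← hndef]
    set W := sieveWeight (geomNat q n)
    refine lt_of_pow_lt_pow_left₀ 2 (by positivity) ?_
    have e : (n - 2) * 2 + 2 * 1 = 2 * (n - 1) := by omega
    rw [e, one_pow, one_mul]
    have hpow : (q ^ (n - 2)) ^ 2 = q ^ (n - 1) * q ^ (n - 3) := by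
      rw [← pow_mul, ← pow_add]; congr 1; omega
    rw [hpow]
    calc (W ^ 2 * (2 * (n - 1)) ^ 2) ^ 2 = W ^ 4 * (16 * (n - 1) ^ 4) := by ring
      _ ≤ 5588 * q ^ (n - 1) * (16 * (n - 1) ^ 4) := by gcongr
      _ = q ^ (n - 1) * (16 * (n - 1) ^ 4 * 5588) := by ring
      _ < _ := by gcongr

lemma rootBound_le {q n : ℕ} (hq : 2 ≤ q) : rootBound q n ≤ q - 1 := by
  have : n.gcd (q - 1) ≤ q - 1 := Nat.gcd_le_right _ (by omega)
  unfold rootBound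
  split_ifs <;> omega

lemma hasTwoPrimitiveOneNormal_of_finrank_lt_two_mul (hodd : Odd (Fintype.card K))
    (hn : 20 ≤ Module.finrank K L) (hq : 11 ≤ Fintype.card K)
    (hnq : Module.finrank K L < 2 * Fintype.card K) :
    HasTwoPrimitiveOneNormal K L := by
  set n := Module.finrank K L with hndef
  set q := Fintype.card K with hqdef
  have hW := sieveWeight_pow_four_le (by omega : 5 ≤ q) (by omega : n ≠ 0)
  have hq0 : (0 : ℝ) < q := by exact_mod_cast (by omega : 0 < q)
  refine hasTwoPrimitiveOneNormal_of_factors hodd (by omega) (G := q - 1) (D := 1) (Z := 2 * q)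
    (Or.inr (rootBound_le (by omega))) one_pos (by omega) ?_ ?_
  · rw [← hqdef, ← hndef, Nat.cast_sub (by omega)]
    have : (n : ℝ) ≤ 2 * q := by exact_mod_cast hnq.le
    push_cast
    rw [div_add_div _ _ hq0.ne' (by positivity), one_sub_div (by positivity),
      div_le_div_iff₀ (by positivity) (by positivity)]
    nlinarith [mul_nonneg (sub_nonneg.2 this) (by positivity : (0 : ℝ) ≤ q ^ 2)]
  · rw [← hqdef, ← hndef]
    set W := sieveWeight (geomNat q n)
    refine lt_of_pow_lt_pow_left₀ 2 (by positivity) ?_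
    have e : (n - 2) * (2 * q) + 2 * 1 ≤ 4 * q ^ 2 := by
      have : (n - 2) * (2 * q) ≤ (2 * q - 2) * (2 * q) := Nat.mul_le_mul_right _ (by omega)
      have h2 : (2 * q - 2) * (2 * q) + 4 * q = 4 * q ^ 2 := by
        obtain ⟨r, hr⟩ : ∃ r, q = r + 1 := ⟨q - 1, by omega⟩
        rw [hr, show 2 * (r + 1) - 2 = 2 * r by omega]; ring
      omega
    rw [one_pow, one_mul]
    have hpow : (q ^ (n - 2)) ^ 2 = q ^ (n - 1) * q ^ 8 * q ^ (n - 11) := by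
      rw [← pow_mul, ← pow_add, ← pow_add]; congr 1; omega
    have hlast : 256 * 5588 < q ^ (n - 11) := calc
      256 * 5588 < 11 ^ 9 := by norm_num
      _ ≤ q ^ 9 := by gcongr
      _ ≤ _ := Nat.pow_le_pow_right (by omega) (by omega)
    rw [hpow]
    calc (W ^ 2 * ((n - 2) * (2 * q) + 2 * 1) ^ 2) ^ 2 ≤ (W ^ 2 * (4 * q ^ 2) ^ 2) ^ 2 := by gcongr
      _ = W ^ 4 * (256 * q ^ 8) := by ring
      _ ≤ 5588 * q ^ (n - 1) * (256 * q ^ 8) := by gcongr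
      _ = q ^ (n - 1) * q ^ 8 * (256 * 5588) := by ring
      _ < _ := by gcongr

lemma hasTwoPrimitiveOneNormal_of_four_pow_lt (hodd : Odd (Fintype.card K))
    (hn : 3 ≤ Module.finrank K L) (hq : 5 ≤ Fintype.card K)
    (hbig : 5588 * 4 ^ (Module.finrank K L + Fintype.card K) <
      Fintype.card K ^ (Module.finrank K L - 3)) :
    HasTwoPrimitiveOneNormal K L := by
  set n := Module.finrank K L with hndef
  set q := Fintype.card K with hqdef
  have hW := sieveWeight_pow_four_le hq (by omega : n ≠ 0)
  refine exists_of_sieve_primes hodd (by omega) geomNat_card_mul (disjoint_empty_right _)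
    (union_empty _) (notMem_empty 2) (s := 0) (D := 1) (Z := 1) le_rfl (by simp) le_rfl
    one_pos one_pos (by simp) ?_
  rw [← hqdef, ← hndef]
  change 4 ^ _ * sieveWeight (geomNat q n) ^ 2 * _ < _
  set W := sieveWeight (geomNat q n)
  set a := (n - 1 + rootBound q n) / 2
  have ha : 2 * a ≤ n + q - 2 := by
    have := rootBound_le (n := n) (by omega : 2 ≤ q)
    omega
  refine lt_of_pow_lt_pow_left₀ 2 (by positivity) ?_
  have hpow : (q ^ (n - 2)) ^ 2 = q ^ (n - 1) * q ^ (n - 3) := by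
    rw [← pow_mul, ← pow_add]; congr 1; omega
  rw [one_pow, one_mul, hpow]
  calc (4 ^ a * W ^ 2 * (0 * 1 + 2 * 1) ^ 2) ^ 2 = W ^ 4 * 4 ^ (2 * a + 2) := by ring
    _ ≤ 5588 * q ^ (n - 1) * 4 ^ (n + q) := by
        have : 4 ^ (2 * a + 2) ≤ 4 ^ (n + q) := Nat.pow_le_pow_right (by norm_num) (by omega)
        gcongr
    _ = q ^ (n - 1) * (5588 * 4 ^ (n + q)) := by ring
    _ < _ := by gcongr

end Regions

/-- The primes below `53`. -/
def smallPrimes : List ℕ := [2, 3, 5, 7, 11, 13, 17, 19, 23, 29, 31, 37, 41, 43, 47]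

lemma prime_of_mem_smallPrimes : ∀ l ∈ smallPrimes, l.Prime := by
  intro l hl
  simp only [smallPrimes, List.mem_cons, List.not_mem_nil, or_false] at hl
  rcases hl with h | h | h | h | h | h | h | h | h | h | h | h | h | h | h <;> subst h <;> norm_num

lemma mem_smallPrimes {l : ℕ} (hl : l.Prime) (h : l < 53) : l ∈ smallPrimes := by
  interval_cases l <;> first | decide | (exfalso; revert hl; norm_num)

/-- An upper bound for the logarithm of `R` in base `53`. -/
def logBound : ℕ → ℕ → ℕ
  | 0, R => R
  | k + 1, R => if R < 53 then 0 else logBound k (R / 53) + 1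

lemma le_logBound {k R c : ℕ} (h : 53 ^ c ≤ R) : c ≤ logBound k R := by
  induction k generalizing R c with
  | zero => exact (Nat.lt_pow_self (by norm_num)).le.trans h
  | succ k ih =>
    rw [logBound]
    rcases c with _ | c
    · exact Nat.zero_le _
    · have h1 : 53 ^ c ≤ R / 53 := by rw [Nat.le_div_iff_mul_le (by norm_num), ← pow_succ]; exact h
      have h2 : ¬ R < 53 := by
        have : 0 < 53 ^ c := by positivity
        rw [pow_succ] at h; omega
      rw [if_neg h2]
      have := ih h1
      omega

/-- A rounded up version of `10 ^ 6 * ∑ l⁻¹`. -/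
def scaledInvSum (T : List ℕ) : ℕ := (T.map fun l => 1000000 / l + 1).sum

lemma inv_le_scaled {l : ℕ} (hl : 0 < l) : (l : ℝ)⁻¹ ≤ ((1000000 / l + 1 : ℕ) : ℝ) / 1000000 := by
  have h : 1000000 < l * (1000000 / l + 1) := Nat.lt_mul_div_succ _ hl
  have h' : (1000000 : ℝ) ≤ l * ((1000000 / l + 1 : ℕ) : ℝ) := by exact_mod_cast h.le
  have hl' : (0 : ℝ) < l := by exact_mod_cast hl
  rw [inv_eq_one_div, div_le_div_iff₀ hl' (by norm_num)]
  linarith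

lemma sum_inv_le_scaledInvSum {T : List ℕ} (hnd : T.Nodup) (hT : ∀ l ∈ T, 0 < l) :
    ∑ l ∈ T.toFinset, (l : ℝ)⁻¹ ≤ (scaledInvSum T : ℝ) / 1000000 := by
  rw [List.sum_toFinset _ hnd, scaledInvSum]
  clear hnd
  induction T with
  | nil => simp
  | cons a T ih =>
    simp only [List.map_cons, List.sum_cons, Nat.cast_add, add_div] at *
    have h1 := inv_le_scaled (hT a (by simp))
    have h2 := ih fun l hl => hT l (by simp [hl])
    push_cast [add_div] at h1
    linarith

/-- The prime divisors of `Q` below `53`. -/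
def smallFactors (Q : ℕ) : List ℕ := smallPrimes.filter fun l => Q % l == 0

/-- An upper bound for the number of prime divisors of `Q` above `53`. -/
def numLargeFactors (Q : ℕ) : ℕ := logBound 64 (Q / (smallFactors Q).prod)

lemma mem_smallFactors {Q l : ℕ} : l ∈ smallFactors Q ↔ l ∈ smallPrimes ∧ l ∣ Q := by
  simp [smallFactors, Nat.dvd_iff_mod_eq_zero]

lemma smallFactors_nodup (Q : ℕ) : (smallFactors Q).Nodup :=
  List.Nodup.filter _ (by decide)

lemma split_smallFactors {Q z : ℕ} (hQ : Q ≠ 0) (hz : z < 53) :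
    #{l ∈ Q.primeFactors | l ≤ z} ≤ ((smallFactors Q).filter (· ≤ z)).length ∧
    #{l ∈ Q.primeFactors | ¬ l ≤ z} ≤
      ((smallFactors Q).filter (z < ·)).length + numLargeFactors Q ∧
    ∑ l ∈ Q.primeFactors with ¬ l ≤ z, (l : ℝ)⁻¹ ≤
      ((scaledInvSum ((smallFactors Q).filter (z < ·)) +
        numLargeFactors Q * (1000000 / 53 + 1) : ℕ) : ℝ) / 1000000 := by
  set P := ((smallFactors Q).filter (z < ·)).toFinset with hP
  set T : Finset ℕ := {l ∈ Q.primeFactors | ¬ l ≤ z} with hT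
  have hmem : ∀ l ∈ Q.primeFactors, l < 53 → l ∈ smallFactors Q := fun l hl h =>
    mem_smallFactors.2 ⟨mem_smallPrimes (Nat.prime_of_mem_primeFactors hl) h,
      Nat.dvd_of_mem_primeFactors hl⟩
  have hnd := (smallFactors_nodup Q).filter (z < ·)
  have hlarge : ∀ l ∈ T, l ∉ P → 53 ≤ l := by
    intro l hl hlP
    by_contra! h
    obtain ⟨h1, h2⟩ := mem_filter.1 hl
    exact hlP (List.mem_toFinset.2 (List.mem_filter.2 ⟨hmem l h1 h, by simpa using h2⟩))
  have hcard : #(T \ P) ≤ numLargeFactors Q := by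
    refine le_logBound ?_
    have hprod : (smallFactors Q).prod = ∏ l ∈ (smallFactors Q).toFinset, l := by
      rw [List.prod_toFinset _ (smallFactors_nodup Q), List.map_id']
    have hpos : 0 < (smallFactors Q).prod := by
      rw [hprod]
      exact prod_pos fun l hl => (prime_of_mem_smallPrimes l
        (mem_smallFactors.1 (List.mem_toFinset.1 hl)).1).pos
    rw [Nat.le_div_iff_mul_le hpos, hprod]
    have hdisj : Disjoint (T \ P) (smallFactors Q).toFinset := by
      rw [disjoint_left]
      intro l hl hl'
      obtain ⟨h1, h2⟩ := mem_sdiff.1 hl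
      have h3 := (mem_filter.1 h1).2
      exact h2 (List.mem_toFinset.2 (List.mem_filter.2
        ⟨List.mem_toFinset.1 hl', by simpa using h3⟩))
    have hsub : (T \ P) ∪ (smallFactors Q).toFinset ⊆ Q.primeFactors := by
      refine union_subset (fun l hl => (mem_filter.1 (mem_sdiff.1 hl).1).1) fun l hl => ?_
      obtain ⟨h1, h2⟩ := mem_smallFactors.1 (List.mem_toFinset.1 hl)
      exact Nat.mem_primeFactors.2 ⟨prime_of_mem_smallPrimes l h1, h2, hQ⟩
    have h1 := Nat.le_of_dvd (Nat.pos_of_ne_zero hQ) (prod_dvd_of_subset_primeFactors hsub)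
    rw [prod_union hdisj] at h1
    refine le_trans ?_ h1
    gcongr
    exact pow_card_le_prod _ _ _ fun l hl => hlarge l (mem_sdiff.1 hl).1 (mem_sdiff.1 hl).2
  obtain ⟨h1, h2⟩ := card_and_sum_inv_le (by norm_num) hlarge hcard
  have hPcard : #P ≤ ((smallFactors Q).filter (z < ·)).length := List.toFinset_card_le _
  refine ⟨?_, by omega, h2.trans ?_⟩
  · refine le_trans (card_le_card ?_)
      (List.toFinset_card_le ((smallFactors Q).filter (· ≤ z)))
    intro l hl
    obtain ⟨h1, h2⟩ := mem_filter.1 hl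
    exact List.mem_toFinset.2 (List.mem_filter.2 ⟨hmem l h1 (by omega), by simpa using h2⟩)
  · have h3 := sum_inv_le_scaledInvSum hnd fun l hl =>
      (prime_of_mem_smallPrimes l (mem_smallFactors.1 (List.mem_filter.1 hl).1).1).pos
    push_cast [add_div]
    refine add_le_add h3 ?_
    rw [mul_div_assoc]
    refine mul_le_mul_of_nonneg_left ?_ (by positivity)
    norm_num

/-- The sieve inequality for the primes of `Q` above `z`, with `m` further sieving conditions of
total density `σ / 10 ^ 6` and `a` conditions in the core. -/
def sieveTest (q n Q a m σ z : ℕ) : Bool :=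
  let T := (smallFactors Q).filter (z < ·)
  let W := 2 ^ ((smallFactors Q).filter (· ≤ z)).length * if Q % 4 == 0 then 2 else 1
  let S := scaledInvSum T + numLargeFactors Q * (1000000 / 53 + 1) + σ
  let D := 1000000 - S
  let s := T.length + numLargeFactors Q + m - 1
  Nat.blt S 1000000 &&
    Nat.blt (4 ^ a * W ^ 2 * (s * 1000000 + 2 * D) ^ 2) (D ^ 2 * q ^ (n - 2))

lemma sieveTest_spec {q n Q a m σ z : ℕ} (hQ : Q ≠ 0) (hz : z < 53)
    (h : sieveTest q n Q a m σ z = true) :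
    ∃ s W D : ℕ, #{l ∈ Q.primeFactors | ¬ l ≤ z} + m ≤ s + 1 ∧
      (2 ^ #{l ∈ Q.primeFactors | l ≤ z} * if 4 ∣ Q then 2 else 1) ≤ W ∧ 0 < D ∧
      (D : ℝ) / (1000000 : ℕ) ≤
        1 - ∑ l ∈ Q.primeFactors with ¬ l ≤ z, (l : ℝ)⁻¹ - (σ : ℝ) / 1000000 ∧
      4 ^ a * W ^ 2 * (s * 1000000 + 2 * D) ^ 2 < D ^ 2 * q ^ (n - 2) := by
  obtain ⟨h1, h2, h3⟩ := split_smallFactors hQ hz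
  simp only [sieveTest, Bool.and_eq_true, Nat.blt_eq] at h
  obtain ⟨hS, hmain⟩ := h
  refine ⟨_, _, _, ?_, ?_, ?_, ?_, hmain⟩
  · omega
  · have : (if Q % 4 == 0 then 2 else 1) = if 4 ∣ Q then 2 else 1 := by
      simp [Nat.dvd_iff_mod_eq_zero]
    rw [this]
    gcongr
    norm_num
  · omega
  · rw [Nat.cast_sub hS.le]
    push_cast [add_div, sub_div] at h3 ⊢
    linarith

/-- A sufficient numerical criterion. -/
def criterion (q n : ℕ) : Bool :=
  let Q := geomNat q n
  let G := rootBound q n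
  let m := (n - 1 + G) / 2
  if n == 3 then
    [2, 3, 5, 7].any fun z => sieveTest q n Q 0 0 0 z
  else
    ([2, 3, 5, 7].any fun z =>
      Nat.ble G (n - 1) &&
        sieveTest q n Q 0 m (1000000 * (2 * q * G + (n - 1 - G)) / (2 * q ^ 2) + 1) z) ||
    ([2, 3, 5, 7].any fun z => sieveTest q n Q m 0 0 z)

section Soundness

variable {K L : Type*} [Field K] [Field L] [Algebra K L] [Fintype K] [Fintype L]

lemma two_notMem_filter {Q z : ℕ} (hz : 2 ≤ z) : 2 ∉ ({l ∈ Q.primeFactors | ¬ l ≤ z} : Finset ℕ) :=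
  fun h => (mem_filter.1 h).2 hz

lemma hasTwoPrimitiveOneNormal_of_criterion (hodd : Odd (Fintype.card K))
    (hn : 3 ≤ Module.finrank K L)
    (h : criterion (Fintype.card K) (Module.finrank K L) = true) :
    HasTwoPrimitiveOneNormal K L := by
  classical
  have hn0 : Module.finrank K L ≠ 0 := by omega
  have hQ0 := (geomNat_pos (q := Fintype.card K) hn0).ne'
  have hz : ∀ z ∈ [2, 3, 5, 7], 2 ≤ z ∧ z < 53 := by decide
  simp only [criterion, beq_iff_eq] at h
  split_ifs at h with h3
  · obtain ⟨z, hzmem, hz'⟩ := List.any_eq_true.1 h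
    obtain ⟨hz2, hz53⟩ := hz z hzmem
    obtain ⟨s, W, D, h1, h2, h4, h5, h6⟩ := sieveTest_spec hQ0 hz53 hz'
    obtain ⟨α, hα⟩ := exists_of_sieve_three (K := K) (L := L) (Z := 1000000) hodd h3
      (Q := geomNat (Fintype.card K) (Module.finrank K L))
      (by rw [geomNat_card_mul, h3]) (disjoint_filter_filter_not _ _ (· ≤ z))
      (filter_union_filter_not_eq _ _) (two_notMem_filter hz2) h1 h2 h4 (by norm_num)
      (by simpa using h5) (by simpa [h3] using h6)
    exact ⟨α, by rw [h3]; exact hα⟩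
  rw [Bool.or_eq_true] at h
  rcases h with h | h
  · obtain ⟨z, hzmem, hz'⟩ := List.any_eq_true.1 h
    obtain ⟨hz2, hz53⟩ := hz z hzmem
    rw [Bool.and_eq_true, Nat.ble_eq] at hz'
    obtain ⟨hG, hz'⟩ := hz'
    obtain ⟨s, W, D, h1, h2, h4, h5, h6⟩ := sieveTest_spec hQ0 hz53 hz'
    have hc := card_geomFactors_le (K := K) hn0
    have hsum := sum_inv_geomFactors_le hn0 (card_filter_natDegree_eq_one_le (K := K) hn0)
    refine exists_of_sieve_factors (Z := 1000000) (s := s) hodd (by omega) geomNat_card_mul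
      (disjoint_filter_filter_not _ _ (· ≤ z))
      (filter_union_filter_not_eq _ _) (two_notMem_filter hz2) (by omega) h2 h4 (by norm_num) ?_
      (by rwa [pow_zero, one_mul] at h6)
    refine h5.trans (sub_le_sub_left (hsum.trans ?_) _)
    set q := Fintype.card K
    set n := Module.finrank K L
    set G := rootBound q n
    have hq : 0 < 2 * q ^ 2 := by have : 0 < q := Fintype.card_pos; positivity
    have hlt : 1000000 * (2 * q * G + (n - 1 - G)) <
        2 * q ^ 2 * (1000000 * (2 * q * G + (n - 1 - G)) / (2 * q ^ 2) + 1) :=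
      Nat.lt_mul_div_succ _ hq
    set V := 1000000 * (2 * q * G + (n - 1 - G)) / (2 * q ^ 2) + 1
    have hlt' : (1000000 : ℝ) * (2 * q * G + (n - 1 - G)) ≤ 2 * q ^ 2 * V := by
      have : ((n - 1 - G : ℕ) : ℝ) = n - 1 - G := by
        rw [Nat.cast_sub hG, Nat.cast_sub (by omega)]; simp
      rw [← this]
      exact_mod_cast hlt.le
    have hq' : (0 : ℝ) < q := by exact_mod_cast Fintype.card_pos (α := K)
    have : (G : ℝ) / q + ((n : ℝ) - 1 - G) / (2 * (q : ℝ) ^ 2) =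
        (2 * q * G + (n - 1 - G)) / (2 * q ^ 2) := by field_simp
    rw [this, div_le_div_iff₀ (by positivity) (by norm_num)]
    linarith
  · obtain ⟨z, hzmem, hz'⟩ := List.any_eq_true.1 h
    obtain ⟨hz2, hz53⟩ := hz z hzmem
    obtain ⟨s, W, D, h1, h2, h4, h5, h6⟩ := sieveTest_spec hQ0 hz53 hz'
    exact exists_of_sieve_primes (Z := 1000000) hodd (by omega) geomNat_card_mul
      (disjoint_filter_filter_not _ _ (· ≤ z)) (filter_union_filter_not_eq _ _)
      (two_notMem_filter hz2) le_rfl h1 h2 h4 (by norm_num) (by simpa using h5) h6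

end Soundness

/-- Splitting the large primes of `Q` according to a list `P` of primes below `b`. -/
lemma card_and_sum_inv_filter_le {Q z b t : ℕ} {P : Finset ℕ} (hQ : Q ≠ 0) (hb : 1 < b)
    (hP : ∀ l, l.Prime → l ∣ Q → z < l → l < b → l ∈ P) (ht : Q < b ^ (t + 1)) :
    #{l ∈ Q.primeFactors | ¬ l ≤ z} ≤ #P + t ∧
      ∑ l ∈ Q.primeFactors with ¬ l ≤ z, (l : ℝ)⁻¹ ≤ ∑ l ∈ P, (l : ℝ)⁻¹ + t * (b : ℝ)⁻¹ := by
  set T : Finset ℕ := {l ∈ Q.primeFactors | ¬ l ≤ z} with hT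
  have hlarge : ∀ l ∈ T, l ∉ P → b ≤ l := by
    intro l hl hlP
    by_contra! h
    obtain ⟨h1, h2⟩ := mem_filter.1 hl
    exact hlP (hP l (Nat.prime_of_mem_primeFactors h1) (Nat.dvd_of_mem_primeFactors h1)
      (not_le.1 h2) h)
  refine card_and_sum_inv_le (by omega) hlarge (card_le_of_pow_le hb ht ?_)
  have hsub : T \ P ⊆ Q.primeFactors := fun l hl => (mem_filter.1 (mem_sdiff.1 hl).1).1
  refine le_trans (pow_card_le_prod _ _ _ fun l hl => ?_)
    (Nat.le_of_dvd (Nat.pos_of_ne_zero hQ) (prod_dvd_of_subset_primeFactors hsub))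
  exact hlarge l (mem_sdiff.1 hl).1 (mem_sdiff.1 hl).2

lemma prime_dvd_geomNat_three {q l : ℕ} (hl : l.Prime) (h : l ∣ geomNat q 3) :
    l = 3 ∨ l % 3 = 1 := by
  have h' : q ^ 2 + q + 1 ≡ 0 [MOD l] := by
    rw [Nat.modEq_zero_iff_dvd]
    convert h using 1
    simp [geomNat, sum_range_succ]; ring
  have := Fact.mk hl
  have hz : (q : ZMod l) ^ 2 + q + 1 = 0 := by
    have := (ZMod.natCast_eq_natCast_iff _ _ _).2 h'
    push_cast at this; exact this
  by_cases h1 : (q : ZMod l) = 1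
  · left
    rw [h1] at hz
    have : ((3 : ℕ) : ZMod l) = 0 := by push_cast; linear_combination hz
    exact ((Nat.prime_dvd_prime_iff_eq hl Nat.prime_three).1
      ((ZMod.natCast_eq_zero_iff _ _).1 this))
  · right
    have h3 : (q : ZMod l) ^ 3 = 1 := by linear_combination ((q : ZMod l) - 1) * hz
    have hord := orderOf_eq_prime (p := 3) h3 h1
    have h0 : (q : ZMod l) ≠ 0 := by
      intro h0; rw [h0] at h3; simp at h3
    have := orderOf_dvd_of_pow_eq_one (ZMod.pow_card_sub_one_eq_one h0)
    rw [hord] at this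
    have := hl.two_le
    omega

section Coarse

variable {K L : Type*} [Field K] [Field L] [Algebra K L] [Fintype K] [Fintype L]

lemma hasTwoPrimitiveOneNormal_three_of_lt (hodd : Odd (Fintype.card K))
    (h3 : Module.finrank K L = 3) {t D : ℕ} (ht : geomNat (Fintype.card K) 3 < 31 ^ (t + 1))
    (hD : 0 < D)
    (hδ : (D : ℝ) / (1000 : ℕ) ≤ 1 - (7⁻¹ + 13⁻¹ + 19⁻¹ + t * 31⁻¹))
    (hmain : 2 ^ 2 * ((t + 2) * 1000 + 2 * D) ^ 2 < D ^ 2 * Fintype.card K) :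
    HasTwoPrimitiveOneNormal K L := by
  classical
  set q := Fintype.card K with hq
  have hQ0 : geomNat q 3 ≠ 0 := (geomNat_pos (by norm_num)).ne'
  have hQodd : ¬ 2 ∣ geomNat q 3 := geomNat_odd hodd (by decide)
  obtain ⟨h1, h2⟩ := card_and_sum_inv_filter_le (z := 3) (P := {7, 13, 19}) hQ0 (by norm_num)
    (fun l hl hdvd hz hb => by
      have := prime_dvd_geomNat_three hl hdvd
      interval_cases l <;> first | decide | omega | (exfalso; revert hl; norm_num)) ht
  have hc : #{l ∈ (geomNat q 3).primeFactors | l ≤ 3} ≤ 1 := by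
    refine card_le_card (t := {3}) fun l hl => ?_
    obtain ⟨hl, hl3⟩ := mem_filter.1 hl
    have := (Nat.prime_of_mem_primeFactors hl).two_le
    have hdvd := Nat.dvd_of_mem_primeFactors hl
    rw [mem_singleton]
    by_contra h
    obtain rfl : l = 2 := by omega
    exact hQodd hdvd
  obtain ⟨α, hα⟩ := exists_of_sieve_three (K := K) (L := L) (Z := 1000) (s := t + 2) (W := 2)
    hodd h3
    (Q := geomNat q 3) (geomNat_mul Fintype.card_pos _)
    (disjoint_filter_filter_not _ _ (· ≤ 3))
    (filter_union_filter_not_eq _ _) (two_notMem_filter (by norm_num))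
    (h1.trans (by rw [show #({7, 13, 19} : Finset ℕ) = 3 from rfl]; omega))
    (by
      rw [if_neg (fun h => hQodd (dvd_trans (by norm_num) h)), mul_one]
      exact Nat.pow_le_pow_right (by norm_num) hc) hD (by norm_num)
    (hδ.trans (by simp at h2 ⊢; linarith)) hmain
  exact ⟨α, by rw [h3]; exact hα⟩

lemma hasTwoPrimitiveOneNormal_three (hodd : Odd (Fintype.card K))
    (h3 : Module.finrank K L = 3) (hq : 840 ≤ Fintype.card K) :
    HasTwoPrimitiveOneNormal K L := by
  have hgeom : geomNat (Fintype.card K) 3 = Fintype.card K ^ 2 + Fintype.card K + 1 := by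
    simp [geomNat, sum_range_succ]; ring
  by_cases hq1 : Fintype.card K < 29790
  · refine hasTwoPrimitiveOneNormal_three_of_lt hodd h3 (t := 5) (D := 566) ?_ (by norm_num)
      (by norm_num) (by norm_num; omega)
    rw [hgeom]; norm_num; nlinarith
  by_cases hq2 : Fintype.card K < 10 ^ 8
  · refine hasTwoPrimitiveOneNormal_three_of_lt hodd h3 (t := 10) (D := 400) ?_ (by norm_num)
      (by norm_num) (by norm_num; omega)
    rw [hgeom]; norm_num at hq2 ⊢; nlinarith
  by_cases hq3 : Fintype.card K < 10 ^ 17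
  · refine hasTwoPrimitiveOneNormal_three_of_lt hodd h3 (t := 22) (D := 17) ?_ (by norm_num)
      (by norm_num) (by norm_num; omega)
    rw [hgeom]; norm_num at hq3 ⊢; nlinarith
  classical
  set q := Fintype.card K with hqdef
  have hW := sieveWeight_pow_five_le (q := q) (n := 3) (by norm_num)
  set W := sieveWeight (geomNat q 3) with hWdef
  have hgeom' := four_mul_geomNat_lt (q := q) (n := 3) (by omega) (by norm_num)
  obtain ⟨α, hα⟩ := exists_of_sieve_three (K := K) (L := L) (Z := 1) (D := 1) (s := 0) (W := W)
    (C := (geomNat q 3).primeFactors) (T := ∅) hodd h3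
    (Q := geomNat q 3) (geomNat_mul Fintype.card_pos _)
    (disjoint_empty_right _) (union_empty _) (notMem_empty _) (by simp) le_rfl one_pos one_pos
    (by simp) (by
      refine lt_of_pow_lt_pow_left₀ 5 (by positivity) ?_
      have h5 : 4 * W ^ 5 ≤ 2874297 * 5 * q ^ 2 := by norm_num at hgeom'; nlinarith
      calc (W ^ 2 * (0 * 1 + 2 * 1) ^ 2) ^ 5 = 64 * (4 * W ^ 5) ^ 2 := by ring
        _ ≤ 64 * (2874297 * 5 * q ^ 2) ^ 2 := by gcongr
        _ = (64 * (2874297 * 5) ^ 2) * q ^ 4 := by ring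
        _ < q * q ^ 4 := by
          have : 0 < q := by omega
          gcongr; omega
        _ = _ := by ring)
  exact ⟨α, by rw [h3]; exact hα⟩

lemma hasTwoPrimitiveOneNormal_four (hodd : Odd (Fintype.card K))
    (h4 : Module.finrank K L = 4) (hq : 1300 ≤ Fintype.card K) :
    HasTwoPrimitiveOneNormal K L := by
  classical
  set q := Fintype.card K with hqdef
  have hgeom' := four_mul_geomNat_lt (q := q) (n := 4) (by omega) (by norm_num)
  norm_num at hgeom'
  have hq0 : (0 : ℝ) < q := by exact_mod_cast (by omega : 0 < q)
  by_cases hq1 : q < 62000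
  · have hQ0 : geomNat q 4 ≠ 0 := (geomNat_pos (by norm_num)).ne'
    obtain ⟨h1, h2⟩ := card_and_sum_inv_filter_le (z := 5) (t := 9) (b := 29)
      (P := {7, 11, 13, 17, 19, 23}) hQ0 (by norm_num)
      (fun l hl hdvd hz hb => by
        interval_cases l <;> first | decide | (exfalso; revert hl; norm_num)) (by
        have : q ^ 3 ≤ 62000 ^ 3 := by gcongr
        norm_num at this ⊢; omega)
    have hc : #{l ∈ (geomNat q 4).primeFactors | l ≤ 5} ≤ 3 := by
      refine card_le_card (t := {2, 3, 5}) fun l hl => ?_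
      obtain ⟨hl, hl5⟩ := mem_filter.1 hl
      have hp := Nat.prime_of_mem_primeFactors hl
      interval_cases l <;> first | decide | (exfalso; revert hp; norm_num)
    have hcB := card_geomFactors_degree_le (K := K) (n := 4) (by norm_num)
    have hsplit := card_filter_add_card_filter_not (s := geomFactors K 4) (fun g => g.natDegree = 1)
    have hsum := sum_inv_geomFactors_le (K := K) (n := 4) (G := 3) (by norm_num) (by omega)
    refine exists_of_sieve_factors (Z := 10000) (D := 2200) (s := 17) (W := 16) hodd (by omega)
      (Q := geomNat q 4) (by rw [h4]; exact geomNat_mul Fintype.card_pos _)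
      (disjoint_filter_filter_not _ _ (· ≤ 5))
      (filter_union_filter_not_eq _ _) (two_notMem_filter (by norm_num)) ?_ ?_
      (by norm_num) (by norm_num) ?_ ?_
    · rw [h4]
      have : #({7, 11, 13, 17, 19, 23} : Finset ℕ) = 6 := rfl
      omega
    · calc _ ≤ 2 ^ 3 * 2 := by
            gcongr
            · norm_num
            · split_ifs <;> norm_num
        _ = 16 := by norm_num
    · rw [h4]
      have : (3 : ℝ) / q ≤ 3 / 1300 := by
        gcongr; exact_mod_cast hq
      norm_num at h2 hsum ⊢
      linarith
    · rw [h4]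
      norm_num
      nlinarith
  · have hW := sieveWeight_pow_five_le (q := q) (n := 4) (by norm_num)
    refine hasTwoPrimitiveOneNormal_of_factors hodd (by omega) (G := 3) (D := 99) (Z := 100)
      (Or.inl (by omega)) (by norm_num) (by norm_num) ?_ ?_
    · rw [h4]
      have : (3 : ℝ) / q ≤ 3 / 1300 := by
        gcongr; exact_mod_cast hq
      norm_num
      linarith
    · rw [h4, ← hqdef]
      set W := sieveWeight (geomNat q 4) with hWdef
      have h5 : 4 * W ^ 5 ≤ 2874297 * 5 * q ^ 3 := by nlinarith
      have : W * 398 < 99 * q := by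
        refine lt_of_pow_lt_pow_left₀ 5 (by positivity) ?_
        have hqq : 62000 ^ 2 ≤ q ^ 2 := by gcongr; omega
        have h6 : (2874297 * 5 * 398 ^ 5) * q ^ 3 < (4 * 99 ^ 5 * q ^ 2) * q ^ 3 := by
          have : 0 < q := by omega
          refine Nat.mul_lt_mul_of_pos_right ?_ (by positivity)
          norm_num at hqq ⊢; omega
        have : (W * 398) ^ 5 * 4 = 4 * W ^ 5 * 398 ^ 5 := by ring
        have : (99 * q) ^ 5 * 4 = (4 * 99 ^ 5 * q ^ 2) * q ^ 3 := by ring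
        nlinarith
      have h7 := Nat.pow_lt_pow_left this (n := 2) (by norm_num)
      norm_num at h7 ⊢
      nlinarith

end Coarse

/-- A certificate that `q` is not a prime power. -/
def isNotPrimePow (q : ℕ) : Bool := smallPrimes.any fun l => q % l == 0 && l ^ q % q != 0

lemma not_isNotPrimePow {p t : ℕ} (hp : p.Prime) : isNotPrimePow (p ^ t) = false := by
  rw [← Bool.not_eq_true, isNotPrimePow, List.any_eq_true]
  rintro ⟨l, hl, h⟩
  rw [Bool.and_eq_true, beq_iff_eq, bne_iff_ne] at h
  have hlp : l = p := (Nat.prime_dvd_prime_iff_eq (prime_of_mem_smallPrimes l hl) hp).1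
    ((prime_of_mem_smallPrimes l hl).dvd_of_dvd_pow (Nat.dvd_of_mod_eq_zero h.1))
  subst hlp
  exact h.2 (Nat.mod_eq_zero_of_dvd (pow_dvd_pow _ (Nat.lt_pow_self hp.one_lt).le))

/-- The pairs `(q, n)` that the sieve does not settle. -/
def exceptions : List (ℕ × ℕ) :=
  [(7, 3), (25, 3), (5, 4), (7, 4), (11, 4), (13, 4), (17, 4), (19, 4), (23, 4), (25, 4), (29, 4),
    (37, 4), (41, 4), (47, 4), (53, 4), (83, 4), (5, 6), (7, 6), (5, 8)]

/-- The pair `(q, n)` is irrelevant, exceptional or settled by the sieve. -/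
def settled (q n : ℕ) : Bool :=
  q % 2 == 0 || q % 3 == 0 || isNotPrimePow q || exceptions.elem (q, n) || criterion q n

/-- All pairs `(q, n)` with `5 ≤ q < b` are settled. -/
def settledBelow (n b : ℕ) : Bool := (List.range (b - 5)).all fun i => settled (i + 5) n

/-- All pairs `(q, n)` with `a ≤ n < b` are settled. -/
def settledBetween (q a b : ℕ) : Bool := (List.range (b - a)).all fun i => settled q (i + a)

lemma settled_of_settledBelow {q n b : ℕ} (h : settledBelow n b = true) (hq : 5 ≤ q) (hb : q < b) :
    settled q n = true := by
  have := List.all_eq_true.1 h (q - 5) (List.mem_range.2 (by omega))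
  rwa [Nat.sub_add_cancel hq] at this

lemma settled_of_settledBetween {q n a b : ℕ} (h : settledBetween q a b = true) (ha : a ≤ n)
    (hb : n < b) : settled q n = true := by
  have := List.all_eq_true.1 h (n - a) (List.mem_range.2 (by omega))
  rwa [Nat.sub_add_cancel ha] at this

lemma settledBelow_three : settledBelow 3 840 = true := by decide +kernel
lemma settledBelow_four : settledBelow 4 1300 = true := by decide +kernel
lemma settledBelow_five : settledBelow 5 4785 = true := by decide +kernel
lemma settledBelow_six : settledBelow 6 383 = true := by decide +kernel
lemma settledBelow_seven : settledBelow 7 105 = true := by decide +kernel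
lemma settledBelow_eight : settledBelow 8 47 = true := by decide +kernel
lemma settledBelow_nine : settledBelow 9 28 = true := by decide +kernel
lemma settledBelow_two_mul :
    ((List.range 10).all fun i => settledBelow (i + 10) (2 * (i + 10))) = true := by
  decide +kernel
lemma settledBetween_five : settledBetween 5 20 92 = true := by decide +kernel
lemma settledBetween_seven : settledBetween 7 20 44 = true := by decide +kernel
lemma settledBetween_eleven : settledBetween 11 22 31 = true := by decide +kernel
lemma settledBetween_thirteen : settledBetween 13 26 30 = true := by decide +kernel

section Regions

variable {K L : Type*} [Field K] [Field L] [Algebra K L] [Fintype K] [Fintype L]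

lemma four_pow_lt_of_base {q a n : ℕ} (hq : 5 ≤ q) (ha : 3 ≤ a)
    (hbase : 5588 * 4 ^ (a + q) < q ^ (a - 3)) (hn : a ≤ n) :
    5588 * 4 ^ (n + q) < q ^ (n - 3) := by
  obtain ⟨k, rfl⟩ := Nat.exists_eq_add_of_le hn
  have e1 : 4 ^ (a + k + q) = 4 ^ (a + q) * 4 ^ k := by rw [← pow_add]; congr 1; omega
  have e2 : q ^ (a + k - 3) = q ^ (a - 3) * q ^ k := by rw [← pow_add]; congr 1; omega
  rw [e1, e2, ← mul_assoc]
  exact Nat.mul_lt_mul_of_lt_of_le hbase (Nat.pow_le_pow_left (by omega) k) (by positivity)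

lemma four_pow_lt {q n : ℕ} (hq : 17 ≤ q) (hn : 2 * q ≤ n) :
    5588 * 4 ^ (n + q) < q ^ (n - 3) := by
  refine four_pow_lt_of_base (a := 2 * q) (by omega) (by omega) ?_ hn
  obtain ⟨i, rfl⟩ := Nat.exists_eq_add_of_le hq
  calc 5588 * 4 ^ (2 * (17 + i) + (17 + i)) = 5588 * 4 ^ 51 * 64 ^ i := by
        rw [show 2 * (17 + i) + (17 + i) = 51 + 3 * i by ring, pow_add, pow_mul]; norm_num
        ring
    _ < 17 ^ 31 * 289 ^ i :=
        Nat.mul_lt_mul_of_lt_of_le (by norm_num) (Nat.pow_le_pow_left (by norm_num) i)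
          (by positivity)
    _ = 17 ^ (2 * (17 + i) - 3) := by
        rw [show 2 * (17 + i) - 3 = 31 + 2 * i by omega, pow_add, pow_mul]; norm_num
    _ ≤ _ := Nat.pow_le_pow_left (by omega) _

lemma hasTwoPrimitiveOneNormal_or_settled (hodd : Odd (Fintype.card K))
    (hq : 5 ≤ Fintype.card K) (h9 : Fintype.card K ≠ 9) (hn : 3 ≤ Module.finrank K L) :
    HasTwoPrimitiveOneNormal K L ∨ settled (Fintype.card K) (Module.finrank K L) = true := by
  set q := Fintype.card K with hqdef
  set n := Module.finrank K L with hndef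
  have hR1 : 2 * n ≤ q → 16 * (n - 1) ^ 4 * 5588 < q ^ (n - 3) → HasTwoPrimitiveOneNormal K L :=
    fun h1 h2 => hasTwoPrimitiveOneNormal_of_two_mul_finrank_le hodd hn hq h1 h2
  have hR3 : 5588 * 4 ^ (n + q) < q ^ (n - 3) → HasTwoPrimitiveOneNormal K L :=
    fun h => hasTwoPrimitiveOneNormal_of_four_pow_lt hodd hn hq h
  have hsmall : ∀ m b, n = m → settledBelow m b = true → 2 * m ≤ b →
      16 * (m - 1) ^ 4 * 5588 < b ^ (m - 3) →
      HasTwoPrimitiveOneNormal K L ∨ settled q n = true := by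
    intro m b hm hb h1 h2
    rcases lt_or_ge q b with h | h
    · exact Or.inr (hm ▸ settled_of_settledBelow hb hq h)
    · exact Or.inl (hR1 (by omega) (by rw [hm]; exact h2.trans_le (Nat.pow_le_pow_left h _)))
  rcases lt_or_ge n 10 with h10 | h10
  · have hcases : n = 3 ∨ n = 4 ∨ n = 5 ∨ n = 6 ∨ n = 7 ∨ n = 8 ∨ n = 9 := by omega
    rcases hcases with h | h | h | h | h | h | h
    · rcases lt_or_ge q 840 with h' | h'
      · exact Or.inr (h ▸ settled_of_settledBelow settledBelow_three hq h')
      · exact Or.inl (hasTwoPrimitiveOneNormal_three hodd h h')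
    · rcases lt_or_ge q 1300 with h' | h'
      · exact Or.inr (h ▸ settled_of_settledBelow settledBelow_four hq h')
      · exact Or.inl (hasTwoPrimitiveOneNormal_four hodd h h')
    · exact hsmall _ _ h settledBelow_five (by norm_num) (by norm_num)
    · exact hsmall _ _ h settledBelow_six (by norm_num) (by norm_num)
    · exact hsmall _ _ h settledBelow_seven (by norm_num) (by norm_num)
    · exact hsmall _ _ h settledBelow_eight (by norm_num) (by norm_num)
    · exact hsmall _ _ h settledBelow_nine (by norm_num) (by norm_num)
  rcases le_or_gt (2 * n) q with hnq | hnq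
  · refine Or.inl (hR1 hnq ?_)
    have h1 : 16 * (n - 1) ^ 4 ≤ q ^ 4 := calc
      16 * (n - 1) ^ 4 = (2 * (n - 1)) ^ 4 := by ring
      _ ≤ q ^ 4 := Nat.pow_le_pow_left (by omega) _
    have h2 : 5588 < q ^ (n - 7) := calc
      5588 < 20 ^ 3 := by norm_num
      _ ≤ q ^ 3 := Nat.pow_le_pow_left (by omega) _
      _ ≤ _ := Nat.pow_le_pow_right (by omega) (by omega)
    have h3 : q ^ (n - 3) = q ^ 4 * q ^ (n - 7) := by rw [← pow_add]; congr 1; omega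
    rw [h3]
    exact Nat.mul_lt_mul_of_le_of_lt h1 h2 (by positivity)
  rcases lt_or_ge n 20 with h20 | h20
  · have h := List.all_eq_true.1 settledBelow_two_mul (n - 10) (List.mem_range.2 (by omega))
    rw [Nat.sub_add_cancel h10] at h
    exact Or.inr (settled_of_settledBelow h hq hnq)
  rcases le_or_gt 17 q with h17 | h17
  · rcases lt_or_ge n (2 * q) with h | h
    · exact Or.inl (hasTwoPrimitiveOneNormal_of_finrank_lt_two_mul hodd h20 (by omega) h)
    · exact Or.inl (hR3 (four_pow_lt h17 h))
  have hlarge : ∀ r a, q = r → 5 ≤ r → 3 ≤ a → 5588 * 4 ^ (a + r) < r ^ (a - 3) → a ≤ n →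
      HasTwoPrimitiveOneNormal K L ∨ settled q n = true := by
    rintro r a hr h5 ha hbase han
    exact Or.inl (hR3 (hr ▸ four_pow_lt_of_base h5 ha hbase han))
  have hcases : q = 5 ∨ q = 7 ∨ q = 11 ∨ q = 13 ∨ q = 15 := by
    obtain ⟨k, hk⟩ := hodd
    omega
  rcases hcases with h | h | h | h | h
  · rcases lt_or_ge n 92 with h' | h'
    · exact Or.inr (h ▸ settled_of_settledBetween settledBetween_five h20 h')
    · exact hlarge _ _ h (by norm_num) (by norm_num) (by norm_num) h'
  · rcases lt_or_ge n 44 with h' | h'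
    · exact Or.inr (h ▸ settled_of_settledBetween settledBetween_seven h20 h')
    · exact hlarge _ _ h (by norm_num) (by norm_num) (by norm_num) h'
  · rcases lt_or_ge n 22 with h'' | h''
    · exact Or.inl (hasTwoPrimitiveOneNormal_of_finrank_lt_two_mul hodd h20 (by omega) (by omega))
    rcases lt_or_ge n 31 with h' | h'
    · exact Or.inr (h ▸ settled_of_settledBetween settledBetween_eleven h'' h')
    · exact hlarge _ _ h (by norm_num) (by norm_num) (by norm_num) h'
  · rcases lt_or_ge n 26 with h'' | h''
    · exact Or.inl (hasTwoPrimitiveOneNormal_of_finrank_lt_two_mul hodd h20 (by omega) (by omega))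
    rcases lt_or_ge n 30 with h' | h'
    · exact Or.inr (h ▸ settled_of_settledBetween settledBetween_thirteen h'' h')
    · exact hlarge _ _ h (by norm_num) (by norm_num) (by norm_num) h'
  · exact Or.inr (by rw [h]; rfl)

/-- The sieve settles all cases outside of a finite list. -/
lemma hasTwoPrimitiveOneNormal_or_mem_exceptions {p t : ℕ} (hp : p.Prime) (hp5 : 5 ≤ p)
    (ht : 1 ≤ t) (hq : Fintype.card K = p ^ t) (hn : 3 ≤ Module.finrank K L) :
    HasTwoPrimitiveOneNormal K L ∨ (Fintype.card K, Module.finrank K L) ∈ exceptions := by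
  have h5 : 5 ≤ Fintype.card K := hq ▸ hp5.trans (Nat.le_self_pow (by omega) _)
  have hndvd : ∀ l, l.Prime → l < 5 → ¬ l ∣ Fintype.card K := by
    intro l hl hl5 h
    have := (Nat.prime_dvd_prime_iff_eq hl hp).1 (hl.dvd_of_dvd_pow (hq ▸ h))
    omega
  have h2 := hndvd 2 Nat.prime_two (by norm_num)
  have h3 := hndvd 3 Nat.prime_three (by norm_num)
  have hodd : Odd (Fintype.card K) := by rwa [← Nat.not_even_iff_odd, even_iff_two_dvd]
  rcases hasTwoPrimitiveOneNormal_or_settled (L := L) hodd h5 (by omega) hn with h | h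
  · exact Or.inl h
  · simp only [settled, Bool.or_eq_true, beq_iff_eq, List.elem_iff] at h
    rcases h with (((h | h) | h) | h) | h
    · omega
    · omega
    · rw [hq, not_isNotPrimePow hp] at h
      simp at h
    · exact Or.inr h
    · exact Or.inl (hasTwoPrimitiveOneNormal_of_criterion hodd hn h)

end Regions

/-- The value at `r` of the polynomial with the given list of coefficients. -/
def evalList {R : Type*} [CommRing R] (r : R) : List ℕ → R
  | [] => 0
  | c :: l => c + r * evalList r l

/-- Addition of coefficient lists modulo `p`. -/
def addMod (p : ℕ) : List ℕ → List ℕ → List ℕ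
  | [], b => b
  | x :: a, [] => x :: a
  | x :: a, y :: b => (x + y) % p :: addMod p a b

/-- Multiplication of a coefficient list by a scalar modulo `p`. -/
def scaleMod (p c : ℕ) (l : List ℕ) : List ℕ := l.map fun x => c * x % p

/-- Multiplication by `X` modulo `p` and `X ^ red.length - red`. -/
def shiftMod (p : ℕ) (red l : List ℕ) : List ℕ :=
  match (0 :: l).drop red.length with
  | [c] => addMod p ((0 :: l).take red.length) (scaleMod p c red)
  | _ => 0 :: l

/-- Multiplication modulo `p` and `X ^ red.length - red`. -/
def mulMod (p : ℕ) (red : List ℕ) : List ℕ → List ℕ → List ℕ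
  | [], _ => []
  | x :: a, b => addMod p (scaleMod p x b) (shiftMod p red (mulMod p red a b))

/-- Powers modulo `p` and `X ^ red.length - red`, for exponents below `2 ^ k`. -/
def powMod (p : ℕ) (red : List ℕ) : ℕ → List ℕ → ℕ → List ℕ
  | 0, _, _ => [1]
  | k + 1, a, e =>
    if e = 0 then [1]
    else if e % 2 = 0 then powMod p red k (mulMod p red a a) (e / 2)
    else mulMod p red a (powMod p red k (mulMod p red a a) (e / 2))

/-- The test for the zero polynomial. -/
def isZeroMod (l : List ℕ) : Bool := l.all (· == 0)

/-- The test for the constant polynomial `1`. -/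
def isOneMod (p : ℕ) (l : List ℕ) : Bool := isZeroMod (addMod p l [p - 1])

/-- The action of the polynomial `g` in the Frobenius on `v`. -/
def frobMod (p q : ℕ) (red v : List ℕ) : List ℕ → List ℕ
  | [] => []
  | c :: g => addMod p (scaleMod p c v) (powMod p red 32 (frobMod p q red v g) q)

/-- The test for units of order dividing `M`. -/
def isUnitMod (p : ℕ) (red : List ℕ) (M : ℕ) (v : List ℕ) : Bool :=
  isOneMod p (powMod p red 32 v M)

/-- Primality by trial division. -/
def isPrimeTrial (l : ℕ) : Bool :=
  Nat.ble 2 l && (List.range l).all fun m => Nat.ble m 1 || l % m != 0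

/-- The test for `X` being a root of unity of order exactly `M / 2` and trace zero, where
`M = q ^ n - 1` and `ls` contains the prime divisors of `M / 2`. -/
def isTwoPrimitiveMod (p q n : ℕ) (red ls : List ℕ) : Bool :=
  isZeroMod (addMod p (powMod p red 32 [0, 1] (q ^ n)) [0, p - 1]) &&
  (isOneMod p (powMod p red 32 [0, 1] ((q ^ n - 1) / 2)) &&
  (ls.all isPrimeTrial && (ls.prod ^ 32 % ((q ^ n - 1) / 2) == 0 &&
  (ls.all (fun l => isUnitMod p red (q ^ n - 1)
    (addMod p (powMod p red 32 [0, 1] ((q ^ n - 1) / 2 / l)) [p - 1])) &&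
  isZeroMod (frobMod p q red [0, 1] (List.replicate n 1))))))

section Soundness

variable {R : Type*} [CommRing R] {r : R} {p : ℕ} {red : List ℕ}

lemma map_evalList {S : Type*} [CommRing S] (f : R →+* S) (r : R) (l : List ℕ) :
    f (evalList r l) = evalList (f r) l := by
  induction l with
  | nil => simp [evalList]
  | cons c l ih => simp [evalList, ih]

lemma natCast_mod_of_cast_eq_zero (hp : (p : R) = 0) (m : ℕ) : ((m % p : ℕ) : R) = m := by
  conv_rhs => rw [← Nat.mod_add_div m p]
  push_cast
  rw [hp, zero_mul, add_zero]

lemma evalList_addMod (hp : (p : R) = 0) (a b : List ℕ) :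
    evalList r (addMod p a b) = evalList r a + evalList r b := by
  induction a generalizing b with
  | nil => simp [addMod, evalList]
  | cons x a ih =>
    rcases b with _ | ⟨y, b⟩
    · simp [addMod, evalList]
    · simp only [addMod, evalList, ih, natCast_mod_of_cast_eq_zero hp]
      push_cast; ring

lemma evalList_scaleMod (hp : (p : R) = 0) (c : ℕ) (a : List ℕ) :
    evalList r (scaleMod p c a) = c * evalList r a := by
  induction a with
  | nil => simp [scaleMod, evalList]
  | cons x a ih =>
    simp only [scaleMod, List.map_cons, evalList, natCast_mod_of_cast_eq_zero hp] at ih ⊢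
    rw [ih]
    push_cast; ring

lemma evalList_take_add_drop (k : ℕ) (a : List ℕ) :
    evalList r (a.take k) + r ^ k * evalList r (a.drop k) = evalList r a := by
  induction k generalizing a with
  | zero => simp [evalList]
  | succ k ih =>
    rcases a with _ | ⟨x, a⟩
    · simp [evalList]
    · simp only [List.take_succ_cons, List.drop_succ_cons, evalList, ← ih a]
      ring

lemma evalList_shiftMod (hp : (p : R) = 0) (hr : r ^ red.length = evalList r red) (a : List ℕ) :
    evalList r (shiftMod p red a) = r * evalList r a := by
  have h0 : evalList r (0 :: a) = r * evalList r a := by simp [evalList]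
  rw [shiftMod]
  split
  · next c h =>
    rw [evalList_addMod hp, evalList_scaleMod hp, ← h0,
      ← evalList_take_add_drop red.length (0 :: a),
      h, hr]
    simp [evalList, mul_comm]
  · exact h0

lemma evalList_mulMod (hp : (p : R) = 0) (hr : r ^ red.length = evalList r red) (a b : List ℕ) :
    evalList r (mulMod p red a b) = evalList r a * evalList r b := by
  induction a with
  | nil => simp [mulMod, evalList]
  | cons x a ih =>
    rw [mulMod, evalList_addMod hp, evalList_scaleMod hp, evalList_shiftMod hp hr, ih, evalList]
    ring

lemma evalList_powMod (hp : (p : R) = 0) (hr : r ^ red.length = evalList r red) {k e : ℕ}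
    (he : e < 2 ^ k) (a : List ℕ) :
    evalList r (powMod p red k a e) = evalList r a ^ e := by
  induction k generalizing a e with
  | zero =>
    obtain rfl : e = 0 := by simpa using he
    simp [powMod, evalList]
  | succ k ih =>
    have hlt : e / 2 < 2 ^ k := by rw [pow_succ] at he; omega
    have h2 : evalList r (powMod p red k (mulMod p red a a) (e / 2)) =
        evalList r a ^ (2 * (e / 2)) := by
      rw [ih hlt, evalList_mulMod hp hr, ← pow_two, ← pow_mul]
    rw [powMod]
    split_ifs with h0 h1
    · simp [h0, evalList]
    · rw [h2]; congr 1; omega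
    · rw [evalList_mulMod hp hr, h2, ← pow_succ']; congr 1; omega

lemma evalList_eq_zero {a : List ℕ} (h : isZeroMod a = true) : evalList r a = 0 := by
  induction a with
  | nil => rfl
  | cons x a ih =>
    simp only [isZeroMod, List.all_cons, Bool.and_eq_true, beq_iff_eq] at h ih
    simp [evalList, h.1, ih h.2]

lemma evalList_neg_one (hp : (p : R) = 0) (hp0 : p ≠ 0) : evalList r [p - 1] = -1 := by
  simp [evalList, Nat.cast_sub (Nat.one_le_iff_ne_zero.2 hp0), hp]

lemma evalList_eq_one (hp : (p : R) = 0) (hp0 : p ≠ 0) {a : List ℕ} (h : isOneMod p a = true) :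
    evalList r a = 1 := by
  have := evalList_eq_zero (r := r) h
  rw [evalList_addMod hp, evalList_neg_one hp hp0] at this
  linear_combination this

lemma evalList_X : evalList r [0, 1] = r := by simp [evalList]

lemma evalList_ne_zero [Nontrivial R] (hp : (p : R) = 0) (hp0 : p ≠ 0)
    (hr : r ^ red.length = evalList r red) {M : ℕ} (hM : M < 2 ^ 32) (hM0 : M ≠ 0) {v : List ℕ}
    (h : isUnitMod p red M v = true) : evalList r v ≠ 0 := by
  intro h0
  have := evalList_eq_one (r := r) hp hp0 h
  rw [evalList_powMod hp hr hM, h0, zero_pow hM0] at this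
  exact zero_ne_one this

lemma prime_of_isPrimeTrial {l : ℕ} (h : isPrimeTrial l = true) : l.Prime := by
  rw [isPrimeTrial, Bool.and_eq_true, Nat.ble_eq] at h
  refine Nat.prime_def_lt.2 ⟨h.1, fun m hm hdvd => ?_⟩
  have h1 := List.all_eq_true.1 h.2 m (List.mem_range.2 hm)
  rw [Bool.or_eq_true, Nat.ble_eq, bne_iff_ne] at h1
  have h2 : m ≠ 0 := by rintro rfl; simp at hdvd; omega
  rcases h1 with h1 | h1
  · omega
  · exact absurd (Nat.mod_eq_zero_of_dvd hdvd) h1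

end Soundness

section FiniteFields

variable {L : Type*} [Field L] {p : ℕ} {red : List ℕ}

lemma degree_evalList_X_lt (l : List ℕ) : (evalList (X : L[X]) l).degree < l.length := by
  induction l with
  | nil => simp [evalList]
  | cons c l ih =>
    rw [evalList]
    refine (degree_add_le _ _).trans_lt (max_lt ?_ ?_)
    · rw [← C_eq_natCast]
      exact degree_C_le.trans_lt (by simp; positivity)
    · rw [X_mul, degree_mul_X]
      rcases eq_or_ne (evalList (X : L[X]) l) 0 with h | h
      · simp [h]
      · rw [degree_eq_natDegree h] at ih ⊢
        norm_cast at ih ⊢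
        simp only [List.length_cons]
        omega

/-- A polynomial modulo which `X ^ card L = X` has a root in `L`. -/
lemma exists_pow_length_eq [Fintype L] (hp : (p : L) = 0) (hp0 : p ≠ 0) (hred : red ≠ [])
    (hcard : Fintype.card L < 2 ^ 32)
    (h : isZeroMod (addMod p (powMod p red 32 [0, 1] (Fintype.card L)) [0, p - 1]) = true) :
    ∃ r : L, r ^ red.length = evalList r red := by
  set H : L[X] := X ^ red.length - evalList X red with hH
  have hlt : (evalList (X : L[X]) red).degree < (X ^ red.length : L[X]).degree := by
    rw [degree_X_pow]; exact degree_evalList_X_lt red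
  have hdeg : H.degree = red.length := by
    rw [hH, degree_sub_eq_left_of_degree_lt hlt, degree_X_pow]
  have hp' : ((p : ℕ) : AdjoinRoot H) = 0 := by
    rw [← map_natCast (algebraMap L (AdjoinRoot H)), hp, map_zero]
  have hroot : AdjoinRoot.root H ^ red.length = evalList (AdjoinRoot.root H) red := by
    have : AdjoinRoot.mk H H = 0 := AdjoinRoot.mk_self
    rw [hH, map_sub, map_pow, map_evalList, sub_eq_zero] at this
    exact this
  have h1 := evalList_eq_zero (r := AdjoinRoot.root H) h
  have h2 : evalList (AdjoinRoot.root H) [0, p - 1] = - AdjoinRoot.root H := by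
    rw [evalList, evalList_neg_one hp' hp0]; simp
  rw [evalList_addMod hp', evalList_powMod hp' hroot hcard, evalList_X, h2] at h1
  have hdvd : H ∣ X ^ Nat.card L - X := by
    rw [← AdjoinRoot.mk_eq_zero, map_sub, map_pow, AdjoinRoot.mk_X, Nat.card_eq_fintype_card,
      sub_eq_add_neg]
    exact h1
  have hsplit : H.Splits := by
    refine Splits.of_dvd (Polynomial.splits_X_pow_nat_card_sub_X) ?_ hdvd
    rw [Nat.card_eq_fintype_card]
    exact FiniteField.X_pow_card_sub_X_ne_zero L Fintype.one_lt_card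
  obtain ⟨r, hr⟩ := hsplit.exists_eval_eq_zero (by
    rw [hdeg]; exact_mod_cast (List.length_pos_iff.2 hred).ne')
  refine ⟨r, ?_⟩
  have h3 := map_evalList (evalRingHom r) X red
  simp only [coe_evalRingHom, eval_X] at h3
  rw [hH, eval_sub, eval_pow, eval_X, h3, sub_eq_zero] at hr
  exact hr

end FiniteFields

lemma evalList_replicate_one {K : Type*} [Field K] (n : ℕ) :
    evalList (X : K[X]) (List.replicate n 1) = ∑ i ∈ range n, X ^ i := by
  induction n with
  | zero => simp [evalList]
  | succ n ih => rw [List.replicate_succ, evalList, ih, geom_sum_succ]; push_cast; ring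

section FrobMod

variable {K L : Type*} [Field K] [Field L] [Algebra K L] [Fintype K] [Fintype L] {p : ℕ}
  {red : List ℕ} {r : L}

lemma frobAct_natCast (c : ℕ) (x : L) : frobAct K (c : K[X]) x = c * x := by
  rw [← C_eq_natCast, frobAct_C, Algebra.smul_def, map_natCast]

lemma evalList_frobMod (hp : (p : L) = 0) (hr : r ^ red.length = evalList r red)
    (hq : Fintype.card K < 2 ^ 32) (v g : List ℕ) :
    evalList r (frobMod p (Fintype.card K) red v g) =
      frobAct K (evalList (X : K[X]) g) (evalList r v) := by
  induction g with
  | nil => simp [frobMod, evalList, frobAct]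
  | cons c g ih =>
    rw [frobMod, evalList_addMod hp, evalList_scaleMod hp, evalList_powMod hp hr hq, ih, evalList,
      frobAct_add, frobAct_mul, frobAct_X, frobAct_natCast]

lemma exists_of_isTwoPrimitiveMod (hp : (p : L) = 0) (hp0 : p ≠ 0) (hred : red ≠ []) {n : ℕ}
    (hn : n ≠ 0) (hcard : Fintype.card L = Fintype.card K ^ n) (hlt : Fintype.card L < 2 ^ 32)
    (h3 : 3 ≤ Fintype.card L) {ls : List ℕ}
    (h : isTwoPrimitiveMod p (Fintype.card K) n red ls = true) :
    ∃ r : L, r ^ red.length = evalList r red ∧ orderOf r = (Fintype.card L - 1) / 2 ∧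
      frobAct K (∑ i ∈ range n, X ^ i) r = 0 := by
  have hq : Fintype.card K < 2 ^ 32 := by
    refine lt_of_le_of_lt ?_ hlt
    rw [hcard]; exact Nat.le_self_pow hn _
  simp only [isTwoPrimitiveMod, ← hcard, Bool.and_eq_true, beq_iff_eq] at h
  obtain ⟨hroot, hone, hprime, hprod, hdiv, htr⟩ := h
  obtain ⟨r, hr⟩ := exists_pow_length_eq hp hp0 hred hlt hroot
  refine ⟨r, hr, orderOf_eq_of_pow_and_pow_div_prime (by omega) ?_ ?_, ?_⟩
  · have := evalList_eq_one (r := r) hp hp0 hone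
    rwa [evalList_powMod hp hr (by omega), evalList_X] at this
  · intro l hl hdvd h1
    obtain ⟨l', hl', hll'⟩ := (Prime.dvd_prod_iff hl.prime).1
      (hl.dvd_of_dvd_pow (hdvd.trans (Nat.dvd_of_mod_eq_zero hprod)))
    have := (Nat.prime_dvd_prime_iff_eq hl
      (prime_of_isPrimeTrial (List.all_eq_true.1 hprime l' hl'))).1 hll'
    subst this
    refine evalList_ne_zero (r := r) hp hp0 hr (by omega) (by omega)
      (List.all_eq_true.1 hdiv l hl') ?_
    rw [evalList_addMod hp, evalList_neg_one hp hp0,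
      evalList_powMod hp hr ((Nat.div_le_self _ _).trans_lt (by omega)), evalList_X, h1]
    ring
  · have := evalList_eq_zero (r := r) htr
    rwa [evalList_frobMod hp hr hq, evalList_X, evalList_replicate_one] at this

/-- For `n = 4`, two conditions force an element of trace zero to be `1`-normal. -/
lemma finrank_conjSpan_four (h4 : Module.finrank K L = 4) {α : L}
    (hα : frobAct K (∑ i ∈ range 4, X ^ i) α = 0) (h1 : frobAct K (1 + X ^ 2) α ≠ 0)
    (h2 : frobAct K (1 + X) (frobAct K (1 + X) α ^ 2) ≠ 0) :
    Module.finrank K (conjSpan K (Fintype.card K) 4 α) = 3 := by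
  have hdeg : (∑ i ∈ range 4, X ^ i : K[X]).natDegree = 3 := natDegree_geomSum (by norm_num)
  rw [finrank_conjSpan_of_forall (h4 ▸ geomSum_dvd _) (by rw [hdeg]; norm_num) hα, hdeg]
  intro g hg e hge he
  have hf : (∑ i ∈ range 4, X ^ i : K[X]) = (1 + X) * (1 + X ^ 2) := by
    simp [sum_range_succ]; ring
  have hg0 := hg.ne_zero
  have hirr : Irreducible (1 + X : K[X]) := by
    rw [add_comm, ← C_1]; exact irreducible_of_degree_eq_one (degree_X_add_C 1)
  rcases hg.prime.dvd_or_dvd (show g ∣ (1 + X) * (1 + X ^ 2) from hf ▸ Dvd.intro _ hge.symm) with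
    ⟨k, hk⟩ | ⟨k, hk⟩
  · have hek : e = k * (1 + X ^ 2) := by
      refine mul_left_cancel₀ hg0 ?_
      rw [← hge, hf, hk]; ring
    have hku := (hirr.isUnit_or_isUnit hk).resolve_left hg.not_isUnit
    exact h1 (frobKer_mono (hek ▸ hku.mul_left_dvd.2 dvd_rfl) he)
  · have hek : e = k * (1 + X) := by
      refine mul_left_cancel₀ hg0 ?_
      rw [← hge, hf, hk]; ring
    rw [hek, frobAct_mul] at he
    set β := frobAct K (1 + X) α
    rw [frobAct_add, frobAct_one, frobAct_X] at h2
    have hk0 : k ≠ 0 := by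
      rintro rfl
      rw [hek, zero_mul, mul_zero, ← leadingCoeff_eq_zero,
        (monic_geomSum (by norm_num)).leadingCoeff] at hge
      exact one_ne_zero hge
    have hkdeg : k.natDegree ≤ 1 := by
      have h5 := congrArg natDegree hk
      have h6 := hg.natDegree_pos
      rw [natDegree_mul hg0 hk0, add_comm 1 (X ^ 2), ← C_1, natDegree_X_pow_add_C] at h5
      omega
    rcases Nat.le_one_iff_eq_zero_or_eq_one.1 hkdeg with h0 | h0
    · have hku : IsUnit k := isUnit_iff_degree_eq_zero.2 (by rw [degree_eq_natDegree hk0, h0]; rfl)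
      have hβ : frobAct K 1 β = 0 := frobKer_mono hku.dvd he
      rw [frobAct_one] at hβ
      have : Fintype.card K ≠ 0 := Fintype.card_ne_zero
      simp [hβ, this] at h2
    · have hkdeg' : k.degree = 1 := by rw [degree_eq_natDegree hk0, h0]; rfl
      obtain ⟨c, hc⟩ := exists_root_of_degree_eq_one hkdeg'
      have hdvd : k ∣ X - C c := (irreducible_X_sub_C c).dvd_symm
        (irreducible_of_degree_eq_one hkdeg') (dvd_iff_isRoot.2 hc)
      have hβ : frobAct K (X - C c) β = 0 := frobKer_mono hdvd he
      rw [frobAct_sub, frobAct_X, frobAct_C, Algebra.smul_def, sub_eq_zero] at hβ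
      have hc2 : 1 + c ^ 2 = 0 := by
        have := congrArg (eval c) hk
        rw [eval_mul, hc.eq_zero, mul_zero] at this
        simpa using this
      have hc2' : 1 + algebraMap K L c ^ 2 = 0 := by
        rw [← map_pow, ← map_one (algebraMap K L), ← map_add, hc2, map_zero]
      refine h2 ?_
      rw [← pow_mul, mul_comm, pow_mul, hβ]
      linear_combination β ^ 2 * hc2'

/-- A criterion for `1`-normality in terms of a factorisation into irreducible factors. -/
lemma finrank_conjSpan_of_prod_eq {gs : List K[X]} {α : L} (hn : Module.finrank K L ≠ 0)
    (hprod : gs.prod = ∑ i ∈ range (Module.finrank K L), X ^ i) (hirr : ∀ g ∈ gs, Irreducible g)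
    (hα : frobAct K (∑ i ∈ range (Module.finrank K L), X ^ i) α = 0)
    (h : ∀ i < gs.length, frobAct K (gs.eraseIdx i).prod α ≠ 0) :
    Module.finrank K (conjSpan K (Fintype.card K) (Module.finrank K L) α) =
      Module.finrank K L - 1 := by
  have hdeg := natDegree_geomSum (K := K) hn
  rw [finrank_conjSpan_of_forall (geomSum_dvd _) (by omega) hα, hdeg]
  intro g hg e hge he
  obtain ⟨g', hg', hdvd⟩ := (Prime.dvd_prod_iff hg.prime).1 (hprod ▸ Dvd.intro _ hge.symm)
  obtain ⟨i, hi, rfl⟩ := List.getElem_of_mem hg'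
  obtain ⟨k, hk⟩ := hdvd
  have hku := ((hirr _ hg').isUnit_or_isUnit hk).resolve_left hg.not_isUnit
  have hek : e = k * (gs.eraseIdx i).prod := by
    refine mul_left_cancel₀ hg.ne_zero ?_
    rw [← hge, ← hprod, ← List.CommMonoid.mul_prod_eraseIdx hi, hk]; ring
  exact h i hi (frobKer_mono (hek ▸ hku.mul_left_dvd.2 dvd_rfl) he)

/-- The test of `finrank_conjSpan_of_prod_eq` for `X`. -/
def isNormalMod (p q n : ℕ) (red : List ℕ) (gs : List (List ℕ)) : Bool :=
  (List.range gs.length).all fun i => isUnitMod p red (q ^ n - 1)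
    ((gs.eraseIdx i).foldr (fun g v => frobMod p q red v g) [0, 1])

lemma evalList_foldr_frobMod (hp : (p : L) = 0) (hr : r ^ red.length = evalList r red)
    (hq : Fintype.card K < 2 ^ 32) (gs : List (List ℕ)) :
    evalList r (gs.foldr (fun g v => frobMod p (Fintype.card K) red v g) [0, 1]) =
      frobAct K (gs.map (evalList (X : K[X]))).prod r := by
  induction gs with
  | nil => simp [evalList_X, frobAct_one]
  | cons g gs ih =>
    rw [List.foldr_cons, evalList_frobMod hp hr hq, ih, List.map_cons, List.prod_cons, frobAct_mul]

end FrobMod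

/-- The tests of `finrank_conjSpan_four` for `X`. -/
def isNormalFourMod (p q : ℕ) (red : List ℕ) : Bool :=
  isUnitMod p red (q ^ 4 - 1) (frobMod p q red [0, 1] [1, 0, 1]) &&
  isUnitMod p red (q ^ 4 - 1)
    (frobMod p q red (powMod p red 32 (frobMod p q red [0, 1] [1, 1]) 2) [1, 1])

section Exceptions

lemma irreducible_evalList_linear {K : Type*} [Field K] (c : ℕ) :
    Irreducible (evalList (X : K[X]) [c, 1]) := by
  have : evalList (X : K[X]) [c, 1] = X + C (c : K) := by simp [evalList, add_comm]
  rw [this]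
  exact irreducible_of_degree_eq_one (degree_X_add_C _)

lemma irreducible_evalList_quadratic {K : Type*} [Field K] [Fintype K] {p : ℕ} (hp : p.Prime)
    (hK : Fintype.card K = p) {c d : ℕ} (h : ∀ x : ZMod p, x ^ 2 + d * x + c ≠ 0) :
    Irreducible (evalList (X : K[X]) [c, d, 1]) := by
  have he : evalList (X : K[X]) [c, d, 1] = X ^ 2 + (C (d : K) * X + C (c : K)) := by
    simp [evalList]; ring
  have hlt : (C (d : K) * X + C (c : K)).degree < ((2 : ℕ) : WithBot ℕ) :=
    degree_linear_le.trans_lt (by norm_num)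
  have hmonic : (X ^ 2 + (C (d : K) * X + C (c : K))).Monic := monic_X_pow_add hlt
  have hdeg : (X ^ 2 + (C (d : K) * X + C (c : K))).natDegree = 2 :=
    natDegree_eq_of_degree_eq_some (by
      rw [degree_add_eq_left_of_degree_lt (by rwa [degree_X_pow]), degree_X_pow])
  rw [he, hmonic.irreducible_iff_roots_eq_zero_of_degree_le_three (by omega) (by omega)]
  refine Multiset.eq_zero_of_forall_notMem fun x hx => ?_
  have hx := (mem_roots'.1 hx).2
  let E := ZMod.ringEquivOfPrime K hp hK
  refine h (E.symm x) (E.injective ?_)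
  simp only [IsRoot.def, eval_add, eval_pow, eval_X, eval_mul, eval_C] at hx
  simp only [map_add, map_mul, map_pow, map_natCast, map_zero, RingEquiv.apply_symm_apply]
  linear_combination hx

variable {K L : Type*} [Field K] [Field L] [Algebra K L] [Fintype K] [Fintype L]

lemma natCast_eq_zero_of_card {p t : ℕ} (hK : Fintype.card K = p ^ t) : (p : K) = 0 := by
  have h := FiniteField.cast_card_eq_zero K
  rw [hK, Nat.cast_pow] at h
  exact eq_zero_of_pow_eq_zero h

lemma exists_of_test {p t n : ℕ} {red ls : List ℕ} (hK : Fintype.card K = p ^ t)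
    (hn : Module.finrank K L = n)
    (h : (red != [] && (Nat.blt 2 ((p ^ t) ^ n) && (Nat.blt ((p ^ t) ^ n) (2 ^ 32) &&
      isTwoPrimitiveMod p (p ^ t) n red ls))) = true) :
    (p : L) = 0 ∧ p ≠ 0 ∧ Fintype.card K < 2 ^ 32 ∧ Fintype.card L < 2 ^ 32 ∧
    ∃ r : L, r ^ red.length = evalList r red ∧ orderOf r = (Fintype.card L - 1) / 2 ∧
      frobAct K (∑ i ∈ range n, X ^ i) r = 0 := by
  have hcard : Fintype.card L = (p ^ t) ^ n := by
    rw [Module.card_eq_pow_finrank (K := K), hK, hn]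
  have hp : (p : L) = 0 := by
    rw [← map_natCast (algebraMap K L), natCast_eq_zero_of_card hK, map_zero]
  simp only [Bool.and_eq_true, bne_iff_ne, Nat.blt_eq, ← hcard] at h
  obtain ⟨hred, h3, hlt, h⟩ := h
  have hn0 : n ≠ 0 := hn ▸ Module.finrank_pos.ne'
  have hp0 : p ≠ 0 := by
    rintro rfl
    have := Fintype.one_lt_card (α := K)
    rw [hK] at this
    rcases t with _ | t <;> simp at this
  refine ⟨hp, hp0, ?_, hlt, exists_of_isTwoPrimitiveMod (K := K) hp hp0 hred hn0
    (by rw [hcard, hK]) hlt h3 (by rw [hK]; exact h)⟩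
  refine lt_of_le_of_lt ?_ hlt
  rw [hcard, hK]
  exact Nat.le_self_pow hn0 _

lemma hasTwoPrimitiveOneNormal_three_of_test (p t : ℕ) (red ls : List ℕ)
    (hK : Fintype.card K = p ^ t) (h3 : Module.finrank K L = 3)
    (h : (red != [] && (Nat.blt 2 ((p ^ t) ^ 3) && (Nat.blt ((p ^ t) ^ 3) (2 ^ 32) &&
      isTwoPrimitiveMod p (p ^ t) 3 red ls))) = true) :
    HasTwoPrimitiveOneNormal K L := by
  obtain ⟨-, -, -, -, r, hr, hord, htr⟩ := exists_of_test hK h3 h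
  exact ⟨r, hord, by rw [h3]; exact finrank_conjSpan_three h3 hord htr⟩

lemma hasTwoPrimitiveOneNormal_four_of_test (p t : ℕ) (red ls : List ℕ)
    (hK : Fintype.card K = p ^ t) (h4 : Module.finrank K L = 4)
    (h : (red != [] && (Nat.blt 2 ((p ^ t) ^ 4) && (Nat.blt ((p ^ t) ^ 4) (2 ^ 32) &&
      isTwoPrimitiveMod p (p ^ t) 4 red ls))) = true)
    (hnormal : isNormalFourMod p (p ^ t) red = true) :
    HasTwoPrimitiveOneNormal K L := by
  obtain ⟨hp, hp0, hq, hlt, r, hr, hord, htr⟩ := exists_of_test hK h4 h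
  have hcard : Fintype.card L = (p ^ t) ^ 4 := by
    rw [Module.card_eq_pow_finrank (K := K), hK, h4]
  have h1 := Fintype.one_lt_card (α := L)
  rw [isNormalFourMod, Bool.and_eq_true, ← hcard, ← hK] at hnormal
  have hu := evalList_ne_zero (r := r) hp hp0 hr (by omega) (by omega) hnormal.1
  have hv := evalList_ne_zero (r := r) hp hp0 hr (by omega) (by omega) hnormal.2
  rw [evalList_frobMod hp hr hq] at hu hv
  rw [evalList_powMod hp hr (by norm_num), evalList_frobMod hp hr hq] at hv
  rw [evalList_X] at hu hv
  simp [evalList, ← pow_two] at hu hv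
  exact ⟨r, hord, by rw [h4]; exact finrank_conjSpan_four h4 htr hu hv⟩

lemma hasTwoPrimitiveOneNormal_of_test (p n : ℕ) (red ls : List ℕ) (gs : List (List ℕ))
    (hK : Fintype.card K = p) (hn : Module.finrank K L = n)
    (h : (red != [] && (Nat.blt 2 ((p ^ 1) ^ n) && (Nat.blt ((p ^ 1) ^ n) (2 ^ 32) &&
      isTwoPrimitiveMod p (p ^ 1) n red ls))) = true)
    (hnormal : isNormalMod p (p ^ 1) n red gs = true)
    (hirr : ∀ g ∈ gs, Irreducible (evalList (X : K[X]) g))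
    (hprod : (gs.map (evalList (X : K[X]))).prod = ∑ i ∈ range n, X ^ i) :
    HasTwoPrimitiveOneNormal K L := by
  have hK1 : Fintype.card K = p ^ 1 := by rw [hK, pow_one]
  obtain ⟨hp, hp0, hq, hlt, r, hr, hord, htr⟩ := exists_of_test hK1 hn h
  have hcard : Fintype.card L = (p ^ 1) ^ n := by
    rw [Module.card_eq_pow_finrank (K := K), hK1, hn]
  have h1 := Fintype.one_lt_card (α := L)
  refine ⟨r, hord, finrank_conjSpan_of_prod_eq (gs := gs.map (evalList (X : K[X])))
    Module.finrank_pos.ne' (by rw [hprod, hn]) (by simpa using hirr) (by rw [hn]; exact htr) ?_⟩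
  intro i hi
  rw [List.length_map] at hi
  rw [isNormalMod, ← hcard, ← hK1] at hnormal
  have hu := evalList_ne_zero (r := r) hp hp0 hr (by omega) (by omega)
    (List.all_eq_true.1 hnormal i (List.mem_range.2 hi))
  rwa [evalList_foldr_frobMod hp hr hq, ← List.eraseIdx_map] at hu

lemma hasTwoPrimitiveOneNormal_five_six (hK : Fintype.card K = 5)
    (hn : Module.finrank K L = 6) : HasTwoPrimitiveOneNormal K L := by
  refine hasTwoPrimitiveOneNormal_of_test 5 6 [1, 1, 3, 3, 4, 0] [2, 3, 7, 31]
    [[1, 1], [1, 1, 1], [1, 4, 1]] hK hn (by decide +kernel)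
    (by decide +kernel) ?_ ?_
  · simp only [List.forall_mem_cons, List.not_mem_nil, false_imp_iff, implies_true, and_true]
    refine ⟨?_, ?_, ?_⟩
    · exact irreducible_evalList_linear _
    · exact irreducible_evalList_quadratic (by norm_num) hK (by decide)
    · exact irreducible_evalList_quadratic (by norm_num) hK (by decide)
  · have hp : (5 : K[X]) = 0 := by
      have := natCast_eq_zero_of_card (t := 1) (by rw [hK, pow_one])
      rw [← C_ofNat, ← C_0]
      exact_mod_cast congrArg C this
    simp only [List.map_cons, List.map_nil, List.prod_cons, List.prod_nil, evalList,
      sum_range_succ, sum_range_zero]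
    push_cast
    linear_combination (1 * X ^ 1 + 2 * X ^ 2 + 2 * X ^ 3 + 1 * X ^ 4) * hp

lemma hasTwoPrimitiveOneNormal_seven_six (hK : Fintype.card K = 7)
    (hn : Module.finrank K L = 6) : HasTwoPrimitiveOneNormal K L := by
  refine hasTwoPrimitiveOneNormal_of_test 7 6 [3, 2, 5, 6, 0, 0] [2, 3, 19, 43]
    [[5, 1], [4, 1], [3, 1], [2, 1], [1, 1]] hK hn (by decide +kernel)
    (by decide +kernel) ?_ ?_
  · simp only [List.forall_mem_cons, List.not_mem_nil, false_imp_iff, implies_true, and_true]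
    refine ⟨?_, ?_, ?_, ?_, ?_⟩
    · exact irreducible_evalList_linear _
    · exact irreducible_evalList_linear _
    · exact irreducible_evalList_linear _
    · exact irreducible_evalList_linear _
    · exact irreducible_evalList_linear _
  · have hp : (7 : K[X]) = 0 := by
      have := natCast_eq_zero_of_card (t := 1) (by rw [hK, pow_one])
      rw [← C_ofNat, ← C_0]
      exact_mod_cast congrArg C this
    simp only [List.map_cons, List.map_nil, List.prod_cons, List.prod_nil, evalList,
      sum_range_succ, sum_range_zero]
    push_cast
    linear_combination (17 * X ^ 0 + 39 * X ^ 1 + 32 * X ^ 2 + 12 * X ^ 3 + 2 * X ^ 4) * hp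

lemma hasTwoPrimitiveOneNormal_five_eight (hK : Fintype.card K = 5)
    (hn : Module.finrank K L = 8) : HasTwoPrimitiveOneNormal K L := by
  refine hasTwoPrimitiveOneNormal_of_test 5 8 [1, 0, 1, 3, 4, 3, 2, 0] [2, 3, 13, 313]
    [[1, 1], [3, 1], [2, 1], [3, 0, 1], [2, 0, 1]] hK hn (by decide +kernel)
    (by decide +kernel) ?_ ?_
  · simp only [List.forall_mem_cons, List.not_mem_nil, false_imp_iff, implies_true, and_true]
    refine ⟨?_, ?_, ?_, ?_, ?_⟩
    · exact irreducible_evalList_linear _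
    · exact irreducible_evalList_linear _
    · exact irreducible_evalList_linear _
    · exact irreducible_evalList_quadratic (by norm_num) hK (by decide)
    · exact irreducible_evalList_quadratic (by norm_num) hK (by decide)
  · have hp : (5 : K[X]) = 0 := by
      have := natCast_eq_zero_of_card (t := 1) (by rw [hK, pow_one])
      rw [← C_ofNat, ← C_0]
      exact_mod_cast congrArg C this
    simp only [List.map_cons, List.map_nil, List.prod_cons, List.prod_nil, evalList,
      sum_range_succ, sum_range_zero]
    push_cast
    linear_combination (7 * X ^ 0 + 13 * X ^ 1 + 13 * X ^ 2 + 12 * X ^ 3 + 7 * X ^ 4 +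
      3 * X ^ 5 + 1 * X ^ 6) * hp

lemma hasTwoPrimitiveOneNormal_of_mem_exceptions
    (h : (Fintype.card K, Module.finrank K L) ∈ exceptions) : HasTwoPrimitiveOneNormal K L := by
  simp only [exceptions, List.mem_cons, Prod.mk.injEq, List.not_mem_nil, or_false] at h
  rcases h with ⟨hK, hn⟩ | ⟨hK, hn⟩ | ⟨hK, hn⟩ | ⟨hK, hn⟩ | ⟨hK, hn⟩ | ⟨hK, hn⟩ |
    ⟨hK, hn⟩ | ⟨hK, hn⟩ | ⟨hK, hn⟩ | ⟨hK, hn⟩ | ⟨hK, hn⟩ | ⟨hK, hn⟩ |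
    ⟨hK, hn⟩ | ⟨hK, hn⟩ | ⟨hK, hn⟩ | ⟨hK, hn⟩ | ⟨hK, hn⟩ | ⟨hK, hn⟩ |
    ⟨hK, hn⟩
  · exact hasTwoPrimitiveOneNormal_three_of_test 7 1 [2, 1, 0] [3, 19] hK hn
      (by decide +kernel)
  · exact hasTwoPrimitiveOneNormal_three_of_test 5 2 [1, 0, 3, 3, 1, 0] [2, 3, 7, 31] hK hn
      (by decide +kernel)
  · exact hasTwoPrimitiveOneNormal_four_of_test 5 1 [1, 2, 0, 0] [2, 3, 13] hK hn
      (by decide +kernel) (by decide +kernel)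
  · exact hasTwoPrimitiveOneNormal_four_of_test 7 1 [3, 6, 5, 0] [2, 3, 5] hK hn
      (by decide +kernel) (by decide +kernel)
  · exact hasTwoPrimitiveOneNormal_four_of_test 11 1 [2, 8, 6, 0] [2, 3, 5, 61] hK hn
      (by decide +kernel) (by decide +kernel)
  · exact hasTwoPrimitiveOneNormal_four_of_test 13 1 [9, 3, 12, 0] [2, 3, 5, 7, 17] hK hn
      (by decide +kernel) (by decide +kernel)
  · exact hasTwoPrimitiveOneNormal_four_of_test 17 1 [9, 5, 9, 0] [2, 3, 5, 29] hK hn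
      (by decide +kernel) (by decide +kernel)
  · exact hasTwoPrimitiveOneNormal_four_of_test 19 1 [2, 9, 0, 0] [2, 3, 5, 181] hK hn
      (by decide +kernel) (by decide +kernel)
  · exact hasTwoPrimitiveOneNormal_four_of_test 23 1 [17, 1, 20, 0] [2, 3, 5, 11, 53] hK hn
      (by decide +kernel) (by decide +kernel)
  · exact hasTwoPrimitiveOneNormal_four_of_test 5 2 [1, 4, 0, 1, 3, 0, 3, 0] [2, 3, 13, 313] hK hn
      (by decide +kernel) (by decide +kernel)
  · exact hasTwoPrimitiveOneNormal_four_of_test 29 1 [16, 28, 20, 0] [2, 3, 5, 7, 421] hK hn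
      (by decide +kernel) (by decide +kernel)
  · exact hasTwoPrimitiveOneNormal_four_of_test 37 1 [33, 26, 7, 0] [2, 3, 5, 19, 137] hK hn
      (by decide +kernel) (by decide +kernel)
  · exact hasTwoPrimitiveOneNormal_four_of_test 41 1 [36, 28, 32, 0] [2, 3, 5, 7, 29] hK hn
      (by decide +kernel) (by decide +kernel)
  · exact hasTwoPrimitiveOneNormal_four_of_test 47 1 [38, 10, 16, 0] [2, 3, 5, 13, 17, 23] hK hn
      (by decide +kernel) (by decide +kernel)
  · exact hasTwoPrimitiveOneNormal_four_of_test 53 1 [49, 10, 2, 0] [2, 3, 5, 13, 281] hK hn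
      (by decide +kernel) (by decide +kernel)
  · exact hasTwoPrimitiveOneNormal_four_of_test 83 1 [45, 44, 20, 0] [2, 3, 5, 7, 13, 41, 53] hK hn
      (by decide +kernel) (by decide +kernel)
  · exact hasTwoPrimitiveOneNormal_five_six hK hn
  · exact hasTwoPrimitiveOneNormal_seven_six hK hn
  · exact hasTwoPrimitiveOneNormal_five_eight hK hn

end Exceptions

/-- Let `q` be a power of a prime `p ≥ 5` and `n ≥ 3`. Then there exists `α ∈ F_{q^n}`
that is simultaneously `2`-primitive and `1`-normal over `F_q`. -/
theorem stmt_2 (p t q n : ℕ) (hp : p.Prime) (hp5 : 5 ≤ p) (ht : 1 ≤ t)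
    (hq : q = p ^ t) (hn : 3 ≤ n)
    (K L : Type*) [Field K] [Field L] [Algebra K L] [Fintype K] [Fintype L]
    (hK : Fintype.card K = q) (hL : Fintype.card L = q ^ n) :
    ∃ α : L, orderOf α = (q ^ n - 1) / 2 ∧
      Module.finrank K (conjSpan K q n α) = n - 1 := by
  have hq1 : 1 < q := hK ▸ Fintype.one_lt_card
  have hfin : Module.finrank K L = n := by
    have h := Module.card_eq_pow_finrank (K := K) (V := L)
    rw [hL, hK] at h
    exact (Nat.pow_right_injective hq1 h).symm
  have h : HasTwoPrimitiveOneNormal K L :=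
    (hasTwoPrimitiveOneNormal_or_mem_exceptions hp hp5 ht (hK.trans hq)
      (hn.trans hfin.ge)).elim id hasTwoPrimitiveOneNormal_of_mem_exceptions
  rwa [HasTwoPrimitiveOneNormal, hL, hK, hfin] at h
end

section
/- Let q > 3 be an odd prime power. Then every 2-primitive element of F_{q^2}, i.e., every element of multiplicative order (q^2 − 1)/2, is normal over F_q. -/
/-- Let `q > 3` be an odd prime power. Then every `2`-primitive element of `F_{q^2}`
is normal over `F_q`. -/
theorem stmt_3 (p t q : ℕ) (hp : p.Prime) (hodd : Odd p) (ht : 1 ≤ t)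
    (hq : q = p ^ t) (hq3 : 3 < q)
    (K L : Type*) [Field K] [Field L] [Algebra K L] [Fintype K] [Fintype L]
    (hK : Fintype.card K = q) (hL : Fintype.card L = q ^ 2) :
    ∀ α : L, orderOf α = (q ^ 2 - 1) / 2 → conjSpan K q 2 α = ⊤ := by
  intro α hα
  have hq_odd : Odd q := hq ▸ hodd.pow
  obtain ⟨m, hm⟩ := hq_odd
  have hcard : (q ^ 2 - 1) / 2 = m * (q + 1) := by
    have : q ^ 2 - 1 = 2 * (m * (q + 1)) := by
      rw [Nat.sub_eq_iff_eq_add (Nat.one_le_pow _ _ (by omega)), hm]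
      ring
    omega
  have hα0 : α ≠ 0 := by
    rintro rfl
    rw [orderOf_zero, hcard] at hα
    have : 0 < m * (q + 1) := Nat.mul_pos (by omega) (by omega)
    omega
  have hrank : Module.finrank K L = 2 := by
    have h := Module.card_eq_pow_finrank (K := K) (V := L)
    rw [hK, hL] at h
    exact (Nat.pow_right_injective (by omega : 2 ≤ q) h).symm
  have hne : ∀ c : K, c • α ≠ α ^ q := by
    intro c hc
    have hpow : algebraMap K L c = α ^ (q - 1) := by
      apply mul_right_cancel₀ hα0
      rw [← Algebra.smul_def, hc, ← pow_succ, Nat.sub_add_cancel (by omega)]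
    have hc0 : c ≠ 0 := by
      rintro rfl
      rw [map_zero] at hpow
      exact pow_ne_zero _ hα0 hpow.symm
    have hone : α ^ ((q - 1) * (q - 1)) = 1 := by
      rw [pow_mul, ← hpow, ← map_pow, ← hK, FiniteField.pow_card_sub_one_eq_one c hc0, map_one]
    have hdvd := orderOf_dvd_of_pow_eq_one hone
    have hsq : (q - 1) * (q - 1) = m * (4 * m) := by
      rw [hm, Nat.add_sub_cancel]
      ring
    rw [hα, hcard, hsq] at hdvd
    have hdvd' : q + 1 ∣ 4 * m := Nat.dvd_of_mul_dvd_mul_left (by omega) hdvd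
    have hfour : q + 1 ∣ 4 := by
      refine (Nat.dvd_add_right hdvd').mp ?_
      exact ⟨2, by omega⟩
    have := Nat.le_of_dvd (by omega) hfour
    omega
  have hindep : LinearIndependent K fun i : Fin 2 => α ^ q ^ (i : ℕ) := by
    have hpair : (fun i : Fin 2 => α ^ q ^ (i : ℕ)) = ![α, α ^ q] := by
      ext i
      fin_cases i <;> simp
    rw [hpair, LinearIndependent.pair_iff' hα0]
    exact hne
  exact hindep.span_eq_top_of_card_eq_finrank' (by simp [hrank])
end
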